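/- arXiv:math/9810012 — 3 statements merged into one kernel-verified Lean document; each statement's English description precedes it below -/
import Mathlib

section
/- For every n ≥ 1, the space T(n,1) has exactly n+1 connected components, and every connected component of T(n,1) is contractible. -/
noncomputable section

open scoped Classical

/-- `Sym^n ℝ`, the `n`-fold symmetric product of `ℝ` with the quotient topology:
the quotient of `ℝ^n` identifying tuples with the same underlying multiset.
Its points are effective divisors of degree `n` on `ℝ`. -/
def SymDiv (n : ℕ) :=
  Quotient (Setoid.ker (fun u : Fin n → ℝ => (↑(List.ofFn u) : Multiset ℝ)))

instance (n : ℕ) : TopologicalSpace (SymDiv n) :=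
  inferInstanceAs (TopologicalSpace (Quotient _))

/-- The multiplicity of the point `x` in the degree-`n` divisor `ζ`. -/
noncomputable def multOf {n : ℕ} (ζ : SymDiv n) (x : ℝ) : ℕ :=
  Quotient.liftOn ζ (fun u => Multiset.count x (↑(List.ofFn u) : Multiset ℝ))
    (fun _ _ h => congrArg (Multiset.count x) h)

/-- `S(n,m)`: tuples of `m+1` effective degree-`n` divisors on `ℝ` such that no point of
`ℝ` lies in the support of all of them. -/
def Sspace (n m : ℕ) : Set (Fin (m + 1) → SymDiv n) :=
  {ζ | ∀ x : ℝ, ∃ i, multOf (ζ i) x = 0}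

/-- The equivalence relation on `S(n,m)` identifying two tuples of divisors whenever,
at every point of `ℝ`, the multiplicities in corresponding divisors agree mod `2`. -/
def Tsetoid (n m : ℕ) : Setoid ↥(Sspace n m) :=
  Setoid.ker (fun ζ => fun (i : Fin (m + 1)) (x : ℝ) => multOf (ζ.1 i) x % 2)

/-- `T(n,m)`: the space of mod-2 particle configurations, i.e. the quotient of `S(n,m)`
by mod-2 equality of multiplicities, with the quotient topology. -/
def Tspace (n m : ℕ) := Quotient (Tsetoid n m)

instance (n m : ℕ) : TopologicalSpace (Tspace n m) :=
  inferInstanceAs (TopologicalSpace (Quotient _))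

namespace ModTwo

open Set Filter Topology

variable {n : ℕ}

/-- The divisor of a tuple. -/
def divisor (u : Fin n → ℝ) : SymDiv n := Quotient.mk _ u

theorem multOf_divisor (u : Fin n → ℝ) (x : ℝ) :
    multOf (divisor u) x = (Finset.univ.filter fun i => u i = x).card := by
  change Multiset.count x (↑(List.ofFn u) : Multiset ℝ) = _
  have : (↑(List.ofFn u) : Multiset ℝ) = Multiset.map u Finset.univ.val := by
    simp [List.ofFn_eq_map, Fin.univ_def]
  rw [this, Multiset.count_map]
  simp [Finset.card_def, eq_comm]

theorem divisor_eq_iff {u v : Fin n → ℝ} :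
    divisor u = divisor v ↔ ∃ σ : Equiv.Perm (Fin n), v = u ∘ σ := by
  have h0 : divisor u = divisor v ↔ (List.ofFn u).Perm (List.ofFn v) :=
    Quotient.eq.trans Multiset.coe_eq_coe
  rw [h0]
  constructor
  · intro h
    have h2 : List.ofFn (u ∘ Tuple.sort u) = List.ofFn (v ∘ Tuple.sort v) := by
      have p := ((Tuple.sort u).ofFn_comp_perm u).trans
        (h.trans ((Tuple.sort v).ofFn_comp_perm v).symm)
      exact p.eq_of_pairwise' (Tuple.monotone_sort u).sortedLE_ofFn.pairwise
        (Tuple.monotone_sort v).sortedLE_ofFn.pairwise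
    have h3 := List.ofFn_injective h2
    refine ⟨(Tuple.sort v).symm.trans (Tuple.sort u), ?_⟩
    funext i
    have := congrFun h3 ((Tuple.sort v).symm i)
    simpa using this.symm
  · rintro ⟨σ, rfl⟩
    exact (σ.ofFn_comp_perm u).symm

theorem isOpenQuotientMap_divisor : IsOpenQuotientMap (divisor (n := n)) := by
  refine ⟨Quotient.mk_surjective, continuous_quotient_mk', fun U hU => ?_⟩
  have hq : IsQuotientMap (divisor (n := n)) := isQuotientMap_quotient_mk'
  rw [← hq.isOpen_preimage]
  have : divisor ⁻¹' (divisor '' U) =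
      ⋃ σ : Equiv.Perm (Fin n), (fun u : Fin n → ℝ => u ∘ σ) ⁻¹' U := by
    ext u
    simp only [mem_preimage, mem_image, mem_iUnion]
    constructor
    · rintro ⟨v, hv, h⟩
      obtain ⟨σ, rfl⟩ := divisor_eq_iff.1 h.symm
      exact ⟨σ, hv⟩
    · rintro ⟨σ, h⟩
      exact ⟨_, h, (divisor_eq_iff.2 ⟨σ, rfl⟩).symm⟩
  rw [this]
  refine isOpen_iUnion fun σ => hU.preimage ?_
  exact continuous_pi fun i => continuous_apply _

/-- Pairs of tuples of points of `ℝ` without a common point. -/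
def Shat (n : ℕ) : Set (Fin 2 → Fin n → ℝ) :=
  Pi.map (fun _ => divisor) ⁻¹' Sspace n 1

theorem mem_Shat {a : Fin 2 → Fin n → ℝ} : a ∈ Shat n ↔ ∀ i j, a 0 i ≠ a 1 j := by
  have : a ∈ Shat n ↔ ∀ x, ∃ κ : Fin 2, multOf (divisor (a κ)) x = 0 := Iff.rfl
  rw [this]
  simp only [multOf_divisor, Finset.card_eq_zero, Finset.filter_eq_empty_iff, Fin.exists_fin_two,
    Finset.mem_univ, true_implies]
  constructor
  · intro h i j hij
    rcases h (a 0 i) with h | h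
    · exact h rfl
    · exact h hij.symm
  · intro h x
    by_contra! hx
    obtain ⟨⟨i, hi⟩, ⟨j, hj⟩⟩ := hx
    exact h i j (hi.trans hj.symm)

theorem ne_of_mem_Shat {a : Fin 2 → Fin n → ℝ} (h : a ∈ Shat n) {κ l : Fin 2} (hkl : κ ≠ l)
    (i j) : a κ i ≠ a l j := by
  rw [mem_Shat] at h
  fin_cases κ <;> fin_cases l
  · exact absurd rfl hkl
  · exact h i j
  · exact (h j i).symm
  · exact absurd rfl hkl

theorem isOpen_Shat : IsOpen (Shat n) := by
  have : Shat n = ⋂ i, ⋂ j, {a : Fin 2 → Fin n → ℝ | a 0 i ≠ a 1 j} := by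
    ext a; simp [mem_Shat]
  rw [this]
  refine isOpen_iInter_of_finite fun i => isOpen_iInter_of_finite fun j => ?_
  exact isOpen_ne_fun (by fun_prop) (by fun_prop)

/-- The configuration of a pair of tuples. -/
def config (a : Shat n) : Tspace n 1 :=
  Quotient.mk (Tsetoid n 1) ((Sspace n 1).restrictPreimage (Pi.map (fun _ => divisor)) a)

theorem isQuotientMap_config : IsQuotientMap (config (n := n)) := by
  have h1 : IsOpenQuotientMap (Pi.map (fun _ : Fin 2 => divisor (n := n))) :=
    IsOpenQuotientMap.piMap fun _ => isOpenQuotientMap_divisor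
  have h2 : IsQuotientMap (Quotient.mk (Tsetoid n 1)) := isQuotientMap_quotient_mk'
  exact h2.comp (h1.restrictPreimage (Sspace n 1)).isQuotientMap

theorem continuous_config : Continuous (config (n := n)) := isQuotientMap_config.continuous

/-- The points which occur an odd number of times in a tuple. -/
def oddPoints {ι : Type*} [Fintype ι] (u : ι → ℝ) : Finset ℝ :=
  (Finset.univ.image u).filter fun x => Odd (Finset.univ.filter fun i => u i = x).card

theorem mem_oddPoints {ι : Type*} [Fintype ι] {u : ι → ℝ} {x : ℝ} :
    x ∈ oddPoints u ↔ Odd (Finset.univ.filter fun i => u i = x).card := by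
  rw [oddPoints, Finset.mem_filter, and_iff_right_iff_imp]
  intro h
  obtain ⟨i, hi⟩ := Finset.card_pos.1 h.pos
  simp only [Finset.mem_filter, Finset.mem_univ, true_and] at hi
  simp only [Finset.mem_image, Finset.mem_univ, true_and]
  exact ⟨i, hi⟩

theorem exists_of_mem_oddPoints {ι : Type*} [Fintype ι] {u : ι → ℝ} {x : ℝ}
    (h : x ∈ oddPoints u) : ∃ i, u i = x := by
  rw [oddPoints, Finset.mem_filter] at h
  simpa using h.1

theorem config_eq_iff {a b : Shat n} :
    config a = config b ↔ ∀ κ, oddPoints (a.1 κ) = oddPoints (b.1 κ) := by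
  have h0 : config a = config b ↔
      (fun (i : Fin 2) (x : ℝ) => multOf (divisor (a.1 i)) x % 2) =
      (fun (i : Fin 2) (x : ℝ) => multOf (divisor (b.1 i)) x % 2) := Quotient.eq
  rw [h0]
  simp only [funext_iff, multOf_divisor, Finset.ext_iff, mem_oddPoints]
  refine forall_congr' fun κ => forall_congr' fun x => ?_
  simp only [Nat.odd_iff]
  omega

/-- The points of given colour in a configuration. -/
def pts (t : Tspace n 1) (κ : Fin 2) : Finset ℝ :=
  oddPoints ((Function.surjInv isQuotientMap_config.surjective t).1 κ)

theorem pts_config (a : Shat n) (κ : Fin 2) : pts (config a) κ = oddPoints (a.1 κ) :=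
  config_eq_iff.1 (Function.surjInv_eq isQuotientMap_config.surjective (config a)) κ

theorem ext_pts {t t' : Tspace n 1} (h : ∀ κ, pts t κ = pts t' κ) : t = t' := by
  obtain ⟨a, rfl⟩ := isQuotientMap_config.surjective t
  obtain ⟨b, rfl⟩ := isQuotientMap_config.surjective t'
  exact config_eq_iff.2 fun κ => by rw [← pts_config, h, pts_config]

theorem pts_disjoint (t : Tspace n 1) {κ l : Fin 2} (h : κ ≠ l) {x : ℝ} (hx : x ∈ pts t κ) :
    x ∉ pts t l := by
  obtain ⟨a, rfl⟩ := isQuotientMap_config.surjective t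
  rw [pts_config] at hx ⊢
  intro hx'
  obtain ⟨i, hi⟩ := exists_of_mem_oddPoints hx
  obtain ⟨j, hj⟩ := exists_of_mem_oddPoints hx'
  exact ne_of_mem_Shat a.2 h i j (hi.trans hj.symm)

theorem card_oddPoints_filter {ι : Type*} [Fintype ι] (u : ι → ℝ) (P : ℝ → Prop)
    [DecidablePred P] :
    ((oddPoints u).filter P).card ≤ (Finset.univ.filter fun i => P (u i)).card ∧
    (Odd ((oddPoints u).filter P).card ↔ Odd (Finset.univ.filter fun i => P (u i)).card) := by
  have h := Finset.card_eq_sum_card_image u (Finset.univ.filter fun i => P (u i))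
  have hA : (oddPoints u).filter P =
      ((Finset.univ.filter fun i => P (u i)).image u).filter
        (fun b => Odd ((Finset.univ.filter fun i => P (u i)).filter fun i => u i = b).card) := by
    ext x
    have key : P x → ((Finset.univ.filter fun i => P (u i)).filter fun i => u i = x) =
        Finset.univ.filter fun i => u i = x := by
      intro hx
      ext i
      simp only [Finset.mem_filter, Finset.mem_univ, true_and]
      constructor
      · exact And.right
      · exact fun h => ⟨h ▸ hx, h⟩
    simp only [Finset.mem_filter, Finset.mem_image, Finset.mem_univ, true_and]
    constructor
    · rintro ⟨h1, h2⟩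
      obtain ⟨i, hi⟩ := exists_of_mem_oddPoints h1
      refine ⟨⟨i, hi ▸ h2, hi⟩, ?_⟩
      have := key h2
      simp only [Finset.filter_filter] at this ⊢
      rw [this]
      exact mem_oddPoints.1 h1
    · rintro ⟨⟨i, h1, h2⟩, h3⟩
      have hx : P x := h2 ▸ h1
      refine ⟨mem_oddPoints.2 ?_, hx⟩
      have := key hx
      simp only [Finset.filter_filter] at this h3
      rwa [this] at h3
  constructor
  · rw [hA]
    exact (Finset.card_filter_le _ _).trans Finset.card_image_le
  · rw [h, hA, Finset.odd_sum_iff_odd_card_odd]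

theorem exists_of_pts (n : ℕ) (E : Fin 2 → Finset ℝ) (hd : Disjoint (E 0) (E 1))
    (hle : ∀ κ, (E κ).card ≤ n) (hpar : ∀ κ, Even (n - (E κ).card)) :
    ∃ t : Tspace n 1, ∀ κ, pts t κ = E κ := by
  obtain ⟨B, hB⟩ : ∃ B : ℝ, ∀ κ, ∀ x ∈ E κ, x < B := by
    obtain ⟨B, hB⟩ := (E 0 ∪ E 1).bddAbove
    refine ⟨B + 1, fun κ x hx => ?_⟩
    have : x ∈ (↑(E 0 ∪ E 1) : Set ℝ) := by
      fin_cases κ <;> simp_all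
    linarith [hB this]
  have key : ∀ κ : Fin 2, ∃ u : Fin n → ℝ, oddPoints u = E κ ∧
      ∀ i, u i ∈ E κ ∨ u i = B + (κ : ℕ) := by
    intro κ
    set e := (E κ).equivFin
    let f : Fin n → ℝ := fun i => if h : (i : ℕ) < (E κ).card then ((e.symm ⟨i, h⟩ : E κ) : ℝ)
      else B + (κ : ℕ)
    refine ⟨f, ?_, ?_⟩
    · ext x
      rw [mem_oddPoints]
      by_cases hx : x ∈ E κ
      · simp only [hx, iff_true]
        have : (Finset.univ.filter fun i => f i = x) =
            {⟨(e ⟨x, hx⟩ : ℕ), (e ⟨x, hx⟩).2.trans_le (hle κ)⟩} := by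
          ext i
          simp only [Finset.mem_filter, Finset.mem_univ, true_and, Finset.mem_singleton, f]
          constructor
          · intro h
            split_ifs at h with h1
            · have h2 : e.symm ⟨i, h1⟩ = ⟨x, hx⟩ := Subtype.ext h
              rw [Equiv.symm_apply_eq] at h2
              ext
              simp [← h2]
            · exfalso
              have h3 := hB κ x hx
              rw [← h] at h3
              have : (0:ℝ) ≤ (κ : ℕ) := Nat.cast_nonneg _
              linarith
          · rintro rfl
            simp
        rw [this]; simp
      · simp only [hx, iff_false, Nat.not_odd_iff_even]
        by_cases hxB : x = B + (κ : ℕ)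
        · have h1 : (Finset.univ.filter fun i => f i = x) =
              Finset.univ.filter fun i : Fin n => ¬ (i : ℕ) < (E κ).card := by
            ext i
            simp only [Finset.mem_filter, Finset.mem_univ, true_and, f]
            split_ifs with h
            · simp only [h, not_true_eq_false, iff_false]
              intro h'
              exact hx (h' ▸ (e.symm ⟨i, h⟩).2)
            · simp [h, hxB]
          have h2 : (Finset.univ.filter fun i : Fin n => (i : ℕ) < (E κ).card).card =
              (E κ).card := by
            rw [Fin.card_filter_val_lt]
            exact min_eq_right (hle κ)
          have h3 := Finset.card_filter_add_card_filter_not (s := (Finset.univ : Finset (Fin n)))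
            (fun i : Fin n => (i : ℕ) < (E κ).card)
          rw [h2, Finset.card_univ, Fintype.card_fin] at h3
          rw [h1]
          convert hpar κ using 1
          omega
        · rw [Finset.filter_false_of_mem]
          · simp
          · intro i _ h
            simp only [f] at h
            split_ifs at h with h'
            · exact hx (h ▸ (e.symm ⟨i, h'⟩).2)
            · exact hxB h.symm
    · intro i
      simp only [f]
      split_ifs with h
      · exact Or.inl (e.symm ⟨i, h⟩).2
      · exact Or.inr rfl
  choose a ha ha' using key
  have hS : a ∈ Shat n := by
    rw [mem_Shat]
    intro i j h
    rcases ha' 0 i with h1 | h1 <;> rcases ha' 1 j with h2 | h2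
    · exact Finset.disjoint_left.1 hd h1 (h ▸ h2)
    · have := hB 0 _ h1
      rw [h, h2] at this
      norm_num at this
    · have := hB 1 _ h2
      rw [← h, h1] at this
      norm_num at this
    · rw [h1, h2] at h
      norm_num at h
  exact ⟨config ⟨a, hS⟩, fun κ => by rw [pts_config, ha]⟩

/-- The mod 2 image of a finite set under a map. -/
def oddMap (ψ : ℝ → ℝ) (E : Finset ℝ) : Finset ℝ :=
  (E.image ψ).filter fun y => Odd (E.filter fun x => ψ x = y).card

theorem mem_oddMap {ψ : ℝ → ℝ} {E : Finset ℝ} {y : ℝ} :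
    y ∈ oddMap ψ E ↔ Odd (E.filter fun x => ψ x = y).card := by
  rw [oddMap, Finset.mem_filter, and_iff_right_iff_imp]
  intro h
  obtain ⟨i, hi⟩ := Finset.card_pos.1 h.pos
  rw [Finset.mem_filter] at hi
  exact Finset.mem_image.2 ⟨i, hi⟩

theorem oddPoints_comp (u : Fin n → ℝ) (ψ : ℝ → ℝ) :
    oddPoints (fun i => ψ (u i)) = oddMap ψ (oddPoints u) := by
  ext y
  rw [mem_oddMap, mem_oddPoints]
  exact (card_oddPoints_filter u (fun x => ψ x = y)).2.symm

/-- The configuration obtained by moving the points of `c` of colour `κ` by `ψ κ`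
(or `c` itself, if that makes no sense). -/
def push (ψ : Fin 2 → ℝ → ℝ) (c : Tspace n 1) : Tspace n 1 :=
  if h : ∃ c' : Tspace n 1, ∀ κ, pts c' κ = oddMap (ψ κ) (pts c κ) then h.choose else c

theorem push_eq {ψ : Fin 2 → ℝ → ℝ} {c c' : Tspace n 1}
    (h : ∀ κ, pts c' κ = oddMap (ψ κ) (pts c κ)) : push ψ c = c' := by
  have hex : ∃ c' : Tspace n 1, ∀ κ, pts c' κ = oddMap (ψ κ) (pts c κ) := ⟨c', h⟩
  rw [push, dif_pos hex]
  exact ext_pts fun κ => by rw [hex.choose_spec, h]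

theorem continuousWithinAt_push {Z : Type*} [TopologicalSpace Z] {S : Set (Shat n × Z)}
    {ω₀ : Shat n × Z} (hω₀ : ω₀ ∈ S) {ψ : Shat n × Z → Fin 2 → ℝ → ℝ}
    (D : Fin 2 → Finset (Fin n))
    (hc : ∀ κ, ∀ i ∉ D κ, ContinuousWithinAt (fun ω => ψ ω κ (ω.1.1 κ i)) S ω₀)
    (hD : ∀ᶠ ω in 𝓝[S] ω₀, ∀ κ y, Even ((D κ).filter fun i => ψ ω κ (ω.1.1 κ i) = y).card)
    (hne : ∀ i ∉ D 0, ∀ j ∉ D 1, ψ ω₀ 0 (ω₀.1.1 0 i) ≠ ψ ω₀ 1 (ω₀.1.1 1 j)) :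
    ContinuousWithinAt (fun ω => push (ψ ω) (config ω.1)) S ω₀ ∧
      ∀ κ, pts (push (ψ ω₀) (config ω₀.1)) κ = oddMap (ψ ω₀ κ) (pts (config ω₀.1) κ) := by
  obtain ⟨B, hB⟩ : ∃ B : ℝ, ∀ κ i, ψ ω₀ κ (ω₀.1.1 κ i) < B := by
    obtain ⟨B, hB⟩ := (Set.finite_range
      fun p : Fin 2 × Fin n => ψ ω₀ p.1 (ω₀.1.1 p.1 p.2)).bddAbove
    refine ⟨B + 1, fun κ i => ?_⟩
    linarith [hB ⟨(κ, i), rfl⟩]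
  let g : Shat n × Z → Fin 2 → Fin n → ℝ := fun ω κ i =>
    if i ∈ D κ then B + (κ : ℕ) else ψ ω κ (ω.1.1 κ i)
  have hg : ContinuousWithinAt g S ω₀ := by
    refine continuousWithinAt_pi.2 fun κ => continuousWithinAt_pi.2 fun i => ?_
    by_cases hi : i ∈ D κ
    · simp only [g, hi, if_true]; exact continuousWithinAt_const
    · simp only [g, hi, if_false]; exact hc κ i hi
  have hg0 : g ω₀ ∈ Shat n := by
    rw [mem_Shat]
    intro i j
    simp only [g]
    split_ifs with h1 h2 h2
    · norm_num
    · have := hB 1 j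
      norm_num
      linarith
    · have := hB 0 i
      norm_num
      linarith
    · exact hne i h1 j h2
  have hgS : ∀ᶠ ω in 𝓝[S] ω₀, g ω ∈ Shat n := hg.eventually (isOpen_Shat.mem_nhds hg0)
  have hpar : ∀ᶠ ω in 𝓝[S] ω₀, ∀ κ, oddPoints (g ω κ) = oddMap (ψ ω κ) (pts (config ω.1) κ) := by
    filter_upwards [hD] with ω hω κ
    rw [pts_config, ← oddPoints_comp]
    ext y
    rw [mem_oddPoints, mem_oddPoints]
    have hDe : Even (D κ).card := by
      rw [Finset.card_eq_sum_card_image (fun i => ψ ω κ (ω.1.1 κ i)) (D κ)]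
      exact Finset.even_sum _ fun y _ => hω κ y
    have e1 := Finset.card_filter_add_card_filter_not
      (s := Finset.univ.filter fun i => g ω κ i = y) (fun i => i ∈ D κ)
    have e2 := Finset.card_filter_add_card_filter_not
      (s := Finset.univ.filter fun i => ψ ω κ (ω.1.1 κ i) = y) (fun i => i ∈ D κ)
    have e3 : ((Finset.univ.filter fun i => g ω κ i = y).filter fun i => ¬ i ∈ D κ) =
        (Finset.univ.filter fun i => ψ ω κ (ω.1.1 κ i) = y).filter fun i => ¬ i ∈ D κ := by
      ext i
      by_cases hi : i ∈ D κ <;> simp [g, hi]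
    have e4 : Even ((Finset.univ.filter fun i => g ω κ i = y).filter fun i => i ∈ D κ).card := by
      have : ((Finset.univ.filter fun i => g ω κ i = y).filter fun i => i ∈ D κ) =
          if B + ((κ : ℕ) : ℝ) = y then D κ else ∅ := by
        ext i
        by_cases hi : i ∈ D κ
        · by_cases hy : B + ((κ : ℕ) : ℝ) = y <;> simp [g, hi, hy]
        · by_cases hy : B + ((κ : ℕ) : ℝ) = y <;> simp [hi, hy]
      rw [this]
      split_ifs
      · exact hDe
      · simp
    have e5 : Even ((Finset.univ.filter fun i => ψ ω κ (ω.1.1 κ i) = y).filter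
        fun i => i ∈ D κ).card := by
      convert hω κ y using 2
      ext i
      simp [and_comm]
    rw [← e1, ← e2, e3, Nat.odd_add', Nat.odd_add']
    simp only [e4, e5]
  let G : Shat n × Z → Shat n := fun ω => if h : g ω ∈ Shat n then ⟨g ω, h⟩ else ⟨g ω₀, hg0⟩
  have hGv : ∀ ω, g ω ∈ Shat n → (G ω).1 = g ω := fun ω h => by simp only [G, h, dif_pos]
  have hG : ContinuousWithinAt G S ω₀ := by
    rw [IsInducing.subtypeVal.continuousWithinAt_iff]
    refine hg.congr_of_eventuallyEq ?_ (hGv _ hg0)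
    filter_upwards [hgS] with ω hω using hGv ω hω
  have hpush : ∀ᶠ ω in 𝓝[S] ω₀, push (ψ ω) (config ω.1) = config (G ω) := by
    filter_upwards [hgS, hpar] with ω h1 h2
    exact push_eq fun κ => by rw [pts_config, hGv ω h1, h2]
  have hpush0 := hpush.self_of_nhdsWithin hω₀
  refine ⟨?_, fun κ => ?_⟩
  · exact (continuous_config.continuousAt.comp_continuousWithinAt hG).congr_of_eventuallyEq
      hpush hpush0
  · rw [hpush0, pts_config, hGv _ hg0, hpar.self_of_nhdsWithin hω₀]

theorem isClosed_of_config {Z : Type*} [TopologicalSpace Z] [LocallyCompactSpace Z]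
    {K : Set (Tspace n 1 × Z)}
    (h : IsClosed {ω : Shat n × Z | (config ω.1, ω.2) ∈ K}) : IsClosed K := by
  rw [← isOpen_compl_iff] at h ⊢
  have h' : Continuous fun ω : Shat n × Z => (config ω.1, ω.2) ∈ Kᶜ := continuous_Prop.2 h
  exact continuous_Prop.1 (isQuotientMap_config.continuous_lift_prod_left h')

theorem continuousOn_of_config {Z Y : Type*} [TopologicalSpace Z] [LocallyCompactSpace Z]
    [TopologicalSpace Y] {C : Set (Tspace n 1 × Z)} (hC : IsClosed C) {G : Tspace n 1 × Z → Y}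
    (h : ContinuousOn (fun ω : Shat n × Z => G (config ω.1, ω.2))
      {ω | (config ω.1, ω.2) ∈ C}) : ContinuousOn G C := by
  rw [continuousOn_iff_isClosed]
  intro t ht
  refine ⟨G ⁻¹' t ∩ C, isClosed_of_config ?_, by rw [inter_assoc, inter_self]⟩
  have hC' : IsClosed {ω : Shat n × Z | (config ω.1, ω.2) ∈ C} :=
    hC.preimage (f := fun ω : Shat n × Z => (config ω.1, ω.2))
      ((continuous_config.comp continuous_fst).prodMk continuous_snd)
  have := h.preimage_isClosed_of_isClosed hC' ht
  convert this using 1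
  ext ω
  simp [and_comm]

/-- The effect on the height of crossing a point of colour `κ`. -/
def step (κ : Fin 2) (v : ℤ) : ℤ := v + if (κ = 0 ↔ Even v) then 1 else -1

theorem even_step {κ : Fin 2} {v : ℤ} : Even (step κ v) ↔ ¬ Even v := by
  unfold step
  split_ifs <;> simp [Int.even_add]

theorem step_step (κ : Fin 2) (v : ℤ) : step κ (step κ v) = v := by
  have h1 := even_step (κ := κ) (v := v)
  conv_lhs => rw [step]
  simp only [h1]
  unfold step
  by_cases h : κ = 0 <;> by_cases h' : Even v <;> simp [h, h']

theorem step_injective (κ : Fin 2) : Function.Injective (step κ) :=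
  Function.Involutive.injective (step_step κ)

theorem step_eq (κ : Fin 2) (v : ℤ) : step κ v = v + 1 ∨ step κ v = v - 1 := by
  unfold step
  split_ifs <;> simp [sub_eq_add_neg]

theorem step_ne {κ l : Fin 2} (h : κ ≠ l) (v : ℤ) : step κ v = 2 * v - step l v := by
  unfold step
  by_cases h' : Even v <;> fin_cases κ <;> fin_cases l <;>
    simp [h', -Int.not_even_iff_odd] at h ⊢ <;> ring

/-- All points of a configuration. -/
def supp (c : Tspace n 1) : Finset ℝ := pts c 0 ∪ pts c 1

theorem mem_supp {c : Tspace n 1} {x : ℝ} : x ∈ supp c ↔ ∃ κ, x ∈ pts c κ := by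
  simp [supp, Fin.exists_fin_two]

theorem mem_pts_zero_iff {c : Tspace n 1} {x : ℝ} {κ : Fin 2} (h : x ∈ pts c κ) :
    x ∈ pts c 0 ↔ κ = 0 := by
  constructor
  · intro h0
    by_contra hne
    exact pts_disjoint c hne h h0
  · rintro rfl
    exact h

/-- The sign with which a point of a configuration contributes to the height. -/
def sign (c : Tspace n 1) (p : ℝ) : ℤ :=
  if (p ∈ pts c 0 ↔ Even ((supp c).filter (· < p)).card) then 1 else -1

/-- The height function of a configuration. -/
def height (c : Tspace n 1) (x : ℝ) : ℤ := ∑ p ∈ (supp c).filter (· < x), sign c p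

theorem even_sum_sign (c : Tspace n 1) (F : Finset ℝ) :
    Even (∑ p ∈ F, sign c p) ↔ Even F.card := by
  induction F using Finset.induction_on with
  | empty => simp
  | insert a s ha ih =>
    rw [Finset.sum_insert ha, Finset.card_insert_of_notMem ha, Int.even_add, ih, Nat.even_add_one]
    unfold sign
    split_ifs <;> simp

theorem height_eq_of_forall {c : Tspace n 1} {x y : ℝ}
    (h : ∀ p ∈ supp c, p < x ↔ p < y) : height c x = height c y := by
  unfold height
  rw [Finset.filter_congr h]

theorem height_jump {c : Tspace n 1} {κ : Fin 2} {p x : ℝ} (hp : p ∈ pts c κ) (hx : p < x)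
    (h : ∀ q ∈ supp c, q < x → q ≤ p) : height c x = step κ (height c p) := by
  have : (supp c).filter (· < x) = insert p ((supp c).filter (· < p)) := by
    ext q
    simp only [Finset.mem_filter, Finset.mem_insert]
    constructor
    · rintro ⟨h1, h2⟩
      rcases (h q h1 h2).eq_or_lt with h3 | h3
      · exact Or.inl h3
      · exact Or.inr ⟨h1, h3⟩
    · rintro (rfl | ⟨h1, h2⟩)
      · exact ⟨mem_supp.2 ⟨κ, hp⟩, hx⟩
      · exact ⟨h1, h2.trans hx⟩
  unfold height
  rw [this, Finset.sum_insert (by simp), step, add_comm]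
  simp only [even_sum_sign]
  rw [sign]
  simp only [mem_pts_zero_iff hp]

theorem height_of_monochromatic {c : Tspace n 1} {κ : Fin 2} {x y : ℝ} (hxy : x ≤ y)
    (h : ∀ l ≠ κ, ∀ p ∈ pts c l, ¬ (x ≤ p ∧ p < y)) :
    height c y = if Odd ((pts c κ).filter fun p => x ≤ p ∧ p < y).card
      then step κ (height c x) else height c x := by
  induction hk : ((pts c κ).filter fun p => x ≤ p ∧ p < y).card generalizing y with
  | zero =>
    rw [if_neg (by simp)]
    refine height_eq_of_forall fun p hp => ?_
    refine ⟨fun hy => ?_, fun hx => hx.trans_le hxy⟩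
    by_contra hx
    push Not at hx
    obtain ⟨l, hl⟩ := mem_supp.1 hp
    by_cases hlk : l = κ
    · subst hlk
      rw [Finset.card_eq_zero, Finset.filter_eq_empty_iff] at hk
      exact hk hl ⟨hx, hy⟩
    · exact h l hlk p hl ⟨hx, hy⟩
  | succ k ih =>
    have hne : ((pts c κ).filter fun p => x ≤ p ∧ p < y).Nonempty := by
      rw [← Finset.card_pos]; omega
    obtain ⟨p, hp, hmax⟩ := Finset.exists_max_image _ id hne
    rw [Finset.mem_filter] at hp
    have hmax' : ∀ q ∈ pts c κ, q < y → q ≤ p := by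
      intro q hq hqy
      by_contra! hlt
      exact absurd (hmax q (Finset.mem_filter.2 ⟨hq, hp.2.1.trans hlt.le, hqy⟩)) (not_le.2 hlt)
    have h1 : height c y = step κ (height c p) := by
      refine height_jump hp.1 hp.2.2 fun q hq hqy => ?_
      obtain ⟨l, hl⟩ := mem_supp.1 hq
      by_cases hlk : l = κ
      · exact hmax' q (hlk ▸ hl) hqy
      · by_contra! hlt
        exact h l hlk q hl ⟨hp.2.1.trans hlt.le, hqy⟩
    have hfil : ((pts c κ).filter fun q => x ≤ q ∧ q < y) =
        insert p ((pts c κ).filter fun q => x ≤ q ∧ q < p) := by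
      ext q
      simp only [Finset.mem_filter, Finset.mem_insert]
      constructor
      · rintro ⟨a1, a2, a3⟩
        rcases (hmax' q a1 a3).eq_or_lt with h3 | h3
        · exact Or.inl h3
        · exact Or.inr ⟨a1, a2, h3⟩
      · rintro (rfl | ⟨a1, a2, a3⟩)
        · exact hp
        · exact ⟨a1, a2, a3.trans hp.2.2⟩
    rw [hfil, Finset.card_insert_of_notMem (by simp)] at hk
    have h2 := ih hp.2.1 (fun l hl q hq hq' => h l hl q hq ⟨hq'.1, hq'.2.trans hp.2.2⟩)
      (by omega)
    rw [h1, h2]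
    by_cases hodd : Odd k
    · rw [if_pos hodd, if_neg, step_step]
      simpa [Nat.even_add_one, ← Nat.not_even_iff_odd] using hodd
    · rw [if_neg hodd, if_pos]
      simpa [Nat.even_add_one, ← Nat.not_even_iff_odd] using hodd

theorem height_config_of_monochromatic {a : Shat n} {κ : Fin 2} {x y : ℝ} (hxy : x ≤ y)
    (h : ∀ l ≠ κ, ∀ i, ¬ (x ≤ a.1 l i ∧ a.1 l i < y)) :
    height (config a) y = if Odd (Finset.univ.filter fun i => x ≤ a.1 κ i ∧ a.1 κ i < y).card
      then step κ (height (config a) x) else height (config a) x := by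
  rw [height_of_monochromatic (κ := κ) hxy, pts_config]
  · simp only [(card_oddPoints_filter (a.1 κ) fun p => x ≤ p ∧ p < y).2]
  · intro l hl p hp
    rw [pts_config] at hp
    obtain ⟨i, rfl⟩ := exists_of_mem_oddPoints hp
    exact h l hl i

/-- The effect on the height of crossing `p`. -/
def jump (c : Tspace n 1) (p : ℝ) (v : ℤ) : ℤ :=
  if p ∈ pts c 0 then step 0 v else if p ∈ pts c 1 then step 1 v else v

theorem jump_of_mem {c : Tspace n 1} {κ : Fin 2} {p : ℝ} (h : p ∈ pts c κ) (v : ℤ) :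
    jump c p v = step κ v := by
  unfold jump
  fin_cases κ
  · exact if_pos h
  · rw [if_neg fun h0 => pts_disjoint c zero_ne_one h0 h]
    exact if_pos h

theorem jump_of_notMem {c : Tspace n 1} {p : ℝ} (h : p ∉ supp c) (v : ℤ) : jump c p v = v := by
  rw [mem_supp, not_exists] at h
  unfold jump
  rw [if_neg (h 0), if_neg (h 1)]

theorem jump_injective (c : Tspace n 1) (p : ℝ) : Function.Injective (jump c p) := by
  unfold jump
  split_ifs
  · exact step_injective 0
  · exact step_injective 1
  · exact fun _ _ h => h

theorem eventually_notMem_Ico (F : Finset ℝ) (p : ℝ) :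
    ∀ᶠ x in 𝓝[<] p, ∀ q ∈ F, q < p → q < x := by
  rw [Filter.eventually_all_finset]
  intro q _
  by_cases h : q < p
  · filter_upwards [mem_nhdsWithin_of_mem_nhds (Ioi_mem_nhds h)] with x hx _ using hx
  · exact Eventually.of_forall fun x h' => absurd h' h

theorem eventually_notMem_Ioo (F : Finset ℝ) (p : ℝ) :
    ∀ᶠ x in 𝓝[>] p, ∀ q ∈ F, q < x → q ≤ p := by
  rw [Filter.eventually_all_finset]
  intro q _
  by_cases h : p < q
  · filter_upwards [mem_nhdsWithin_of_mem_nhds (Iio_mem_nhds h)] with x hx h'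
    exact absurd h' (not_lt.2 (le_of_lt hx))
  · exact Eventually.of_forall fun x _ => not_lt.1 h

theorem eventually_height_left (c : Tspace n 1) (p : ℝ) :
    ∀ᶠ x in 𝓝[<] p, height c x = height c p := by
  filter_upwards [eventually_notMem_Ico (supp c) p, self_mem_nhdsWithin] with x hx hxp
  exact height_eq_of_forall fun q hq => ⟨fun h => h.trans hxp, hx q hq⟩

theorem eventually_height_right (c : Tspace n 1) (p : ℝ) :
    ∀ᶠ x in 𝓝[>] p, height c x = jump c p (height c p) := by
  filter_upwards [eventually_notMem_Ioo (supp c) p, self_mem_nhdsWithin] with x hx hxp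
  by_cases h : p ∈ supp c
  · obtain ⟨κ, hκ⟩ := mem_supp.1 h
    rw [jump_of_mem hκ]
    exact height_jump hκ hxp hx
  · rw [jump_of_notMem h]
    refine height_eq_of_forall fun q hq => ⟨fun h' => ?_, fun h' => h'.trans hxp⟩
    exact (hx q hq h').lt_of_ne fun e => h (e ▸ hq)

theorem height_eq_zero {c : Tspace n 1} {x : ℝ} (h : ∀ p ∈ supp c, x ≤ p) : height c x = 0 := by
  unfold height
  rw [Finset.filter_false_of_mem, Finset.sum_empty]
  exact fun p hp => not_lt.2 (h p hp)

theorem eventually_height_atBot (c : Tspace n 1) : ∀ᶠ x in atBot, height c x = 0 := by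
  obtain ⟨B, hB⟩ := (supp c).bddBelow
  filter_upwards [eventually_le_atBot B] with x hx
  exact height_eq_zero fun p hp => hx.trans (hB hp)

/-- A property of real numbers which does not change locally is constant. -/
theorem forall_iff_of_eventually {P : ℝ → Prop} (hl : ∀ p, ∀ᶠ x in 𝓝[<] p, P x ↔ P p)
    (hr : ∀ p, ∀ᶠ x in 𝓝[>] p, P x ↔ P p) (x y : ℝ) : P x ↔ P y := by
  have : IsLocallyConstant P := by
    rw [IsLocallyConstant.iff_eventually_eq]
    intro p
    rw [← nhdsNE_sup_pure, ← Iio_union_Ioi, nhdsWithin_union]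
    simp only [eventually_sup, eventually_pure, eq_iff_iff]
    exact ⟨⟨hl p, hr p⟩, trivial⟩
  exact iff_of_eq (this.apply_eq_of_preconnectedSpace x y)

theorem eq_height {c : Tspace n 1} {F : ℝ → ℤ} (h0 : ∃ x, F x = height c x)
    (hl : ∀ p, ∀ᶠ x in 𝓝[<] p, F x = F p)
    (hr : ∀ p, ∀ᶠ x in 𝓝[>] p, F x = jump c p (F p)) : F = height c := by
  obtain ⟨x₀, hx₀⟩ := h0
  funext x
  refine (forall_iff_of_eventually (P := fun x => F x = height c x) ?_ ?_ x x₀).2 hx₀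
  · intro p
    filter_upwards [hl p, eventually_height_left c p] with x h1 h2
    rw [h1, h2]
  · intro p
    filter_upwards [hr p, eventually_height_right c p] with x h1 h2
    rw [h1, h2]
    exact (jump_injective c p).eq_iff

theorem ext_height {c c' : Tspace n 1} (h : ∃ E : Finset ℝ, ∀ x ∉ E, height c x = height c' x) :
    c = c' := by
  obtain ⟨E, hE⟩ := h
  have key : ∀ x, height c x = height c' x := by
    intro p
    have h1 : ∀ᶠ x in 𝓝[<] p, x ∉ E := by
      filter_upwards [eventually_notMem_Ico E p, self_mem_nhdsWithin] with x hx hxp hxE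
      exact (hx x hxE hxp).false
    obtain ⟨x, hx, h2, h3⟩ := (h1.and
      ((eventually_height_left c p).and (eventually_height_left c' p))).exists
    rw [← h2, ← h3, hE x hx]
  have hj : ∀ p, jump c p (height c p) = jump c' p (height c p) := by
    intro p
    obtain ⟨x, h1, h2⟩ := ((eventually_height_right c p).and (eventually_height_right c' p)).exists
    rw [← h1, key p, ← h2, key x]
  have hs : ∀ κ v, step κ v ≠ v := fun κ v h => by
    rcases step_eq κ v with h' | h' <;> omega
  have h01 : ∀ v, step 0 v ≠ step 1 v := fun v h => by
    have := step_ne zero_ne_one v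
    rcases step_eq 1 v with h' | h' <;> omega
  refine ext_pts fun κ => Finset.ext fun p => ?_
  have := hj p
  have d1 := fun h : p ∈ pts c 0 => pts_disjoint c zero_ne_one h
  have d2 := fun h : p ∈ pts c' 0 => pts_disjoint c' zero_ne_one h
  have e1 := hs 0 (height c p)
  have e2 := hs 1 (height c p)
  have e3 := h01 (height c p)
  unfold jump at this
  generalize height c p = v at this e1 e2 e3
  split_ifs at this <;> fin_cases κ <;> grind

theorem abs_height_le (c : Tspace n 1) (x : ℝ) : |height c x| ≤ 2 * n := by
  have hsign : ∀ p, |sign c p| = 1 := fun p => by unfold sign; split_ifs <;> simp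
  have hcard : ∀ κ, (pts c κ).card ≤ n := by
    intro κ
    obtain ⟨a, rfl⟩ := isQuotientMap_config.surjective c
    have := (card_oddPoints_filter (a.1 κ) fun _ => True).1
    simpa [pts_config] using this
  calc |height c x| ≤ ∑ p ∈ (supp c).filter (· < x), |sign c p| := Finset.abs_sum_le_sum_abs _ _
    _ = ((supp c).filter (· < x)).card := by simp [hsign]
    _ ≤ 2 * n := by
      have h1 := Finset.card_filter_le (supp c) (· < x)
      have h2 := Finset.card_union_le (pts c 0) (pts c 1)
      have h3 := hcard 0
      have h4 := hcard 1
      have h5 : (supp c).card = (pts c 0 ∪ pts c 1).card := rfl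
      omega

theorem continuous_coord (κ : Fin 2) (i : Fin n) : Continuous fun a : Shat n => a.1 κ i :=
  (continuous_apply i).comp ((continuous_apply κ).comp continuous_subtype_val)

theorem exists_of_mem_supp {a : Shat n} {x : ℝ} (h : x ∈ supp (config a)) :
    ∃ κ i, a.1 κ i = x := by
  obtain ⟨κ, hκ⟩ := mem_supp.1 h
  rw [pts_config] at hκ
  exact ⟨κ, exists_of_mem_oddPoints hκ⟩

theorem eventually_lt_iff (a₀ : Shat n) {x : ℝ} (hx : ∀ κ i, a₀.1 κ i ≠ x) :
    ∀ᶠ a in 𝓝 a₀, ∀ κ i, a.1 κ i < x ↔ a₀.1 κ i < x := by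
  rw [eventually_all]
  intro κ
  rw [eventually_all]
  intro i
  rcases (hx κ i).lt_or_gt with h | h
  · filter_upwards [(continuous_coord κ i).continuousAt.eventually_lt continuousAt_const h]
      with a ha
    exact iff_of_true ha h
  · filter_upwards [continuousAt_const.eventually_lt (continuous_coord κ i).continuousAt h]
      with a ha
    exact iff_of_false (not_lt.2 ha.le) (not_lt.2 h.le)

theorem exists_lt_forall_lt (a₀ : Shat n) (x : ℝ) :
    ∃ y < x, ∀ κ i, a₀.1 κ i < x → a₀.1 κ i < y := by
  obtain ⟨y, h1, h2⟩ := ((eventually_notMem_Ico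
    (Finset.univ.image fun p : Fin 2 × Fin n => a₀.1 p.1 p.2) x).and self_mem_nhdsWithin).exists
  exact ⟨y, h2, fun κ i h => h1 _ (Finset.mem_image.2 ⟨(κ, i), Finset.mem_univ _, rfl⟩) h⟩

theorem eventually_height_config (a₀ : Shat n) {x : ℝ} (hx : ∀ κ i, a₀.1 κ i ≠ x) :
    ∀ᶠ a in 𝓝 a₀, height (config a) x = height (config a₀) x := by
  induction hN : (Finset.univ.filter fun p : Fin 2 × Fin n => a₀.1 p.1 p.2 < x).card
    using Nat.strong_induction_on generalizing x with
  | _ N ih =>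
  subst hN
  rcases (Finset.univ.filter fun p : Fin 2 × Fin n => a₀.1 p.1 p.2 < x).eq_empty_or_nonempty
    with he | hne
  · rw [Finset.filter_eq_empty_iff] at he
    have h0 : ∀ κ i, ¬ a₀.1 κ i < x := fun κ i => he (Finset.mem_univ (κ, i))
    filter_upwards [eventually_lt_iff a₀ hx] with a ha
    rw [height_eq_zero, height_eq_zero]
    · intro p hp
      obtain ⟨κ, i, rfl⟩ := exists_of_mem_supp hp
      exact not_lt.1 (h0 κ i)
    · intro p hp
      obtain ⟨κ, i, rfl⟩ := exists_of_mem_supp hp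
      exact not_lt.1 fun h => h0 κ i ((ha κ i).1 h)
  · obtain ⟨⟨κ, i₀⟩, hm, hmax⟩ := Finset.exists_max_image _
      (fun p : Fin 2 × Fin n => a₀.1 p.1 p.2) hne
    simp only [Finset.mem_filter, Finset.mem_univ, true_and, Prod.forall] at hm hmax
    obtain ⟨y, hym, hy⟩ := exists_lt_forall_lt a₀ (a₀.1 κ i₀)
    have hyne : ∀ l i, a₀.1 l i ≠ y := fun l i h => by
      rcases lt_or_ge (a₀.1 l i) (a₀.1 κ i₀) with h' | h'
      · exact (hy l i h').ne h
      · exact (hym.trans_le h').ne h.symm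
    have hcard : (Finset.univ.filter fun p : Fin 2 × Fin n => a₀.1 p.1 p.2 < y).card <
        (Finset.univ.filter fun p : Fin 2 × Fin n => a₀.1 p.1 p.2 < x).card := by
      refine Finset.card_lt_card ((Finset.ssubset_iff_of_subset ?_).2 ⟨(κ, i₀), ?_, ?_⟩)
      · intro p hp
        simp only [Finset.mem_filter, Finset.mem_univ, true_and] at hp ⊢
        exact hp.trans (hym.trans hm)
      · simpa using hm
      · simpa using hym.le
    filter_upwards [ih _ hcard hyne rfl, eventually_lt_iff a₀ hx, eventually_lt_iff a₀ hyne]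
      with a h1 h2 h3
    have hiff : ∀ l i, (y ≤ a.1 l i ∧ a.1 l i < x) ↔ (y ≤ a₀.1 l i ∧ a₀.1 l i < x) := by
      intro l i
      rw [← not_lt, ← not_lt, h2, h3]
    have hno : ∀ l ≠ κ, ∀ i, ¬ (y ≤ a₀.1 l i ∧ a₀.1 l i < x) := by
      rintro l hl i ⟨h4, h5⟩
      rcases (hmax l i h5).eq_or_lt with h6 | h6
      · exact ne_of_mem_Shat a₀.2 hl _ _ h6
      · exact not_lt.2 h4 (hy l i h6)
    rw [height_config_of_monochromatic (hym.trans hm).le hno,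
      height_config_of_monochromatic (hym.trans hm).le fun l hl i => (hiff l i).not.2 (hno l hl i),
      h1]
    simp only [hiff]

theorem eventually_height_config_or (a₀ : Shat n) {κ : Fin 2} {x₀ : ℝ}
    (h : ∀ l ≠ κ, ∀ i, a₀.1 l i ≠ x₀) :
    ∀ᶠ p : Shat n × ℝ in 𝓝 (a₀, x₀), height (config p.1) p.2 = height (config a₀) x₀ ∨
      height (config p.1) p.2 = step κ (height (config a₀) x₀) := by
  obtain ⟨y, hyx, hy⟩ := exists_lt_forall_lt a₀ x₀
  have hyne : ∀ l i, a₀.1 l i ≠ y := fun l i h => by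
    rcases lt_or_ge (a₀.1 l i) x₀ with h' | h'
    · exact (hy l i h').ne h
    · exact (hyx.trans_le h').ne h.symm
  have hv : height (config a₀) x₀ = height (config a₀) y := by
    refine height_eq_of_forall fun p hp => ?_
    obtain ⟨κ, i, rfl⟩ := exists_of_mem_supp hp
    exact ⟨hy κ i, fun h => h.trans hyx⟩
  have e1 : ∀ᶠ p : Shat n × ℝ in 𝓝 (a₀, x₀), ∀ l, l ≠ κ → ∀ i,
      p.1.1 l i < y ∨ p.2 < p.1.1 l i := by
    rw [eventually_all]
    intro l
    by_cases hl : l = κ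
    · exact Eventually.of_forall fun _ h => absurd hl h
    · simp only [ne_eq, hl, not_false_eq_true, true_implies]
      rw [eventually_all]
      intro i
      have hc : ContinuousAt (fun p : Shat n × ℝ => p.1.1 l i) (a₀, x₀) :=
        ((continuous_coord l i).comp continuous_fst).continuousAt
      rcases (h l hl i).lt_or_gt with h' | h'
      · filter_upwards [hc.eventually_lt continuousAt_const (hy l i h')] with p hp using Or.inl hp
      · filter_upwards [continuousAt_snd.eventually_lt hc h'] with p hp using Or.inr hp
  have e2 : ∀ᶠ p : Shat n × ℝ in 𝓝 (a₀, x₀), y < p.2 :=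
    continuousAt_const.eventually_lt continuousAt_snd hyx
  have e3 : ∀ᶠ p : Shat n × ℝ in 𝓝 (a₀, x₀), height (config p.1) y = height (config a₀) y :=
    (continuous_fst.tendsto' (a₀, x₀) a₀ rfl).eventually (eventually_height_config a₀ hyne)
  filter_upwards [e1, e2, e3] with p h1 h2 h3
  rw [height_config_of_monochromatic (κ := κ) h2.le, h3, hv]
  · split_ifs
    · exact Or.inr rfl
    · exact Or.inl rfl
  · rintro l hl i ⟨h4, h5⟩
    rcases h1 l hl i with h6 | h6
    · exact not_lt.2 h4 h6
    · exact lt_asymm h5 h6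

/-- The height to the right of all points. -/
def total (c : Tspace n 1) : ℤ := ∑ p ∈ supp c, sign c p

theorem height_eq_total {c : Tspace n 1} {x : ℝ} (h : ∀ p ∈ supp c, p < x) :
    height c x = total c := by
  rw [height, total, Finset.filter_true_of_mem h]

theorem continuous_total : Continuous (total (n := n)) := by
  rw [isQuotientMap_config.continuous_iff]
  refine (IsLocallyConstant.iff_eventually_eq _).2 (fun a₀ => ?_) |>.continuous
  obtain ⟨B, hB⟩ := (Set.finite_range
      fun p : Fin 2 × Fin n => a₀.1 p.1 p.2).bddAbove
  have hB' : ∀ κ i, a₀.1 κ i < B + 1 := fun κ i => by linarith [hB ⟨(κ, i), rfl⟩]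
  have hne : ∀ κ i, a₀.1 κ i ≠ B + 1 := fun κ i => (hB' κ i).ne
  have key : ∀ a : Shat n, (∀ κ i, a.1 κ i < B + 1) →
      height (config a) (B + 1) = total (config a) := by
    intro a ha
    refine height_eq_total fun p hp => ?_
    obtain ⟨κ, i, rfl⟩ := exists_of_mem_supp hp
    exact ha κ i
  filter_upwards [eventually_height_config a₀ hne, eventually_lt_iff a₀ hne] with a h1 h2
  rw [Function.comp, Function.comp, ← key a fun κ i => (h2 κ i).2 (hB' κ i), ← key a₀ hB', h1]

theorem sum_alternating (F : Finset ℝ) :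
    ∑ p ∈ F, (if Even (F.filter (· < p)).card then 1 else -1 : ℤ) =
      if Odd F.card then 1 else 0 := by
  induction F using Finset.induction_on_max with
  | empty => simp
  | insert a s hlt ih =>
    have ha : a ∉ s := fun h => (hlt a h).false
    have h1 : (insert a s).filter (· < a) = s := by
      ext q
      simp only [Finset.mem_filter, Finset.mem_insert]
      constructor
      · rintro ⟨rfl | h, h'⟩
        · exact absurd h' (lt_irrefl _)
        · exact h
      · exact fun h => ⟨Or.inr h, hlt q h⟩
    have h2 : ∀ p ∈ s, (insert a s).filter (· < p) = s.filter (· < p) := by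
      intro p hp
      ext q
      simp only [Finset.mem_filter, Finset.mem_insert]
      constructor
      · rintro ⟨rfl | h, h'⟩
        · exact absurd h' (hlt p hp).not_gt
        · exact ⟨h, h'⟩
      · exact fun h => ⟨Or.inr h.1, h.2⟩
    rw [Finset.sum_insert ha, h1, Finset.card_insert_of_notMem ha,
      Finset.sum_congr rfl fun p hp => by rw [h2 p hp], ih]
    by_cases h : Even s.card
    · simp [h, ← Nat.not_even_iff_odd]
    · simp [h, Nat.odd_add_one, ← Nat.not_even_iff_odd]

theorem card_pts (c : Tspace n 1) (κ : Fin 2) :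
    (pts c κ).card ≤ n ∧ (Odd (pts c κ).card ↔ Odd n) := by
  obtain ⟨a, rfl⟩ := isQuotientMap_config.surjective c
  have := card_oddPoints_filter (a.1 κ) fun _ => True
  simpa [pts_config] using this

theorem disjoint_pts (c : Tspace n 1) : Disjoint (pts c 0) (pts c 1) :=
  Finset.disjoint_left.2 fun _ h => pts_disjoint c zero_ne_one h

theorem even_card_supp (c : Tspace n 1) : Even (supp c).card := by
  rw [supp, Finset.card_union_of_disjoint (disjoint_pts c), Nat.even_add,
    ← Nat.not_odd_iff_even, ← Nat.not_odd_iff_even, (card_pts c 0).2, (card_pts c 1).2]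

theorem exists_total_eq (c : Tspace n 1) : ∃ i : ℕ, i ≤ n ∧ total c = 2 * (2 * i - n) := by
  set e : ℝ → ℤ := fun p => if Even ((supp c).filter (· < p)).card then 1 else -1 with he
  have h0 : ∑ p ∈ pts c 0, e p + ∑ p ∈ pts c 1, e p = 0 := by
    rw [← Finset.sum_union (disjoint_pts c)]
    have := sum_alternating (supp c)
    rwa [if_neg (Nat.not_odd_iff_even.2 (even_card_supp c))] at this
  have hs0 : ∑ p ∈ pts c 0, sign c p = ∑ p ∈ pts c 0, e p :=
    Finset.sum_congr rfl fun p hp => by simp [sign, he, hp]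
  have hs1 : ∑ p ∈ pts c 1, sign c p = - ∑ p ∈ pts c 1, e p := by
    rw [← Finset.sum_neg_distrib]
    refine Finset.sum_congr rfl fun p hp => ?_
    have : p ∉ pts c 0 := fun h => pts_disjoint c zero_ne_one h hp
    simp only [sign, he, this, false_iff]
    split_ifs <;> simp_all
  have ht : total c = 2 * ∑ p ∈ pts c 0, sign c p := by
    have : total c = ∑ p ∈ pts c 0, sign c p + ∑ p ∈ pts c 1, sign c p :=
      Finset.sum_union (disjoint_pts c)
    rw [this, hs1, hs0]
    linarith
  have heven := even_sum_sign c (pts c 0)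
  have habs : |∑ p ∈ pts c 0, sign c p| ≤ (pts c 0).card := by
    have hsign : ∀ p, |sign c p| = 1 := fun p => by unfold sign; split_ifs <;> simp
    exact (Finset.abs_sum_le_sum_abs _ _).trans (by simp [hsign])
  obtain ⟨h1, h2⟩ := card_pts c 0
  rw [ht]
  generalize ∑ p ∈ pts c 0, sign c p = A at *
  rw [abs_le] at habs
  have h3 : Even A ↔ Even n := by
    rw [heven, ← Nat.not_odd_iff_even, ← Nat.not_odd_iff_even, h2]
  rw [Int.even_iff, Nat.even_iff] at h3
  exact ⟨((A + n) / 2).toNat, by omega, by omega⟩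

theorem exists_total (n : ℕ) {i : ℕ} (hi : i ≤ n) :
    ∃ c : Tspace n 1, total c = 2 * (2 * i - n) := by
  obtain ⟨k, r, hr, hk, hkn, hpar⟩ : ∃ (k r : ℕ), r < 2 ∧
      (2 * (2 * i - n) : ℤ) = 2 * k * (if r = 0 then 1 else -1) ∧ k ≤ n ∧ Even (n - k) := by
    rcases le_total n (2 * i) with h | h
    · exact ⟨2 * i - n, 0, by norm_num, by simp; omega, by omega, ⟨n - i, by omega⟩⟩
    · exact ⟨n - 2 * i, 1, by norm_num, by simp; omega, by omega, ⟨i, by omega⟩⟩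
  let E : Fin 2 → Finset ℝ := fun κ =>
    (Finset.range k).image fun j => ((2 * j + (if κ = 0 then r else 1 - r) : ℕ) : ℝ)
  have hE : ∀ κ x, x ∈ E κ ↔ ∃ j < k, ((2 * j + (if κ = 0 then r else 1 - r) : ℕ) : ℝ) = x :=
    fun κ x => by simp only [E, Finset.mem_image, Finset.mem_range]
  have hcard : ∀ κ, (E κ).card = k := fun κ => by
    rw [Finset.card_image_of_injective, Finset.card_range]
    intro j j' h
    have := Nat.cast_injective h
    omega
  have hd : Disjoint (E 0) (E 1) := by
    rw [Finset.disjoint_left]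
    intro x h1 h2
    obtain ⟨j, _, rfl⟩ := (hE 0 x).1 h1
    obtain ⟨j', _, h⟩ := (hE 1 _).1 h2
    have := Nat.cast_injective h
    simp at this
    omega
  obtain ⟨c, hc⟩ := exists_of_pts n E hd (fun κ => (hcard κ).trans_le hkn)
    fun κ => by rwa [hcard]
  have hsupp : supp c = (Finset.range (2 * k)).image (Nat.cast : ℕ → ℝ) := by
    ext x
    rw [mem_supp, Fin.exists_fin_two, hc, hc, hE, hE, Finset.mem_image]
    simp only [Finset.mem_range, if_true, if_neg one_ne_zero]
    constructor
    · rintro (⟨j, hj, rfl⟩ | ⟨j, hj, rfl⟩)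
      · exact ⟨_, by omega, rfl⟩
      · exact ⟨_, by omega, rfl⟩
    · rintro ⟨j, hj, rfl⟩
      by_cases h : j % 2 = r
      · exact Or.inl ⟨j / 2, by omega, by congr 1; omega⟩
      · exact Or.inr ⟨j / 2, by omega, by congr 1; omega⟩
  have hsign : ∀ j < 2 * k, sign c (j : ℝ) = if r = 0 then 1 else -1 := by
    intro j hj
    have h1 : ((supp c).filter (· < (j : ℝ))).card = j := by
      have : (supp c).filter (· < (j : ℝ)) = (Finset.range j).image (Nat.cast : ℕ → ℝ) := by
        ext x
        simp only [hsupp, Finset.mem_filter, Finset.mem_image, Finset.mem_range]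
        constructor
        · rintro ⟨⟨i, _, rfl⟩, h⟩
          exact ⟨i, Nat.cast_lt.1 h, rfl⟩
        · rintro ⟨i, h, rfl⟩
          exact ⟨⟨i, h.trans hj, rfl⟩, Nat.cast_lt.2 h⟩
      rw [this, Finset.card_image_of_injective _ Nat.cast_injective, Finset.card_range]
    have h2 : (j : ℝ) ∈ pts c 0 ↔ j % 2 = r := by
      rw [hc, hE]
      constructor
      · rintro ⟨i, _, h⟩
        have := Nat.cast_injective h
        simp at this
        omega
      · intro h
        exact ⟨j / 2, by omega, by simp only [if_true]; congr 1; omega⟩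
    rw [sign, h1]
    simp only [h2, Nat.even_iff]
    by_cases hr0 : r = 0
    · simp [hr0]
    · have : r = 1 := by omega
      subst this
      rw [if_neg, if_neg] <;> omega
  refine ⟨c, ?_⟩
  rw [hk, total, hsupp, Finset.sum_image fun _ _ _ _ h => Nat.cast_injective h,
    Finset.sum_congr rfl fun j hj => hsign j (Finset.mem_range.1 hj)]
  simp

theorem odd_card_iff_le_height {κ : Fin 2} {J : ℤ} (hJ : step κ J = J + 1) (hJ0 : 0 ≤ J)
    (c : Tspace n 1) (t : ℝ) :
    Odd ((pts c κ).filter fun x => x < t ∧ (height c x = J ∨ height c x = J + 1)).card ↔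
      J + 1 ≤ height c t := by
  have hJ' : step κ (J + 1) = J := by rw [← hJ, step_step]
  obtain ⟨t₀, h0, h0'⟩ :=
    ((eventually_height_atBot c).and (eventually_le_atBot (sInf (↑(pts c κ) : Set ℝ)))).exists
  refine (forall_iff_of_eventually (P := fun t =>
    Odd ((pts c κ).filter fun x => x < t ∧ (height c x = J ∨ height c x = J + 1)).card ↔
      J + 1 ≤ height c t) ?_ ?_ t t₀).2 ?_
  · intro p
    filter_upwards [eventually_height_left c p, eventually_notMem_Ico (pts c κ) p,
      self_mem_nhdsWithin] with x h1 h2 h3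
    have hx : ∀ q ∈ pts c κ, q < x ↔ q < p := fun q hq => ⟨fun h => h.trans h3, h2 q hq⟩
    rw [h1, Finset.filter_congr fun q hq => and_congr_left fun _ => hx q hq]
  · intro p
    filter_upwards [eventually_height_right c p, eventually_notMem_Ioo (pts c κ) p,
      self_mem_nhdsWithin] with x h1 h2 h3
    have hx : ∀ q ∈ pts c κ, q < x ↔ q ≤ p := fun q hq => ⟨h2 q hq, fun h => h.trans_lt h3⟩
    by_cases hp : p ∈ pts c κ ∧ (height c p = J ∨ height c p = J + 1)
    · have : ((pts c κ).filter fun q => q < x ∧ (height c q = J ∨ height c q = J + 1)) =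
          insert p ((pts c κ).filter fun q => q < p ∧ (height c q = J ∨ height c q = J + 1)) := by
        ext q
        simp only [Finset.mem_filter, Finset.mem_insert]
        constructor
        · rintro ⟨a1, a2, a3⟩
          rcases (h2 q a1 a2).eq_or_lt with h | h
          · exact Or.inl h
          · exact Or.inr ⟨a1, h, a3⟩
        · rintro (rfl | ⟨a1, a2, a3⟩)
          · exact ⟨hp.1, h3, hp.2⟩
          · exact ⟨a1, a2.trans h3, a3⟩
      rw [this, Finset.card_insert_of_notMem (by simp), h1, jump_of_mem hp.1, Nat.odd_add_one]
      rcases hp.2 with h | h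
      · rw [h, hJ]; simp
      · rw [h, hJ']; simp
    · have : ((pts c κ).filter fun q => q < x ∧ (height c q = J ∨ height c q = J + 1)) =
          ((pts c κ).filter fun q => q < p ∧ (height c q = J ∨ height c q = J + 1)) := by
        refine Finset.filter_congr fun q hq => ?_
        rw [hx q hq]
        refine and_congr_left fun hq' => ?_
        have : q ≠ p := fun h => hp ⟨h ▸ hq, h ▸ hq'⟩
        exact ⟨fun h => h.lt_of_ne this, le_of_lt⟩
      rw [this, h1]
      refine iff_congr Iff.rfl ?_
      by_cases hs : p ∈ supp c
      · obtain ⟨l, hl⟩ := mem_supp.1 hs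
        rw [jump_of_mem hl]
        by_cases hlk : l = κ
        · subst hlk
          have h4 : ¬ (height c p = J ∨ height c p = J + 1) := fun h => hp ⟨hl, h⟩
          rcases step_eq l (height c p) with h | h <;> omega
        · have h5 := step_ne hlk (height c p)
          by_cases hcJ : height c p = J
          · rw [hcJ, hJ] at h5
            rw [hcJ]
            omega
          · by_cases hcJ' : height c p = J + 1
            · rw [hcJ', hJ'] at h5
              rw [hcJ']
              omega
            · rcases step_eq l (height c p) with h | h <;> omega
      · rw [jump_of_notMem hs]
  · rw [h0, Finset.filter_false_of_mem]
    · simp; omega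
    · rintro q hq ⟨h, _⟩
      exact absurd h (not_lt.2 (h0'.trans (csInf_le (pts c κ).bddBelow hq)))

/-- The map which collects, at the time `u`, the points of colour `κ` between the levels `J` and
`J + 1` and to the left of `τ + 1 - u⁻¹` at that point. -/
def sweepMap (κ : Fin 2) (J : ℤ) (τ : ℝ) (c : Tspace n 1) (u : ℝ) (l : Fin 2) (x : ℝ) : ℝ :=
  if l = κ ∧ u * (x - τ - 1) + 1 < 0 ∧ (height c x = J ∨ height c x = J + 1)
    then τ + 1 - u⁻¹ else x

theorem sweep_cond_iff {u τ x : ℝ} (hu : 0 < u) :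
    u * (x - τ - 1) + 1 < 0 ↔ x < τ + 1 - u⁻¹ := by
  have : u * (x - τ - 1) + 1 = u * (x - (τ + 1 - u⁻¹)) := by field_simp; ring
  rw [this, ← mul_zero u, mul_lt_mul_iff_right₀ hu, sub_neg]

theorem step_mem_iff {κ : Fin 2} {J : ℤ} (hJ : step κ J = J + 1) (v : ℤ) :
    (step κ v = J ∨ step κ v = J + 1) ↔ (v = J ∨ v = J + 1) := by
  have hJ' : step κ (J + 1) = J := by rw [← hJ, step_step]
  constructor
  · rintro (h | h)
    · rw [← step_step κ v, h, hJ]; exact Or.inr rfl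
    · rw [← step_step κ v, h, hJ']; exact Or.inl rfl
  · rintro (rfl | rfl)
    · exact Or.inr hJ
    · exact Or.inl hJ'

theorem eventually_level_iff {κ : Fin 2} {J : ℤ} (hJ : step κ J = J + 1) (a₀ : Shat n)
    (i : Fin n) :
    ∀ᶠ a in 𝓝 a₀, (height (config a) (a.1 κ i) = J ∨ height (config a) (a.1 κ i) = J + 1) ↔
      (height (config a₀) (a₀.1 κ i) = J ∨ height (config a₀) (a₀.1 κ i) = J + 1) := by
  have ht : Tendsto (fun a : Shat n => (a, a.1 κ i)) (𝓝 a₀) (𝓝 (a₀, a₀.1 κ i)) :=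
    (continuous_id.prodMk (continuous_coord κ i)).continuousAt
  filter_upwards [ht.eventually (eventually_height_config_or a₀ (κ := κ)
    fun l hl j => ne_of_mem_Shat a₀.2 hl _ _)] with a ha
  rcases ha with h | h
  · simp only [h]
  · simp only [h, step_mem_iff hJ]

theorem continuousAt_sweepMap {κ : Fin 2} {J : ℤ} (hJ : step κ J = J + 1) (τ : ℝ)
    (ω₀ : Shat n × unitInterval) (l : Fin 2) (i : Fin n) :
    ContinuousAt (fun ω : Shat n × unitInterval =>
      sweepMap κ J τ (config ω.1) ω.2 l (ω.1.1 l i)) ω₀ := by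
  have hcoord : ContinuousAt (fun ω : Shat n × unitInterval => ω.1.1 l i) ω₀ :=
    ((continuous_coord l i).comp continuous_fst).continuousAt
  have hu : ContinuousAt (fun ω : Shat n × unitInterval => (ω.2 : ℝ)) ω₀ := by fun_prop
  by_cases hl : l = κ
  swap
  · simpa only [sweepMap, hl, false_and, if_false] using hcoord
  subst hl
  have hlev : ∀ᶠ ω : Shat n × unitInterval in 𝓝 ω₀, _ :=
    (continuous_fst.tendsto ω₀).eventually (eventually_level_iff hJ ω₀.1 i)
  by_cases hlev₀ : height (config ω₀.1) (ω₀.1.1 l i) = J ∨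
      height (config ω₀.1) (ω₀.1.1 l i) = J + 1
  swap
  · refine hcoord.congr ?_
    filter_upwards [hlev] with ω hω
    rw [sweepMap, if_neg fun h => hlev₀ (hω.1 h.2.2)]
  rcases ω₀.2.2.1.eq_or_lt with h0 | h0
  · refine hcoord.congr ?_
    have hg : ContinuousAt (fun ω : Shat n × unitInterval =>
        (ω.2 : ℝ) * (ω.1.1 l i - τ - 1) + 1) ω₀ :=
      (hu.mul ((hcoord.sub continuousAt_const).sub continuousAt_const)).add continuousAt_const
    have hg0 : 0 < (ω₀.2 : ℝ) * (ω₀.1.1 l i - τ - 1) + 1 := by rw [← h0]; simp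
    filter_upwards [continuousAt_const.eventually_lt hg hg0] with ω hω
    rw [sweepMap, if_neg fun h => hω.not_gt h.2.1]
  · have hmax : ContinuousAt (fun ω : Shat n × unitInterval =>
        max (ω.1.1 l i) (τ + 1 - (ω.2 : ℝ)⁻¹)) ω₀ :=
      hcoord.max (continuousAt_const.sub (hu.inv₀ h0.ne'))
    refine hmax.congr ?_
    filter_upwards [hlev, continuousAt_const.eventually_lt hu h0] with ω h1 h2
    have := h1.2 hlev₀
    simp only [sweepMap, this, and_true, true_and, sweep_cond_iff h2]
    split_ifs with h
    · exact max_eq_right h.le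
    · exact max_eq_left (not_lt.1 h)

theorem forall_ne_of_other {f : Fin 2 → Fin n → ℝ} {D : Fin 2 → Finset (Fin n)} {κ : Fin 2}
    (h : ∀ l ≠ κ, ∀ i ∉ D κ, ∀ j ∉ D l, f κ i ≠ f l j) :
    ∀ i ∉ D 0, ∀ j ∉ D 1, f 0 i ≠ f 1 j := by
  fin_cases κ
  · exact h 1 (by simp)
  · exact fun i hi j hj => (h 0 (by simp) j hj i hi).symm

theorem continuousWithinAt_sweep {κ : Fin 2} {J : ℤ} (hJ : step κ J = J + 1) (hJ0 : 0 ≤ J)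
    {τ : ℝ} {C : Set (Tspace n 1)} (hC : ∀ c ∈ C, ∀ x < τ + 2, height c x ≤ J + 1)
    {ω₀ : Shat n × unitInterval} (hω₀ : config ω₀.1 ∈ C) :
    ContinuousWithinAt (fun ω : Shat n × unitInterval =>
        push (sweepMap κ J τ (config ω.1) ω.2) (config ω.1)) {ω | config ω.1 ∈ C} ω₀ ∧
      ∀ l, pts (push (sweepMap κ J τ (config ω₀.1) ω₀.2) (config ω₀.1)) l =
        oddMap (sweepMap κ J τ (config ω₀.1) ω₀.2 l) (pts (config ω₀.1) l) := by
  have hJ' : step κ (J + 1) = J := by rw [← hJ, step_step]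
  set ψ : Shat n × unitInterval → Fin 2 → ℝ → ℝ := fun ω => sweepMap κ J τ (config ω.1) ω.2
  have hother : ∀ ω, ∀ l ≠ κ, ∀ x, ψ ω l x = x := fun ω l hl x => by simp [ψ, sweepMap, hl]
  have hψκ : ∀ ω i, ψ ω κ (ω.1.1 κ i) = τ + 1 - (ω.2 : ℝ)⁻¹ ∧ 0 < (ω.2 : ℝ) ∨
      ψ ω κ (ω.1.1 κ i) = ω.1.1 κ i := by
    intro ω i
    simp only [ψ, sweepMap]
    split_ifs with h
    · refine Or.inl ⟨rfl, ω.2.2.1.lt_of_ne fun h0 => ?_⟩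
      have := h.2.1
      rw [← h0] at this
      norm_num at this
    · exact Or.inr rfl
  have hcont := fun l i => continuousAt_sweepMap hJ τ ω₀ l i
  set t₀ : ℝ := τ + 1 - (ω₀.2 : ℝ)⁻¹ with ht₀
  by_cases hl : 0 < (ω₀.2 : ℝ) ∧ ∃ l ≠ κ, ∃ j, ω₀.1.1 l j = t₀
  swap
  · refine continuousWithinAt_push (ψ := ψ) hω₀ (fun _ => ∅)
      (fun l i _ => (hcont l i).continuousWithinAt) (by simp)
      (forall_ne_of_other (D := fun _ => ∅)
        (f := fun l i => ψ ω₀ l (ω₀.1.1 l i)) (κ := κ) ?_)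
    intro l hlk i _ j _
    simp only [hother ω₀ l hlk]
    rcases hψκ ω₀ i with ⟨h, h'⟩ | h
    · rw [h]
      exact fun e => hl ⟨h', l, hlk, j, e.symm⟩
    · rw [h]
      exact ne_of_mem_Shat ω₀.1.2 hlk.symm _ _
  obtain ⟨hu0, l, hlk, j₀, hj₀⟩ := hl
  have hl_unique : ∀ l', l' ≠ κ → l' = l := fun l' h => by omega
  have ht₀τ : t₀ < τ + 2 := by
    have : 0 < (ω₀.2 : ℝ)⁻¹ := inv_pos.2 hu0
    linarith
  by_cases hh : height (config ω₀.1) t₀ = J + 1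
  · refine continuousWithinAt_push (ψ := ψ) hω₀
      (fun l' => if l' = l then Finset.univ.filter fun j => ω₀.1.1 l j = t₀ else ∅)
      (fun l i _ => (hcont l i).continuousWithinAt) ?_
      (forall_ne_of_other
        (D := fun l' => if l' = l then Finset.univ.filter fun j => ω₀.1.1 l j = t₀ else ∅)
        (f := fun l i => ψ ω₀ l (ω₀.1.1 l i)) (κ := κ) ?_)
    · have hcoord : ∀ j, ContinuousAt (fun ω : Shat n × unitInterval => ω.1.1 l j) ω₀ := fun j =>
        ((continuous_coord l j).comp continuous_fst).continuousAt
      have e1 : ∀ᶠ ω in 𝓝 ω₀, ∀ j, ω₀.1.1 l j = t₀ → ω.1.1 l j < τ + 2 := by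
        rw [eventually_all]
        intro j
        by_cases h : ω₀.1.1 l j = t₀
        · filter_upwards [(hcoord j).eventually_lt continuousAt_const (h.trans_lt ht₀τ)] with ω hω _
            using hω
        · exact Eventually.of_forall fun _ h' => absurd h' h
      have e2 : ∀ᶠ ω in 𝓝 ω₀, ∀ j, ω₀.1.1 l j = t₀ → ∀ i, ω₀.1.1 l i ≠ t₀ →
          ω.1.1 l i ≠ ω.1.1 l j := by
        rw [eventually_all]
        intro j
        by_cases h : ω₀.1.1 l j = t₀
        · simp only [h, true_implies]
          rw [eventually_all]
          intro i
          by_cases h' : ω₀.1.1 l i = t₀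
          · exact Eventually.of_forall fun _ h'' => absurd h' h''
          · filter_upwards [((hcoord i).ne_iff_eventually_ne (hcoord j)).1 (h ▸ h')] with ω hω _
              using hω
        · exact Eventually.of_forall fun _ h' => absurd h' h
      have e3 : ∀ᶠ ω in 𝓝 ω₀, ∀ j, ω₀.1.1 l j = t₀ →
          height (config ω.1) (ω.1.1 l j) = J + 1 ∨ height (config ω.1) (ω.1.1 l j) = J + 2 := by
        rw [eventually_all]
        intro j
        by_cases h : ω₀.1.1 l j = t₀
        · have ht : Tendsto (fun ω : Shat n × unitInterval => (ω.1, ω.1.1 l j)) (𝓝 ω₀)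
              (𝓝 (ω₀.1, ω₀.1.1 l j)) := continuousAt_fst.prodMk (hcoord j)
          have hS : step l (J + 1) = J + 2 := by
            have := step_ne hlk (J + 1)
            omega
          filter_upwards [ht.eventually (eventually_height_config_or ω₀.1 (κ := l)
            fun l hl j => ne_of_mem_Shat ω₀.1.2 hl _ _)] with ω hω _
          simpa only [h, hh, hS] using hω
        · exact Eventually.of_forall fun _ h' => absurd h' h
      filter_upwards [mem_nhdsWithin_of_mem_nhds e1, mem_nhdsWithin_of_mem_nhds e2,
        mem_nhdsWithin_of_mem_nhds e3, self_mem_nhdsWithin] with ω h1 h2 h3 hωC l' y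
      by_cases hl' : l' = l
      swap
      · simp [hl']
      subst hl'
      simp only [if_true, hother ω l' hlk]
      by_contra hodd
      rw [Nat.not_even_iff_odd] at hodd
      obtain ⟨j, hj⟩ := Finset.card_pos.1 hodd.pos
      simp only [Finset.mem_filter, Finset.mem_univ, true_and] at hj
      obtain ⟨hj, rfl⟩ := hj
      have hy : ω.1.1 l' j ∈ pts (config ω.1) l' := by
        rw [pts_config, mem_oddPoints]
        convert hodd using 2
        ext i
        simp only [Finset.mem_filter, Finset.mem_univ, true_and]
        refine ⟨fun h => ⟨?_, h⟩, And.right⟩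
        by_contra hne
        exact h2 j hj i hne h
      have hlt := h1 j hj
      have hv : height (config ω.1) (ω.1.1 l' j) = J + 1 := by
        rcases h3 j hj with h | h
        · exact h
        · have := hC _ hωC _ hlt
          omega
      obtain ⟨x, hx, hx'⟩ := ((eventually_height_right (config ω.1) (ω.1.1 l' j)).and
        (mem_nhdsWithin_of_mem_nhds (Iio_mem_nhds hlt))).exists
      rw [jump_of_mem hy, hv, step_ne hlk, hJ'] at hx
      have := hC _ hωC _ hx'
      omega
    · intro l' hl' i _ j hj
      obtain rfl := hl_unique l' hl'
      simp only [if_true, Finset.mem_filter, Finset.mem_univ, true_and] at hj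
      simp only [hother ω₀ l' hlk]
      rcases hψκ ω₀ i with ⟨h, h'⟩ | h
      · rw [h]
        exact Ne.symm hj
      · rw [h]
        exact ne_of_mem_Shat ω₀.1.2 hlk.symm _ _
  · have hle : ¬ J + 1 ≤ height (config ω₀.1) t₀ := by
      have := hC _ hω₀ _ ht₀τ
      omega
    set D : Finset (Fin n) := Finset.univ.filter fun i => ω₀.1.1 κ i < t₀ ∧
      (height (config ω₀.1) (ω₀.1.1 κ i) = J ∨ height (config ω₀.1) (ω₀.1.1 κ i) = J + 1) with hD
    have hDeven : Even D.card := by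
      rw [← Nat.not_odd_iff_even, hD, ← (card_oddPoints_filter (ω₀.1.1 κ) fun x => x < t₀ ∧
        (height (config ω₀.1) x = J ∨ height (config ω₀.1) x = J + 1)).2, ← pts_config,
        odd_card_iff_le_height hJ hJ0]
      exact hle
    refine continuousWithinAt_push (ψ := ψ) hω₀ (fun l' => if l' = κ then D else ∅)
      (fun l i _ => (hcont l i).continuousWithinAt) ?_
      (forall_ne_of_other (D := fun l' => if l' = κ then D else ∅)
        (f := fun l i => ψ ω₀ l (ω₀.1.1 l i)) (κ := κ) ?_)
    · refine Filter.Eventually.filter_mono nhdsWithin_le_nhds ?_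
      have hu : ContinuousAt (fun ω : Shat n × unitInterval => (ω.2 : ℝ)) ω₀ := by fun_prop
      have e1 : ∀ᶠ ω in 𝓝 ω₀, ∀ i, i ∈ D → ψ ω κ (ω.1.1 κ i) = τ + 1 - (ω.2 : ℝ)⁻¹ := by
        rw [eventually_all]
        intro i
        by_cases hi : i ∈ D
        · have hi' := (Finset.mem_filter.1 hi).2
          have hcoord : ContinuousAt (fun ω : Shat n × unitInterval => ω.1.1 κ i) ω₀ :=
            ((continuous_coord κ i).comp continuous_fst).continuousAt
          filter_upwards [(continuous_fst.tendsto ω₀).eventually (eventually_level_iff hJ ω₀.1 i),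
            continuousAt_const.eventually_lt hu hu0,
            hcoord.eventually_lt (continuousAt_const.sub (hu.inv₀ hu0.ne')) hi'.1]
            with ω h1 h2 h3 _
          simp only [ψ, sweepMap]
          rw [if_pos ⟨trivial, (sweep_cond_iff h2).2 h3, h1.2 hi'.2⟩]
        · exact Eventually.of_forall fun _ h => absurd h hi
      filter_upwards [e1] with ω hω l' y
      by_cases hl' : l' = κ
      · subst hl'
        simp only [if_true]
        by_cases hy : τ + 1 - (ω.2 : ℝ)⁻¹ = y
        · rwa [Finset.filter_true_of_mem fun i hi => (hω i hi).trans hy]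
        · rw [Finset.filter_false_of_mem fun i hi h => hy ((hω i hi).symm.trans h)]
          simp
      · simp [hl']
    · intro l' hl' i hi j _
      simp only [if_true] at hi
      simp only [hother ω₀ l' hl']
      have : ψ ω₀ κ (ω₀.1.1 κ i) = ω₀.1.1 κ i := by
        simp only [ψ, sweepMap]
        rw [if_neg]
        rintro ⟨_, h1, h2⟩
        exact hi (Finset.mem_filter.2 ⟨Finset.mem_univ _, (sweep_cond_iff hu0).1 h1, h2⟩)
      rw [this]
      exact ne_of_mem_Shat ω₀.1.2 hl'.symm _ _

theorem height_sweep {κ : Fin 2} {J : ℤ} (hJ : step κ J = J + 1) (hJ0 : 0 ≤ J) {τ : ℝ}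
    {c c' : Tspace n 1} (hc : ∀ x < τ + 2, height c x ≤ J + 1)
    (h : ∀ l, pts c' l = oddMap (sweepMap κ J τ c 1 l) (pts c l)) (x : ℝ) :
    height c' x = if height c x = J + 1 ∧ x ≤ τ then J else height c x := by
  have hJ' : step κ (J + 1) = J := by rw [← hJ, step_step]
  have hother : ∀ l ≠ κ, pts c' l = pts c l := by
    intro l hl
    rw [h]
    ext y
    rw [mem_oddMap]
    simp only [sweepMap, hl, false_and, if_false, Finset.filter_eq']
    split_ifs with h <;> simp [h]
  have hcond : ∀ y, sweepMap κ J τ c 1 κ y =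
      if y < τ ∧ (height c y = J ∨ height c y = J + 1) then τ else y := by
    intro y
    have : (1 : ℝ) * (y - τ - 1) + 1 < 0 ↔ y < τ := by
      constructor <;> intro h <;> linarith
    simp only [sweepMap, this, true_and, inv_one, add_sub_cancel_right]
  have hne : ∀ p ≠ τ, p ∈ pts c' κ ↔
      p ∈ pts c κ ∧ ¬ (p < τ ∧ (height c p = J ∨ height c p = J + 1)) := by
    intro p hp
    rw [h, mem_oddMap]
    have : ((pts c κ).filter fun y => sweepMap κ J τ c 1 κ y = p) =
        if p ∈ pts c κ ∧ ¬ (p < τ ∧ (height c p = J ∨ height c p = J + 1)) then {p} else ∅ := by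
      ext y
      rw [Finset.mem_filter, hcond]
      split_ifs with h1 h2 h2
      · simp only [Finset.mem_singleton]
        constructor
        · exact fun h => absurd h.2.symm hp
        · rintro rfl; exact absurd h1 h2.2
      · simp only [Finset.notMem_empty, iff_false]
        exact fun h => hp h.2.symm
      · simp only [Finset.mem_singleton]
        constructor
        · exact fun h => h.2
        · rintro rfl; exact ⟨h2.1, rfl⟩
      · simp only [Finset.notMem_empty, iff_false]
        rintro ⟨h3, rfl⟩
        exact h2 ⟨h3, h1⟩
    rw [this]
    split_ifs with h1
    · exact iff_of_true (by simp) h1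
    · exact iff_of_false (by simp) h1
  have hτ : τ ∈ pts c' κ ↔ ¬ (τ ∈ pts c κ ↔ height c τ = J + 1) := by
    rw [h, mem_oddMap]
    have e1 : ((pts c κ).filter fun y => sweepMap κ J τ c 1 κ y = τ) =
        ((pts c κ).filter fun y => y < τ ∧ (height c y = J ∨ height c y = J + 1)) ∪
          (pts c κ).filter fun y => y = τ := by
      ext y
      rw [← Finset.filter_or, Finset.mem_filter, Finset.mem_filter, hcond]
      split_ifs with h1 <;> simp [h1]
    rw [e1, Finset.card_union_of_disjoint, Nat.odd_add, odd_card_iff_le_height hJ hJ0]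
    · have : J + 1 ≤ height c τ ↔ height c τ = J + 1 := by
        have := hc τ (by linarith)
        omega
      rw [this]
      have : Even ((pts c κ).filter fun y => y = τ).card ↔ τ ∉ pts c κ := by
        rw [Finset.filter_eq']
        split_ifs with h1 <;> simp [h1]
      rw [this]
      tauto
    · rw [Finset.disjoint_filter]
      rintro y _ ⟨h1, _⟩ rfl
      exact h1.false
  suffices hF : (fun x => if height c x = J + 1 ∧ x ≤ τ then J else height c x) = height c' by
    exact (congrFun hF x).symm
  refine eq_height ?_ ?_ ?_
  · obtain ⟨x, h1, h2⟩ := ((eventually_height_atBot c).and (eventually_height_atBot c')).exists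
    refine ⟨x, ?_⟩
    rw [h1, h2, if_neg fun h => by omega]
  · intro p
    rcases le_or_gt p τ with hp | hp
    · filter_upwards [eventually_height_left c p, self_mem_nhdsWithin] with x h1 h2
      have : x ≤ τ := (le_of_lt h2).trans hp
      simp only [h1, hp, this]
    · filter_upwards [eventually_height_left c p,
        mem_nhdsWithin_of_mem_nhds (Ioi_mem_nhds hp)] with x h1 h2
      have h3 : ¬ x ≤ τ := not_le.2 h2
      simp only [h1, hp.not_ge, h3]
  · intro p
    have hl1 : ∀ l ≠ κ, step l (J + 1) = J + 2 := fun l hl => by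
      have := step_ne hl (J + 1)
      omega
    have hl2 : ∀ l ≠ κ, step l J = J - 1 := fun l hl => by
      have := step_ne hl J
      omega
    have hl3 : ∀ l v, step l v = J + 1 → v = step l (J + 1) := fun l v h => by
      rw [← h, step_step]
    rcases lt_trichotomy p τ with hp | rfl | hp
    · filter_upwards [eventually_height_right c p,
        mem_nhdsWithin_of_mem_nhds (Iio_mem_nhds hp)] with x h1 h2
      have hx := hc x (by linarith [mem_Iio.1 h2])
      have hp' := hc p (by linarith)
      simp only [hp.le, (mem_Iio.1 h2).le, and_true]
      by_cases hs : p ∈ supp c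
      · obtain ⟨l, hl⟩ := mem_supp.1 hs
        rw [jump_of_mem hl] at h1
        by_cases hlk : l = κ
        · subst hlk
          by_cases hlev : height c p = J ∨ height c p = J + 1
          · rw [jump_of_notMem]
            · rcases hlev with h3 | h3
              · rw [h3, hJ] at h1
                rw [h1, h3]
                simp
              · rw [h3, hJ'] at h1
                rw [h1, h3]
                simp
            · rw [mem_supp]
              rintro ⟨l', hl'⟩
              by_cases hl'k : l' = l
              · subst hl'k
                exact ((hne p hp.ne).1 hl').2 ⟨hp, hlev⟩
              · rw [hother l' hl'k] at hl'
                exact pts_disjoint c hl'k hl' hl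
          · rw [jump_of_mem ((hne p hp.ne).2 ⟨hl, fun h => hlev h.2⟩), if_neg, if_neg, h1]
            · exact fun h => hlev (Or.inr h)
            · rw [h1]
              intro h
              refine hlev (Or.inl ?_)
              rw [hl3 _ _ h, hJ']
        · rw [jump_of_mem (by rwa [hother l hlk])]
          have h3 : height c p ≠ J + 1 := by
            intro h3
            rw [h3, hl1 l hlk] at h1
            omega
          rw [if_neg h3, if_neg, h1]
          rw [h1]
          intro h
          have := hl3 _ _ h
          rw [hl1 l hlk] at this
          omega
      · rw [jump_of_notMem hs] at h1
        rw [jump_of_notMem, h1]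
        rw [mem_supp]
        rintro ⟨l', hl'⟩
        refine hs (mem_supp.2 ⟨l', ?_⟩)
        by_cases hl'k : l' = κ
        · subst hl'k
          exact ((hne p hp.ne).1 hl').1
        · rwa [hother l' hl'k] at hl'
    · filter_upwards [eventually_height_right c p, self_mem_nhdsWithin,
        mem_nhdsWithin_of_mem_nhds (Iio_mem_nhds (lt_add_of_pos_right p two_pos))] with x h1 h2 h3
      have hx := hc x h3
      have hx' : ¬ x ≤ p := not_le.2 h2
      simp only [hx', and_false, if_false, le_refl, and_true]
      by_cases hlev : height c p = J + 1
      · rw [if_pos hlev]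
        rw [hlev] at h1
        simp only [hlev, iff_true] at hτ
        by_cases hκ : p ∈ pts c κ
        · rw [jump_of_mem hκ, hJ'] at h1
          rw [h1, jump_of_notMem]
          rw [mem_supp]
          rintro ⟨l', hl'⟩
          by_cases hl'k : l' = κ
          · subst hl'k
            exact hτ.1 hl' hκ
          · rw [hother l' hl'k] at hl'
            exact pts_disjoint c hl'k hl' hκ
        · rw [jump_of_mem (hτ.2 hκ), hJ]
          by_cases hs : p ∈ supp c
          · obtain ⟨l, hl⟩ := mem_supp.1 hs
            have hlk : l ≠ κ := fun h => hκ (h ▸ hl)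
            rw [jump_of_mem hl, hl1 l hlk] at h1
            omega
          · rw [h1, jump_of_notMem hs]
      · rw [if_neg hlev, h1]
        simp only [hlev, iff_false, not_not] at hτ
        by_cases hs : p ∈ supp c
        · obtain ⟨l, hl⟩ := mem_supp.1 hs
          rw [jump_of_mem hl, jump_of_mem (κ := l)]
          by_cases hlk : l = κ
          · subst hlk; exact hτ.2 hl
          · rwa [hother l hlk]
        · rw [jump_of_notMem hs, jump_of_notMem]
          rw [mem_supp]
          rintro ⟨l', hl'⟩
          refine hs (mem_supp.2 ⟨l', ?_⟩)
          by_cases hl'k : l' = κ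
          · subst hl'k
            exact hτ.1 hl'
          · rwa [hother l' hl'k] at hl'
    · filter_upwards [eventually_height_right c p, self_mem_nhdsWithin] with x h1 h2
      have hx' : ¬ x ≤ τ := not_le.2 (hp.trans h2)
      simp only [hx', hp.not_ge, and_false, if_false, h1]
      have hall : ∀ l, p ∈ pts c' l ↔ p ∈ pts c l := by
        intro l
        by_cases hlk : l = κ
        · subst hlk
          rw [hne p hp.ne']
          simp [hp.not_gt]
        · rw [hother l hlk]
      simp only [jump, hall]

theorem isClosed_height_le {φ : ℝ → ℤ} (hφ : Monotone φ) :
    IsClosed {c : Tspace n 1 | ∀ x, height c x ≤ φ x} := by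
  rw [← isQuotientMap_config.isClosed_preimage, ← isOpen_compl_iff, isOpen_iff_mem_nhds]
  intro a₀ ha₀
  simp only [mem_compl_iff, mem_preimage, mem_ofPred_eq, not_forall, not_le] at ha₀
  obtain ⟨x, hx⟩ := ha₀
  obtain ⟨y, h1, h2, h3⟩ := ((eventually_height_left (config a₀) x).and
    ((eventually_notMem_Ico (Finset.univ.image fun p : Fin 2 × Fin n => a₀.1 p.1 p.2) x).and
      self_mem_nhdsWithin)).exists
  have h3 : y < x := h3
  have hne : ∀ κ i, a₀.1 κ i ≠ y := by
    rintro κ i rfl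
    exact (h2 _ (Finset.mem_image.2 ⟨(κ, i), Finset.mem_univ _, rfl⟩) h3).false
  filter_upwards [eventually_height_config a₀ hne] with a ha
  simp only [mem_compl_iff, mem_preimage, mem_ofPred_eq, not_forall, not_le]
  exact ⟨y, by rw [ha, h1]; exact (hφ h3.le).trans_lt hx⟩

theorem push_sweepMap_zero (κ : Fin 2) (J : ℤ) (τ : ℝ) (c : Tspace n 1) :
    push (sweepMap κ J τ c 0) c = c := by
  refine push_eq fun l => ?_
  ext y
  rw [mem_oddMap]
  have : ∀ x, sweepMap κ J τ c 0 l x = x := fun x => by norm_num [sweepMap]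
  simp only [this, Finset.filter_eq']
  split_ifs with h <;> simp [h]

/-- The staircase with steps at the points `2 * j - δ` for `j = 1, 2, …`. -/
def stair (δ x : ℝ) : ℤ := max 0 (⌈(x + δ) / 2⌉ - 1)

theorem stair_nonneg (δ x : ℝ) : 0 ≤ stair δ x := le_max_left _ _

theorem stair_lt_iff {δ x : ℝ} {j : ℤ} (hj : 0 < j) : stair δ x < j ↔ x ≤ 2 * j - δ := by
  rw [stair, max_lt_iff, and_iff_right hj, sub_lt_iff_lt_add, Int.lt_add_one_iff, Int.ceil_le,
    div_le_iff₀ two_pos, mul_comm, le_sub_iff_add_le]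

theorem stair_mono (δ : ℝ) : Monotone (stair δ) := by
  intro x y h
  unfold stair
  gcongr

theorem exists_step_eq_add_one (J : ℤ) : ∃ κ, step κ J = J + 1 := by
  by_cases h : Even J
  · exact ⟨0, by simp [step, h]⟩
  · exact ⟨1, by rw [step, if_pos]; simp [h]⟩

theorem exists_sweep {κ : Fin 2} {J : ℤ} (hJ : step κ J = J + 1) (hJ0 : 0 ≤ J) {τ : ℝ}
    {C : Set (Tspace n 1)} (hCclosed : IsClosed C)
    (hC : ∀ c ∈ C, ∀ x < τ + 2, height c x ≤ J + 1) :
    ∃ G : Tspace n 1 × unitInterval → Tspace n 1, ContinuousOn G (C ×ˢ univ) ∧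
      (∀ c, G (c, 0) = c) ∧ ∀ c ∈ C, ∀ x,
        height (G (c, 1)) x = if height c x = J + 1 ∧ x ≤ τ then J else height c x := by
  refine ⟨fun p => push (sweepMap κ J τ p.1 p.2) p.1, ?_, fun c => ?_, fun c hc => ?_⟩
  · refine continuousOn_of_config (hCclosed.prod isClosed_univ) fun ω hω => ?_
    refine (continuousWithinAt_sweep hJ hJ0 hC (ω₀ := ω) hω.1).1.mono ?_
    exact fun ω' hω' => hω'.1
  · simp only [Set.Icc.coe_zero]
    exact push_sweepMap_zero κ J τ c
  · obtain ⟨a, rfl⟩ := isQuotientMap_config.surjective c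
    have h := (continuousWithinAt_sweep hJ hJ0 hC (ω₀ := (a, 1)) hc).2
    simp only [Set.Icc.coe_one] at h ⊢
    exact height_sweep hJ hJ0 (hC _ hc) h

theorem exists_lower_step (δ : ℝ) {J : ℤ} (hJ0 : 0 ≤ J) {f : C(Tspace n 1, Tspace n 1)}
    (hf : ∀ c x, height (f c) x = min (height c x) (max (J + 1) (stair δ x))) :
    ∃ g : C(Tspace n 1, Tspace n 1), g.Homotopic f ∧
      ∀ c x, height (g c) x = min (height c x) (max J (stair δ x)) := by
  obtain ⟨κ, hJ⟩ := exists_step_eq_add_one J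
  have hCclosed : IsClosed {c : Tspace n 1 | ∀ x, height c x ≤ max (J + 1) (stair δ x)} :=
    isClosed_height_le fun x y h => max_le_max le_rfl (stair_mono δ h)
  obtain ⟨G, hG, hG0, hG1⟩ := exists_sweep hJ hJ0 (τ := 2 * (J + 1 : ℤ) - δ) hCclosed (by
    intro c hc x hx
    have h1 : stair δ x < J + 2 := by
      rw [stair_lt_iff (by omega)]
      push_cast at hx ⊢
      linarith
    have := hc x
    rwa [max_eq_left (by omega)] at this)
  have hfC : ∀ c x, height (f c) x ≤ max (J + 1) (stair δ x) := fun c x => by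
    rw [hf]; exact min_le_right _ _
  have hH : Continuous fun p : unitInterval × Tspace n 1 => G (f p.2, p.1) :=
    hG.comp_continuous (by fun_prop) fun p => ⟨hfC _, trivial⟩
  let g : C(Tspace n 1, Tspace n 1) :=
    ⟨fun c => G (f c, 1), hH.comp (continuous_const.prodMk continuous_id)⟩
  have hom : ContinuousMap.Homotopy f g :=
    { toFun := fun p => G (f p.2, p.1)
      continuous_toFun := hH
      map_zero_left := fun c => hG0 _
      map_one_left := fun c => rfl }
  refine ⟨g, ⟨hom.symm⟩, fun c x => ?_⟩
  have hs : stair δ x < J + 1 ↔ x ≤ 2 * (J + 1 : ℤ) - δ := stair_lt_iff (by omega)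
  change height (G (f c, 1)) x = _
  rw [hG1 _ (hfC c), hf]
  simp only [← hs]
  split_ifs with h <;> omega

/-- The configuration space deforms into the configurations whose height lies below a staircase,
by truncation of the height. -/
theorem exists_truncation (n : ℕ) (δ : ℝ) :
    ∃ g : C(Tspace n 1, Tspace n 1), g.Homotopic (ContinuousMap.id _) ∧
      ∀ c x, height (g c) x = min (height c x) (stair δ x) := by
  have key : ∀ k : ℕ, k ≤ 2 * n → ∃ g : C(Tspace n 1, Tspace n 1),
      g.Homotopic (ContinuousMap.id _) ∧
      ∀ c x, height (g c) x = min (height c x) (max (2 * n - k : ℤ) (stair δ x)) := by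
    intro k
    induction k with
    | zero =>
      refine fun _ => ⟨ContinuousMap.id _, ContinuousMap.Homotopic.refl _, fun c x => ?_⟩
      have := (abs_le.1 (abs_height_le c x)).2
      rw [ContinuousMap.id_apply, min_eq_left]
      exact le_max_of_le_left (by simpa using this)
    | succ k ih =>
      intro hk
      obtain ⟨f, hf, hf'⟩ := ih (by omega)
      obtain ⟨g, hg, hg'⟩ := exists_lower_step δ (J := 2 * n - (k + 1 : ℕ)) (by omega) (f := f)
        (fun c x => by rw [hf']; congr 2; push_cast; ring)
      exact ⟨g, hg.trans hf, hg'⟩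
  obtain ⟨g, hg, hg'⟩ := key (2 * n) le_rfl
  refine ⟨g, hg, fun c x => ?_⟩
  rw [hg', max_eq_right]
  have := stair_nonneg δ x
  push_cast
  omega

/-- A continuous map of configuration spaces is obtained from a continuous map of tuples which is
compatible with equality of configurations. -/
theorem exists_lift {φ : Shat n → Shat n} (hφ : Continuous φ)
    {e : Fin 2 → Fin 2} {r : ℝ → ℝ}
    (h : ∀ a κ x, x ∈ oddPoints ((φ a).1 κ) ↔ r x ∈ oddPoints (a.1 (e κ))) :
    ∃ g : C(Tspace n 1, Tspace n 1), ∀ c κ x, x ∈ pts (g c) κ ↔ r x ∈ pts c (e κ) := by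
  have hf : ∀ a b, config a = config b → config (φ a) = config (φ b) := by
    intro a b hab
    refine config_eq_iff.2 fun κ => ?_
    ext x
    rw [h, h, config_eq_iff.1 hab]
  have hcomp : (fun c => config (φ (Function.surjInv isQuotientMap_config.surjective c))) ∘ config =
      config ∘ φ := by
    funext a
    exact hf _ _ (Function.surjInv_eq isQuotientMap_config.surjective (config a))
  refine ⟨⟨fun c => config (φ (Function.surjInv isQuotientMap_config.surjective c)), ?_⟩,
    fun c κ x => ?_⟩
  · rw [isQuotientMap_config.continuous_iff, hcomp]
    exact continuous_config.comp hφ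
  · rw [ContinuousMap.coe_mk, pts_config, h]
    conv_rhs => rw [← Function.surjInv_eq isQuotientMap_config.surjective c, pts_config]

theorem exists_swap (n : ℕ) : ∃ σ : C(Tspace n 1, Tspace n 1),
    σ.comp σ = ContinuousMap.id _ ∧ ∀ c x, height (σ c) x = -height c x := by
  have hmem : ∀ a : Shat n, (fun κ => a.1 (1 - κ)) ∈ Shat n := fun a =>
    mem_Shat.2 fun i j => (mem_Shat.1 a.2 j i).symm
  obtain ⟨σ, hσ⟩ := exists_lift (φ := fun a : Shat n => ⟨fun κ => a.1 (1 - κ), hmem a⟩)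
    (e := fun κ => 1 - κ) (r := id)
    (Continuous.subtype_mk (continuous_pi fun _ => continuous_pi fun _ => continuous_coord _ _) _)
    fun a κ x => Iff.rfl
  refine ⟨σ, ?_, fun c x => ?_⟩
  · ext1 c
    refine ext_pts fun κ => ?_
    ext x
    simp [hσ]
  · have hs : supp (σ c) = supp c := by
      ext p
      rw [mem_supp, mem_supp, Fin.exists_fin_two, Fin.exists_fin_two, hσ, hσ]
      exact or_comm
    unfold height
    rw [hs, ← Finset.sum_neg_distrib]
    refine Finset.sum_congr rfl fun p hp => ?_
    have h1 : p ∈ pts (σ c) 0 ↔ ¬ p ∈ pts c 0 := by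
      rw [hσ]
      constructor
      · exact fun h => pts_disjoint c (by decide : (1 : Fin 2) ≠ 0) h
      · intro h
        rcases Finset.mem_union.1 (Finset.mem_filter.1 hp).1 with h' | h'
        · exact absurd h' h
        · exact h'
    unfold sign
    rw [hs]
    simp only [h1]
    by_cases h2 : p ∈ pts c 0 <;> by_cases h3 : Even ((supp c).filter (· < p)).card <;>
      simp only [h2, h3] <;> norm_num

theorem exists_reflection (n : ℕ) : ∃ ρ : C(Tspace n 1, Tspace n 1),
    ρ.comp ρ = ContinuousMap.id _ ∧ ∀ c, total (ρ c) = -total c ∧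
      ∀ x, -x ∉ supp c → height (ρ c) x = height c (-x) - total c := by
  have hmem : ∀ a : Shat n, (fun κ i => -a.1 κ i) ∈ Shat n := fun a =>
    mem_Shat.2 fun i j h => mem_Shat.1 a.2 i j (neg_injective h)
  obtain ⟨ρ, hρ⟩ := exists_lift (φ := fun a : Shat n => ⟨fun κ i => -a.1 κ i, hmem a⟩)
    (e := id) (r := fun x => -x)
    (Continuous.subtype_mk (continuous_pi fun _ => continuous_pi fun _ =>
      (continuous_coord _ _).neg) _) fun a κ x => by
      simp only [mem_oddPoints, neg_eq_iff_eq_neg, id]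
  have hs : ∀ c p, p ∈ supp (ρ c) ↔ -p ∈ supp c := fun c p => by
    simp only [mem_supp, hρ, id]
  have hcard : ∀ c p, ((supp (ρ c)).filter (· < p)).card =
      ((supp c).filter (-p < ·)).card := by
    intro c p
    refine Finset.card_bij (fun q _ => -q) ?_ (fun _ _ _ _ h => neg_injective h) fun q hq => ?_
    · intro q hq
      rw [Finset.mem_filter] at hq ⊢
      exact ⟨(hs c q).1 hq.1, neg_lt_neg hq.2⟩
    · rw [Finset.mem_filter] at hq
      refine ⟨-q, Finset.mem_filter.2 ⟨(hs c _).2 (by simpa using hq.1), ?_⟩, neg_neg q⟩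
      linarith [hq.2]
  have hsign : ∀ c p, p ∈ supp c → sign (ρ c) (-p) = -sign c p := by
    intro c p hp
    have h1 : Even ((supp c).filter (p < ·)).card ↔ ¬ Even ((supp c).filter (· < p)).card := by
      have h2 := Finset.card_filter_add_card_filter_not (s := supp c) (· < p)
      have h3 : (supp c).filter (¬ · < p) = insert p ((supp c).filter (p < ·)) := by
        ext q
        simp only [Finset.mem_filter, Finset.mem_insert, not_lt]
        constructor
        · rintro ⟨h4, h5⟩
          rcases h5.eq_or_lt with h5 | h5
          · exact Or.inl h5.symm
          · exact Or.inr ⟨h4, h5⟩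
        · rintro (rfl | ⟨h4, h5⟩)
          · exact ⟨hp, le_rfl⟩
          · exact ⟨h4, h5.le⟩
      rw [h3, Finset.card_insert_of_notMem (by simp)] at h2
      have h4 := even_card_supp c
      rw [← h2, Nat.even_add, Nat.even_add_one] at h4
      tauto
    unfold sign
    rw [hcard]
    simp only [hρ, neg_neg, h1, id]
    by_cases h2 : p ∈ pts c 0 <;> by_cases h3 : Even ((supp c).filter (· < p)).card <;>
      simp only [h2, h3] <;> norm_num
  have hsum : ∀ c (P : ℝ → Prop), ∑ p ∈ (supp (ρ c)).filter P, sign (ρ c) p =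
      -∑ p ∈ (supp c).filter (fun p => P (-p)), sign c p := by
    intro c P
    rw [← Finset.sum_neg_distrib]
    refine Finset.sum_nbij' (fun p => -p) (fun p => -p) ?_ ?_ (fun p _ => neg_neg p)
      (fun p _ => neg_neg p) ?_
    · intro p hp
      rw [Finset.mem_filter] at hp ⊢
      rw [neg_neg]
      exact ⟨(hs c p).1 hp.1, hp.2⟩
    · intro p hp
      rw [Finset.mem_filter] at hp ⊢
      exact ⟨(hs c _).2 (by simpa using hp.1), hp.2⟩
    · intro p hp
      rw [← hsign c (-p) ((hs c p).1 (Finset.mem_filter.1 hp).1), neg_neg]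
  refine ⟨ρ, ?_, fun c => ⟨?_, fun x hx => ?_⟩⟩
  · ext1 c
    refine ext_pts fun κ => ?_
    ext x
    simp [hρ]
  · simpa [total] using hsum c fun _ => True
  · unfold height
    rw [hsum, total, ← Finset.sum_filter_add_sum_filter_not (supp c) (· < -x)]
    have : (supp c).filter (¬ · < -x) = (supp c).filter fun p => -p < x := by
      refine Finset.filter_congr fun p hp => ?_
      rw [not_lt, neg_lt, le_iff_lt_or_eq, or_iff_left]
      rintro rfl
      exact hx hp
    rw [this]
    ring

theorem total_homotopy {f g : C(Tspace n 1, Tspace n 1)} (H : f.Homotopy g) (t : unitInterval)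
    (c : Tspace n 1) : total (H (t, c)) = total (f c) := by
  have h : Continuous fun t : unitInterval => total (H (t, c)) :=
    continuous_total.comp (by fun_prop)
  have := PreconnectedSpace.constant inferInstance h (x := t) (y := 0)
  simpa using this

theorem total_of_homotopic {f g : C(Tspace n 1, Tspace n 1)} (h : f.Homotopic g) (c : Tspace n 1) :
    total (g c) = total (f c) := by
  obtain ⟨H⟩ := h
  simpa using total_homotopy H 1 c

theorem homotopic_conj {s g : C(Tspace n 1, Tspace n 1)} (hs : s.comp s = ContinuousMap.id _)
    (hg : g.Homotopic (ContinuousMap.id _)) :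
    (s.comp (g.comp s)).Homotopic (ContinuousMap.id _) := by
  have := (ContinuousMap.Homotopic.refl s).comp (hg.comp (ContinuousMap.Homotopic.refl s))
  rwa [ContinuousMap.id_comp, hs] at this

theorem exists_upper_truncation (n : ℕ) (δ : ℝ) :
    ∃ g : C(Tspace n 1, Tspace n 1), g.Homotopic (ContinuousMap.id _) ∧
      ∀ c x, height (g c) x = max (height c x) (-stair δ x) := by
  obtain ⟨g, hg, hg'⟩ := exists_truncation n δ
  obtain ⟨σ, hσ, hσ'⟩ := exists_swap n
  refine ⟨_, homotopic_conj hσ hg, fun c x => ?_⟩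
  rw [ContinuousMap.comp_apply, ContinuousMap.comp_apply, hσ', hg', hσ']
  omega

theorem exists_reflected {g : C(Tspace n 1, Tspace n 1)} (hg : g.Homotopic (ContinuousMap.id _))
    {φ : ℝ → ℤ → ℤ} (hφ : ∀ c x, height (g c) x = φ x (height c x)) :
    ∃ g' : C(Tspace n 1, Tspace n 1), g'.Homotopic (ContinuousMap.id _) ∧
      ∀ c, ∃ E : Finset ℝ, ∀ x ∉ E,
        height (g' c) x = φ (-x) (height c x - total c) + total c := by
  obtain ⟨ρ, hρ, hρ'⟩ := exists_reflection n
  refine ⟨_, homotopic_conj hρ hg, fun c =>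
    ⟨supp c ∪ (supp (g (ρ c))).image fun x => -x, fun x hx => ?_⟩⟩
  rw [Finset.mem_union, not_or] at hx
  rw [ContinuousMap.comp_apply, ContinuousMap.comp_apply, (hρ' _).2, hφ, (hρ' _).2,
    ← total_of_homotopic hg, ContinuousMap.id_apply, (hρ' _).1, neg_neg, sub_neg_eq_add]
  · simpa using hx.1
  · intro h
    exact hx.2 (Finset.mem_image.2 ⟨-x, h, neg_neg x⟩)

theorem ceil_add_ceil (D : ℤ) (u : ℝ) :
    ⌈u⌉ + ⌈D - u⌉ = D + 1 ∨ ⌈u⌉ + ⌈D - u⌉ = D ∧ u = ⌈u⌉ := by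
  have h1 := Int.le_ceil u
  have h2 := Int.ceil_lt_add_one u
  rcases h1.eq_or_lt with h | h
  · refine Or.inr ⟨?_, h⟩
    have : ⌈(D : ℝ) - u⌉ = D - ⌈u⌉ := by
      rw [Int.ceil_eq_iff]
      push_cast
      constructor <;> linarith
    omega
  · left
    have : ⌈(D : ℝ) - u⌉ = D - ⌈u⌉ + 1 := by
      rw [Int.ceil_eq_iff]
      push_cast
      constructor <;> linarith
    omega

/-- Away from a finite set of points, a pair of opposite staircases determines the result of a
truncation from both ends. -/
theorem stair_dichotomy (k : ℤ) : ∃ E : Finset ℝ, ∀ x ∉ E,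
    stair (|k| + 1 : ℤ) x = 0 ∧ |k| ≤ stair (|k| + 1 : ℤ) (-x) ∨ stair (|k| + 1 : ℤ) (-x) = 0 ∨
      stair (|k| + 1 : ℤ) x + stair (|k| + 1 : ℤ) (-x) = |k| := by
  set D : ℤ := |k| + 1 with hD
  refine ⟨(Finset.Icc 1 D).image fun j : ℤ => (2 * j - D : ℝ), fun x hx => ?_⟩
  have h1 := ceil_add_ceil D ((x + D) / 2)
  have h2 : (D : ℝ) - (x + D) / 2 = (-x + D) / 2 := by ring
  have h3 : (x + D) / 2 = (⌈(x + D) / 2⌉ : ℝ) →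
      ¬ (1 ≤ ⌈(x + D) / 2⌉ ∧ ⌈(x + D) / 2⌉ ≤ D) := by
    intro h h'
    refine hx (Finset.mem_image.2 ⟨_, Finset.mem_Icc.2 h', ?_⟩)
    rw [← h]
    ring
  rw [h2] at h1
  have h4 := abs_nonneg k
  unfold stair
  rcases h1 with h1 | ⟨h1, h5⟩
  · omega
  · have := h3 h5
    omega

theorem exists_retraction (n : ℕ) (k : ℤ) :
    ∃ g : C(Tspace n 1, Tspace n 1), g.Homotopic (ContinuousMap.id _) ∧
      ∀ c c', total c = k → total c' = k → g c = g c' := by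
  obtain ⟨g₁, h₁, h₁'⟩ := exists_truncation n (|k| + 1 : ℤ)
  obtain ⟨g₂, h₂, h₂'⟩ := exists_upper_truncation n (|k| + 1 : ℤ)
  obtain ⟨g₃, h₃, h₃'⟩ := exists_reflected h₁ (φ := fun x v => min v (stair (|k| + 1 : ℤ) x)) h₁'
  obtain ⟨g₄, h₄, h₄'⟩ := exists_reflected h₂ (φ := fun x v => max v (-stair (|k| + 1 : ℤ) x)) h₂'
  obtain ⟨E₀, hE₀⟩ := stair_dichotomy k
  have key : ∀ c, total c = k → ∃ E : Finset ℝ, ∀ x ∉ E,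
      height (g₄ (g₃ (g₂ (g₁ c)))) x =
        max (min (max (min (height c x) (stair (|k| + 1 : ℤ) x)) (-stair (|k| + 1 : ℤ) x))
          (k + stair (|k| + 1 : ℤ) (-x))) (k - stair (|k| + 1 : ℤ) (-x)) := by
    intro c hc
    obtain ⟨E₃, hE₃⟩ := h₃' (g₂ (g₁ c))
    obtain ⟨E₄, hE₄⟩ := h₄' (g₃ (g₂ (g₁ c)))
    refine ⟨E₃ ∪ E₄, fun x hx => ?_⟩
    rw [Finset.mem_union, not_or] at hx
    rw [hE₄ x hx.2, hE₃ x hx.1, ← total_of_homotopic h₃, ContinuousMap.id_apply,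
      ← total_of_homotopic h₂, ContinuousMap.id_apply, ← total_of_homotopic h₁,
      ContinuousMap.id_apply, hc, h₂', h₁']
    omega
  refine ⟨g₄.comp (g₃.comp (g₂.comp g₁)), h₄.comp (h₃.comp (h₂.comp h₁)), fun c c' hc hc' => ?_⟩
  obtain ⟨E, hE⟩ := key c hc
  obtain ⟨E', hE'⟩ := key c' hc'
  refine ext_height ⟨E₀ ∪ (E ∪ E'), fun x hx => ?_⟩
  simp only [Finset.mem_union, not_or] at hx
  have h := hE₀ x hx.1
  simp only [ContinuousMap.comp_apply]
  rw [hE x hx.2.1, hE' x hx.2.2]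
  have := stair_nonneg (|k| + 1 : ℤ) x
  have := stair_nonneg (|k| + 1 : ℤ) (-x)
  generalize stair (|k| + 1 : ℤ) x = m at *
  generalize stair (|k| + 1 : ℤ) (-x) = m' at *
  rcases abs_cases k with ⟨h', _⟩ | ⟨h', _⟩ <;> rw [h'] at h <;> omega

theorem contractibleSpace_fibre (t : Tspace n 1) :
    ContractibleSpace {c : Tspace n 1 | total c = total t} := by
  obtain ⟨g, ⟨H⟩, hg⟩ := exists_retraction n (total t)
  have hmem : ∀ s c, total c = total t → total (H.symm (s, c)) = total t := fun s c hc => by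
    rw [total_homotopy]; exact hc
  refine (contractible_iff_id_nullhomotopic _).2 ⟨⟨g t, ?_⟩, ⟨?_⟩⟩
  · simpa using hmem 1 t rfl
  · exact
      { toFun := fun p => ⟨H.symm (p.1, p.2.1), hmem _ _ p.2.2⟩
        continuous_toFun := by fun_prop
        map_zero_left := fun c => Subtype.ext (by simp)
        map_one_left := fun c => Subtype.ext (by simpa using hg _ _ c.2 rfl) }

theorem connectedComponent_eq (t : Tspace n 1) :
    connectedComponent t = {c | total c = total t} := by
  have := contractibleSpace_fibre t
  refine Subset.antisymm (fun c hc => ?_) ?_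
  · exact isPreconnected_connectedComponent.constant continuous_total.continuousOn hc
      mem_connectedComponent
  · exact (isPreconnected_iff_preconnectedSpace.2 inferInstance).subset_connectedComponent rfl

theorem coe_eq_coe_iff_total {c c' : Tspace n 1} :
    (c : ConnectedComponents (Tspace n 1)) = c' ↔ total c = total c' := by
  rw [ConnectedComponents.coe_eq_coe', connectedComponent_eq]
  rfl

theorem card_connectedComponents (n : ℕ) :
    Nat.card (ConnectedComponents (Tspace n 1)) = n + 1 := by
  choose f hf using fun i : Fin (n + 1) => exists_total n (Nat.lt_succ_iff.1 i.2)
  have hbij : Function.Bijective fun i => (f i : ConnectedComponents (Tspace n 1)) := by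
    constructor
    · intro i j hij
      have h := coe_eq_coe_iff_total.1 hij
      rw [hf, hf] at h
      exact Fin.ext (by omega)
    · intro q
      obtain ⟨c, rfl⟩ := ConnectedComponents.surjective_coe q
      obtain ⟨i, hi, hc⟩ := exists_total_eq c
      refine ⟨⟨i, Nat.lt_succ_iff.2 hi⟩, coe_eq_coe_iff_total.2 ?_⟩
      rw [hf, hc]
  rw [← Nat.card_eq_of_bijective _ hbij, Nat.card_fin]

end ModTwo

/-- For every `n ≥ 1`, the space `T(n,1)` has exactly `n+1` connected components,
and every connected component of `T(n,1)` is contractible. -/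
theorem tspace_n1_components (n : ℕ) (hn : 1 ≤ n) :
    Nat.card (ConnectedComponents (Tspace n 1)) = n + 1 ∧
    ∀ t : Tspace n 1, ContractibleSpace ↥(connectedComponent t) := by
  refine ⟨ModTwo.card_connectedComponents n, fun t => ?_⟩
  rw [ModTwo.connectedComponent_eq]
  exact ModTwo.contractibleSpace_fibre t

end
end

section
/- For every n ≥ 1: if m ≥ 2 then rat(n,m) is path-connected, and if m ≥ 3 then rat(n,m) is simply connected (path-connected with trivial fundamental group). -/
open OnePoint Projectivization

noncomputable section

/-- Real projective `m`-space, the projectivization of `ℝ^{m+1}`. -/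
abbrev RP (m : ℕ) := Projectivization ℝ (Fin (m + 1) → ℝ)

instance (m : ℕ) : TopologicalSpace (RP m) :=
  inferInstanceAs (TopologicalSpace (Quotient _))

/-- The basepoint `[1 : 1 : ⋯ : 1]` of `ℝP^m`. -/
def basept (m : ℕ) : RP m :=
  Projectivization.mk ℝ (fun _ => (1 : ℝ)) (by
    intro h
    exact one_ne_zero (congrFun h 0))

/-- The based loop space `Ω ℝP^m`: continuous maps `ℝP¹ = ℝ ∪ {∞} → ℝP^m`
sending `∞` to the basepoint, with the compact-open topology. -/
abbrev OmegaRP (m : ℕ) := {f : C(OnePoint ℝ, RP m) // f ∞ = basept m}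

/-- The set of based loops arising from `(m+1)`-tuples of monic real polynomials of
degree `n` with no common complex root. -/
def RRat (n m : ℕ) : Set (OmegaRP m) :=
  {f | ∃ p : Fin (m + 1) → Polynomial ℝ,
    (∀ i, (p i).Monic) ∧ (∀ i, (p i).natDegree = n) ∧
    (∀ z : ℂ, ∃ i, Polynomial.aeval z (p i) ≠ 0) ∧
    ∀ x : ℝ, ∃ hx : (fun i => (p i).eval x) ≠ 0,
      f.1 (x : OnePoint ℝ) = Projectivization.mk ℝ (fun i => (p i).eval x) hx}

/-- `rat n m` is the closure of `RRat n m` in `Ω ℝP^m`. -/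
def ratSet (n m : ℕ) : Set (OmegaRP m) := closure (RRat n m)

open Filter Topology

namespace RatLoop

section Cone

variable {F : Type*} [NormedAddCommGroup F] [InnerProductSpace ℝ F]

theorem inner_mul_inner_pos {u v w : F} (hu : ‖u‖ = 1)
    (hv : ‖v‖ ^ 2 < 2 * inner ℝ u v ^ 2) (hw : ‖w‖ ^ 2 < 2 * inner ℝ u w ^ 2)
    (hvw : 0 < inner ℝ v w) : 0 < inner ℝ u v * inner ℝ u w := by
  set α := inner ℝ u v with hα
  set β := inner ℝ u w with hβ
  have huu : inner ℝ u u = 1 := by rw [real_inner_self_eq_norm_sq, hu]; norm_num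
  have hvu : inner ℝ v u = α := by rw [real_inner_comm]
  have hwu : inner ℝ w u = β := by rw [real_inner_comm]
  have h1 : ‖v - α • u‖ ^ 2 = ‖v‖ ^ 2 - α ^ 2 := by
    rw [norm_sub_sq_real, norm_smul, hu, real_inner_smul_right, hvu, Real.norm_eq_abs, mul_one,
      sq_abs]
    ring
  have h2 : ‖w - β • u‖ ^ 2 = ‖w‖ ^ 2 - β ^ 2 := by
    rw [norm_sub_sq_real, norm_smul, hu, real_inner_smul_right, hwu, Real.norm_eq_abs, mul_one,
      sq_abs]
    ring
  have h3 : inner ℝ (v - α • u) (w - β • u) = inner ℝ v w - α * β := by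
    simp only [inner_sub_left, inner_sub_right, real_inner_smul_left, real_inner_smul_right, huu,
      hvu, ← hβ]
    ring
  have h4 := real_inner_le_norm (v - α • u) (w - β • u)
  rw [h3] at h4
  by_contra! hneg
  have h5 : ‖v - α • u‖ < |α| :=
    lt_of_pow_lt_pow_left₀ 2 (abs_nonneg _) (by rw [sq_abs]; linarith)
  have h6 : ‖w - β • u‖ < |β| :=
    lt_of_pow_lt_pow_left₀ 2 (abs_nonneg _) (by rw [sq_abs]; linarith)
  have h7 : ‖v - α • u‖ * ‖w - β • u‖ ≤ |α| * |β| := by gcongr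
  rw [← abs_mul, abs_of_nonpos hneg] at h7
  linarith

theorem cone_combo {u v w : F} {κ a b : ℝ} (hu : ‖u‖ = 1) (hκ : 1 / 2 ≤ κ)
    (hv : κ * ‖v‖ ^ 2 < inner ℝ u v ^ 2) (hw : κ * ‖w‖ ^ 2 < inner ℝ u w ^ 2)
    (hvw : 0 < inner ℝ v w) (ha : 0 ≤ a) (hb : 0 ≤ b) (hab : a + b = 1) :
    κ * ‖a • v + b • w‖ ^ 2 < inner ℝ u (a • v + b • w) ^ 2 := by
  have hpos : 0 < inner ℝ u v * inner ℝ u w :=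
    inner_mul_inner_pos hu (by nlinarith [sq_nonneg ‖v‖]) (by nlinarith [sq_nonneg ‖w‖]) hvw
  have hcs : (κ * inner ℝ v w) < inner ℝ u v * inner ℝ u w := by
    have h1 : κ * inner ℝ v w ≤ κ * (‖v‖ * ‖w‖) := by
      gcongr
      exact real_inner_le_norm v w
    have h2 : (κ * (‖v‖ * ‖w‖)) ^ 2 < (inner ℝ u v * inner ℝ u w) ^ 2 := by
      calc (κ * (‖v‖ * ‖w‖)) ^ 2 = (κ * ‖v‖ ^ 2) * (κ * ‖w‖ ^ 2) := by ring
        _ < inner ℝ u v ^ 2 * inner ℝ u w ^ 2 := by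
          apply mul_lt_mul'' hv hw <;> positivity
        _ = _ := by ring
    exact h1.trans_lt (lt_of_pow_lt_pow_left₀ 2 hpos.le h2)
  rw [inner_add_right, real_inner_smul_right, real_inner_smul_right, norm_add_sq_real, norm_smul,
    norm_smul, real_inner_smul_left, real_inner_smul_right, Real.norm_of_nonneg ha,
    Real.norm_of_nonneg hb]
  have hA := mul_le_mul_of_nonneg_left hv.le (sq_nonneg a)
  have hB := mul_le_mul_of_nonneg_left hw.le (sq_nonneg b)
  have hC := mul_le_mul_of_nonneg_left hcs.le (mul_nonneg ha hb)
  rcases ha.eq_or_lt with rfl | ha'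
  · obtain rfl : b = 1 := by linarith
    nlinarith
  · have hA' := mul_lt_mul_of_pos_left hv (pow_pos ha' 2)
    nlinarith

end Cone

section Embedding

variable {m : ℕ}

/-- The orthogonal projection matrix onto the line spanned by `v`, as a Euclidean vector. -/
def lineMatrix (v : Fin (m + 1) → ℝ) : EuclideanSpace ℝ (Fin (m + 1) × Fin (m + 1)) :=
  WithLp.toLp 2 fun ij => v ij.1 * v ij.2 / ∑ k, v k ^ 2

theorem sum_sq_pos {v : Fin (m + 1) → ℝ} (hv : v ≠ 0) : 0 < ∑ k, v k ^ 2 := by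
  obtain ⟨i, hi⟩ := Function.ne_iff.1 hv
  exact Finset.sum_pos' (fun _ _ => sq_nonneg _)
    ⟨i, Finset.mem_univ _, by have : v i ≠ 0 := hi; positivity⟩

theorem lineMatrix_smul {c : ℝ} (hc : c ≠ 0) (v : Fin (m + 1) → ℝ) :
    lineMatrix (c • v) = lineMatrix v := by
  ext ij
  simp only [lineMatrix, Pi.smul_apply, smul_eq_mul, mul_pow, ← Finset.mul_sum]
  rw [show c * v ij.1 * (c * v ij.2) = c ^ 2 * (v ij.1 * v ij.2) by ring,
    mul_div_mul_left _ _ (pow_ne_zero 2 hc)]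

theorem norm_lineMatrix_sub_sq {v w : Fin (m + 1) → ℝ} (hv : v ≠ 0) (hw : w ≠ 0) :
    ‖lineMatrix v - lineMatrix w‖ ^ 2 =
      2 - 2 * (v ⬝ᵥ w) ^ 2 / ((∑ k, v k ^ 2) * ∑ k, w k ^ 2) := by
  have hv' := (sum_sq_pos hv).ne'
  have hw' := (sum_sq_pos hw).ne'
  rw [EuclideanSpace.norm_sq_eq, Fintype.sum_prod_type]
  set A := ∑ k, v k ^ 2 with hA
  set B := ∑ k, w k ^ 2 with hB
  have key : ∀ i j, ‖(lineMatrix v - lineMatrix w) (i, j)‖ ^ 2 =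
      (v i ^ 2 * v j ^ 2) / A ^ 2 - 2 * ((v i * w i) * (v j * w j)) / (A * B)
        + (w i ^ 2 * w j ^ 2) / B ^ 2 := by
    intro i j
    simp only [lineMatrix, PiLp.sub_apply, Real.norm_eq_abs, sq_abs, ← hA, ← hB]
    field_simp
    ring
  simp only [key, Finset.sum_add_distrib, Finset.sum_sub_distrib, ← Finset.sum_div,
    ← Finset.mul_sum, ← Finset.sum_mul, ← hA, ← hB]
  simp only [dotProduct]
  field_simp
  ring

theorem continuousAt_lineMatrix {v : Fin (m + 1) → ℝ} (hv : v ≠ 0) :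
    ContinuousAt lineMatrix v := by
  refine (PiLp.continuous_toLp 2 _).continuousAt.comp ?_
  refine continuousAt_pi.2 fun ij => ?_
  have hsum : Continuous fun v : Fin (m + 1) → ℝ => ∑ k, v k ^ 2 :=
    continuous_finsetSum _ fun k _ => (continuous_apply k).pow 2
  exact ContinuousAt.div (by fun_prop) hsum.continuousAt (sum_sq_pos hv).ne'

/-- The embedding of `ℝP^m` in matrices sending a line to the orthogonal projection onto it. -/
def toMatrix (ℓ : RP m) : EuclideanSpace ℝ (Fin (m + 1) × Fin (m + 1)) :=
  ℓ.lift (fun v => lineMatrix v.1) fun a b t hab => by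
    have ht : t ≠ 0 := by
      rintro rfl
      exact a.2 (by simpa using hab)
    simp only [hab]
    exact lineMatrix_smul ht _

theorem toMatrix_mk {v : Fin (m + 1) → ℝ} (hv : v ≠ 0) :
    toMatrix (Projectivization.mk ℝ v hv) = lineMatrix v := rfl

theorem continuous_mk :
    Continuous fun v : {v : Fin (m + 1) → ℝ // v ≠ 0} => Projectivization.mk ℝ v.1 v.2 :=
  continuous_quotient_mk'

theorem continuous_toMatrix : Continuous (toMatrix (m := m)) := by
  refine continuous_quot_lift _ ?_
  exact continuous_iff_continuousAt.2 fun v =>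
    (continuousAt_lineMatrix v.2).comp continuous_subtype_val.continuousAt

theorem toMatrix_injective : Function.Injective (toMatrix (m := m)) := by
  intro ℓ₁ ℓ₂ h
  induction ℓ₁ using Projectivization.ind with | _ v hv => ?_
  induction ℓ₂ using Projectivization.ind with | _ w hw => ?_
  rw [toMatrix_mk, toMatrix_mk] at h
  have hA := sum_sq_pos hv
  have hB := sum_sq_pos hw
  have h' : ∀ i j, v i * v j / (∑ k, v k ^ 2) = w i * w j / ∑ k, w k ^ 2 := fun i j =>
    congrArg (fun M : EuclideanSpace ℝ (Fin (m + 1) × Fin (m + 1)) => M (i, j)) h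
  set A := ∑ k, v k ^ 2
  set B := ∑ k, w k ^ 2
  obtain ⟨j, hj⟩ := Function.ne_iff.1 hw
  have hj : w j ≠ 0 := hj
  have hvj : v j ≠ 0 := by
    intro h0
    have := h' j j
    rw [h0, zero_mul, zero_div, eq_comm, div_eq_zero_iff] at this
    rcases this with h | h
    · exact hj (mul_self_eq_zero.1 h)
    · exact hB.ne' h
  rw [Projectivization.mk_eq_mk_iff']
  refine ⟨w j / v j * (A / B), ?_⟩
  ext i
  have := h' i j
  rw [Pi.smul_apply, smul_eq_mul]
  field_simp at this ⊢
  linarith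

theorem ofLp_ne_zero_of_mem_sphere
    (v : Metric.sphere (0 : EuclideanSpace ℝ (Fin (m + 1))) 1) : WithLp.ofLp v.1 ≠ 0 := fun h => by
  have h0 : v.1 = 0 := by
    ext i
    exact congrFun h i
  have := v.2
  rw [h0] at this
  simp at this

/-- The quotient map from the unit sphere to projective space. -/
def sphereToRP (v : Metric.sphere (0 : EuclideanSpace ℝ (Fin (m + 1))) 1) : RP m :=
  Projectivization.mk ℝ (WithLp.ofLp v.1) (ofLp_ne_zero_of_mem_sphere v)

theorem continuous_sphereToRP : Continuous (sphereToRP (m := m)) :=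
  continuous_mk.comp
    (f := fun v : Metric.sphere (0 : EuclideanSpace ℝ (Fin (m + 1))) 1 =>
      (⟨WithLp.ofLp v.1, ofLp_ne_zero_of_mem_sphere v⟩ : {v : Fin (m + 1) → ℝ // v ≠ 0}))
    (Continuous.subtype_mk ((PiLp.continuous_ofLp 2 _).comp continuous_subtype_val) _)

theorem sphereToRP_surjective : Function.Surjective (sphereToRP (m := m)) := by
  intro ℓ
  induction ℓ using Projectivization.ind with | _ v hv => ?_
  have hv' : WithLp.toLp 2 v ≠ 0 := fun h => hv (by
    ext i
    exact congrArg (fun M : EuclideanSpace ℝ (Fin (m + 1)) => M i) h)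
  refine ⟨⟨‖WithLp.toLp 2 v‖⁻¹ • WithLp.toLp 2 v, ?_⟩, ?_⟩
  · simp [norm_smul, norm_ne_zero_iff.2 hv']
  · rw [sphereToRP, Projectivization.mk_eq_mk_iff']
    exact ⟨‖WithLp.toLp 2 v‖⁻¹, rfl⟩

instance : CompactSpace (RP m) :=
  Function.Surjective.compactSpace continuous_sphereToRP sphereToRP_surjective

theorem isInducing_toMatrix : IsInducing (toMatrix (m := m)) :=
  (continuous_toMatrix.isClosedEmbedding toMatrix_injective).isInducing

end Embedding

section Loops

variable {m N : ℕ}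

/-- The value at `x` of the tuple of monic polynomials of degree `N + 1` whose lower
coefficients are given by `a`. -/
def tupleEval (a : Fin (m + 1) → Fin (N + 1) → ℝ) (x : ℝ) : Fin (m + 1) → ℝ :=
  fun i => x ^ (N + 1) + ∑ k, a i k * x ^ (k : ℕ)

theorem continuous_tupleEval :
    Continuous fun z : (Fin (m + 1) → Fin (N + 1) → ℝ) × ℝ => tupleEval z.1 z.2 := by
  refine continuous_pi fun i => ?_
  refine Continuous.add (by fun_prop) (continuous_finsetSum _ fun k _ => ?_)
  exact Continuous.mul ((continuous_apply_apply i k).comp continuous_fst)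
    (continuous_snd.pow _)

theorem tendsto_tupleEval (a : Fin (m + 1) → Fin (N + 1) → ℝ) :
    Tendsto (fun z : (Fin (m + 1) → Fin (N + 1) → ℝ) × ℝ =>
      (z.2 ^ (N + 1))⁻¹ • tupleEval z.1 z.2) (𝓝 a ×ˢ cocompact ℝ) (𝓝 fun _ => 1) := by
  have hx0 : ∀ᶠ z : (Fin (m + 1) → Fin (N + 1) → ℝ) × ℝ in 𝓝 a ×ˢ cocompact ℝ, z.2 ≠ 0 :=
    tendsto_snd.eventually (by
      have : ({0}ᶜ : Set ℝ) ∈ cocompact ℝ := isCompact_singleton.compl_mem_cocompact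
      exact this)
  refine tendsto_pi_nhds.2 fun i => ?_
  have hlim : Tendsto (fun z : (Fin (m + 1) → Fin (N + 1) → ℝ) × ℝ =>
      1 + ∑ k : Fin (N + 1), z.1 i k * (z.2⁻¹) ^ (N + 1 - (k : ℕ))) (𝓝 a ×ˢ cocompact ℝ)
      (𝓝 (1 + ∑ k : Fin (N + 1), a i k * 0 ^ (N + 1 - (k : ℕ)))) := by
    refine tendsto_const_nhds.add (tendsto_finsetSum _ fun k _ => Tendsto.mul ?_ ?_)
    · exact ((continuous_apply_apply i k).tendsto a).comp tendsto_fst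
    · exact Tendsto.pow ((tendsto_inv₀_cobounded (α := ℝ)).comp
        (by rw [Metric.cobounded_eq_cocompact]; exact tendsto_snd)) _
  have hz : (1 + ∑ k : Fin (N + 1), a i k * 0 ^ (N + 1 - (k : ℕ))) = 1 := by
    rw [Finset.sum_eq_zero, add_zero]
    intro k _
    rw [zero_pow (by omega), mul_zero]
  rw [hz] at hlim
  refine hlim.congr' ?_
  filter_upwards [hx0] with z hz
  simp only [tupleEval, Pi.smul_apply, smul_eq_mul, mul_add, Finset.mul_sum]
  congr 1
  · field_simp
  · refine Finset.sum_congr rfl fun k _ => ?_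
    have : z.2 ^ (N + 1) = z.2 ^ (k : ℕ) * z.2 ^ (N + 1 - (k : ℕ)) := by
      rw [← pow_add]
      congr 1
      omega
    rw [this, inv_pow]
    field_simp

/-- Coefficients of tuples of monic polynomials of degree `N + 1` without common real root. -/
def noRealRoot (m N : ℕ) : Set (Fin (m + 1) → Fin (N + 1) → ℝ) := {a | ∀ x, tupleEval a x ≠ 0}

/-- The based map `ℝ ∪ {∞} → ℝP^m` defined by a tuple without common real root. -/
def tupleMap (a : noRealRoot m N) (y : OnePoint ℝ) : RP m :=
  y.elim (basept m) fun x => Projectivization.mk ℝ (tupleEval a.1 x) (a.2 x)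

theorem continuous_tupleMap :
    Continuous fun z : noRealRoot m N × OnePoint ℝ => tupleMap z.1 z.2 := by
  refine isInducing_toMatrix.continuous_iff.2 (continuous_iff_continuousAt.2 ?_)
  rintro ⟨a, y⟩
  induction y using OnePoint.rec with
  | infty =>
    rw [ContinuousAt, nhds_prod_eq, OnePoint.nhds_infty_eq, coclosedCompact_eq_cocompact,
      prod_sup, tendsto_sup]
    constructor
    · rw [prod_map_right, tendsto_map'_iff]
      have h := (continuousAt_lineMatrix (m := m) (v := fun _ => 1)
        (fun h => one_ne_zero (congrFun h 0))).tendsto.comp ((tendsto_tupleEval a.1).comp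
          ((continuous_subtype_val.tendsto a).prodMap (tendsto_id (x := cocompact ℝ))))
      refine h.congr' ?_
      have hx0 : ∀ᶠ z : noRealRoot m N × ℝ in 𝓝 a ×ˢ cocompact ℝ, z.2 ≠ 0 :=
        tendsto_snd.eventually (by
          have : ({0}ᶜ : Set ℝ) ∈ cocompact ℝ := isCompact_singleton.compl_mem_cocompact
          exact this)
      filter_upwards [hx0] with z hz
      exact lineMatrix_smul (inv_ne_zero (pow_ne_zero _ hz)) _
    · rw [prod_pure, tendsto_map'_iff]
      exact tendsto_const_nhds
  | coe x =>
    rw [ContinuousAt, nhds_prod_eq, OnePoint.nhds_coe_eq, prod_map_right, tendsto_map'_iff,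
      ← nhds_prod_eq]
    have hc : Continuous fun z : noRealRoot m N × ℝ => tupleEval z.1.1 z.2 :=
      continuous_tupleEval.comp (f := fun z : noRealRoot m N × ℝ => (z.1.1, z.2)) (by fun_prop)
    exact ContinuousAt.comp (f := fun z : noRealRoot m N × ℝ => tupleEval z.1.1 z.2)
      (continuousAt_lineMatrix (a.2 x)) (hc.continuousAt (x := (a, x)))

/-- The based loop defined by a tuple without common real root. -/
def tupleLoop (a : noRealRoot m N) : OmegaRP m :=
  ⟨(ContinuousMap.mk _ continuous_tupleMap).curry a, rfl⟩

theorem continuous_tupleLoop : Continuous (tupleLoop (m := m) (N := N)) :=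
  Continuous.subtype_mk (ContinuousMap.curry _).continuous _

theorem tupleLoop_coe (a : noRealRoot m N) (x : ℝ) :
    (tupleLoop a).1 (x : OnePoint ℝ) = Projectivization.mk ℝ (tupleEval a.1 x) (a.2 x) := rfl

theorem loop_ext {f g : OmegaRP m} (h : ∀ x : ℝ, f.1 (x : OnePoint ℝ) = g.1 (x : OnePoint ℝ)) :
    f = g := by
  refine Subtype.ext (ContinuousMap.ext fun y => ?_)
  induction y using OnePoint.rec with
  | infty => rw [f.2, g.2]
  | coe x => exact h x

open Polynomial in
/-- The tuple of monic polynomials with lower coefficients `a`. -/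
def tuplePoly (a : Fin (m + 1) → Fin (N + 1) → ℝ) (i : Fin (m + 1)) : ℝ[X] :=
  X ^ (N + 1) + ∑ k : Fin (N + 1), C (a i k) * X ^ (k : ℕ)

theorem degree_tuplePoly_lower (a : Fin (m + 1) → Fin (N + 1) → ℝ) (i : Fin (m + 1)) :
    (∑ k : Fin (N + 1), Polynomial.C (a i k) * Polynomial.X ^ (k : ℕ)).degree <
      ((N + 1 : ℕ) : WithBot ℕ) := by
  refine (Polynomial.degree_sum_le _ _).trans_lt ?_
  refine (Finset.sup_lt_iff (WithBot.bot_lt_coe _)).2 fun k _ => ?_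
  refine (Polynomial.degree_C_mul_X_pow_le _ _).trans_lt ?_
  exact_mod_cast k.2

theorem tuplePoly_monic (a : Fin (m + 1) → Fin (N + 1) → ℝ) (i : Fin (m + 1)) :
    (tuplePoly a i).Monic :=
  Polynomial.monic_X_pow_add (degree_tuplePoly_lower a i)

theorem tuplePoly_natDegree (a : Fin (m + 1) → Fin (N + 1) → ℝ) (i : Fin (m + 1)) :
    (tuplePoly a i).natDegree = N + 1 :=
  Polynomial.natDegree_eq_of_degree_eq_some (by
    rw [tuplePoly, Polynomial.degree_add_eq_left_of_degree_lt, Polynomial.degree_X_pow]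
    rw [Polynomial.degree_X_pow]
    exact degree_tuplePoly_lower a i)

theorem tuplePoly_eval (a : Fin (m + 1) → Fin (N + 1) → ℝ) (i : Fin (m + 1)) (x : ℝ) :
    (tuplePoly a i).eval x = tupleEval a x i := by
  simp [tuplePoly, tupleEval, Polynomial.eval_finsetSum]

theorem tuplePoly_coeff {p : Fin (m + 1) → Polynomial ℝ} (hp : ∀ i, (p i).Monic)
    (hd : ∀ i, (p i).natDegree = N + 1) :
    tuplePoly (fun i (k : Fin (N + 1)) => (p i).coeff k) = p := by
  ext1 i
  conv_rhs => rw [(hp i).as_sum, hd i, Finset.sum_range]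
  rfl

/-- Tuples whose polynomials have no common complex root. -/
def noComplexRoot (m N : ℕ) : Set (Fin (m + 1) → Fin (N + 1) → ℝ) :=
  {a | ∀ z : ℂ, ∃ i, Polynomial.aeval z (tuplePoly a i) ≠ 0}

theorem noComplexRoot_subset : noComplexRoot m N ⊆ noRealRoot m N := by
  intro a ha x h
  obtain ⟨i, hi⟩ := ha x
  apply hi
  rw [show (x : ℂ) = algebraMap ℝ ℂ x from rfl, Polynomial.aeval_algebraMap_apply,
    Polynomial.coe_aeval_eq_eval, tuplePoly_eval, h]
  simp

theorem tupleLoop_mem_RRat {a : noRealRoot m N} (ha : a.1 ∈ noComplexRoot m N) :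
    tupleLoop a ∈ RRat (N + 1) m := by
  refine ⟨tuplePoly a.1, tuplePoly_monic a.1, tuplePoly_natDegree a.1, ha, fun x => ?_⟩
  simp only [tuplePoly_eval]
  exact ⟨a.2 x, rfl⟩

theorem exists_tupleLoop_of_mem_RRat {f : OmegaRP m} (hf : f ∈ RRat (N + 1) m) :
    ∃ a : noRealRoot m N, tupleLoop a = f := by
  obtain ⟨p, hp, hd, hz, hx⟩ := hf
  have hpoly := tuplePoly_coeff hp hd
  set a : Fin (m + 1) → Fin (N + 1) → ℝ := fun i k => (p i).coeff k
  have hc : a ∈ noComplexRoot m N := fun z => by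
    rw [hpoly]
    exact hz z
  refine ⟨⟨a, noComplexRoot_subset hc⟩, loop_ext fun x => ?_⟩
  obtain ⟨h1, h2⟩ := hx x
  rw [h2, tupleLoop_coe]
  congr 1
  ext i
  rw [← tuplePoly_eval, hpoly]

theorem noRealRoot_subset_closure (hm : 1 ≤ m) :
    noRealRoot m N ⊆ closure (noComplexRoot m N) := by
  intro a _
  obtain ⟨i, hi⟩ : ∃ i : Fin (m + 1), i ≠ 0 := ⟨⟨1, by omega⟩, by simp [Fin.ext_iff]⟩
  let b : ℝ → Fin (m + 1) → Fin (N + 1) → ℝ := fun ε =>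
    Function.update a i (Function.update (a i) 0 (a i 0 + ε))
  have hb0 : b 0 = a := by simp [b]
  have hbc : Continuous b :=
    continuous_const.update i (continuous_const.update 0 (continuous_const.add continuous_id))
  have hpoly0 : ∀ ε, tuplePoly (b ε) 0 = tuplePoly a 0 := fun ε => by
    simp [tuplePoly, b, Function.update_of_ne hi.symm]
  have hpolyi : ∀ ε, tuplePoly (b ε) i = tuplePoly a i + Polynomial.C ε := fun ε => by
    simp only [tuplePoly, b, Function.update_self, Fin.sum_univ_succ, Fin.val_zero,
      ne_eq, Fin.succ_ne_zero, not_false_eq_true, Function.update_of_ne, map_add, pow_zero, mul_one]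
    ring
  let S : Set ℝ := (fun z : ℂ => -(Polynomial.aeval z (tuplePoly a i)).re) ''
    (((tuplePoly a 0).map (algebraMap ℝ ℂ)).rootSet ℂ)
  have hS : S.Finite := (Polynomial.rootSet_finite _ _).image _
  have hev : ∀ᶠ ε in 𝓝[≠] (0 : ℝ), b ε ∈ noComplexRoot m N := by
    have h1 : (S \ {0})ᶜ ∈ 𝓝 (0 : ℝ) :=
      (hS.subset Set.sdiff_subset).isClosed.isOpen_compl.mem_nhds (by simp)
    filter_upwards [nhdsWithin_le_nhds h1, self_mem_nhdsWithin] with ε hε hε0 z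
    by_contra! hall
    have h0 := hall 0
    rw [hpoly0] at h0
    have hi := hall i
    rw [hpolyi, map_add, Polynomial.aeval_C] at hi
    refine hε ⟨⟨z, ?_, ?_⟩, hε0⟩
    · rw [Polynomial.mem_rootSet]
      refine ⟨((tuplePoly_monic a 0).map _).ne_zero, ?_⟩
      simpa using h0
    · have := congrArg Complex.re hi
      simp at this
      simp only
      linarith
  refine mem_closure_of_tendsto (b := 𝓝[≠] (0 : ℝ)) (f := b) ?_ hev
  have := hbc.tendsto 0
  rw [hb0] at this
  exact this.mono_left nhdsWithin_le_nhds

theorem tupleLoop_mem_ratSet (hm : 1 ≤ m) (a : noRealRoot m N) :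
    tupleLoop a ∈ ratSet (N + 1) m := by
  have h1 : a ∈ closure (Subtype.val ⁻¹' noComplexRoot m N : Set (noRealRoot m N)) := by
    rw [closure_subtype, Subtype.image_preimage_coe,
      Set.inter_eq_right.2 noComplexRoot_subset]
    exact noRealRoot_subset_closure hm a.2
  have h2 := image_closure_subset_closure_image continuous_tupleLoop ⟨a, h1, rfl⟩
  refine closure_mono ?_ h2
  rintro _ ⟨b, hb, rfl⟩
  exact tupleLoop_mem_RRat hb

end Loops

section Selection

variable {m N : ℕ}

theorem dotProduct_tupleEval_pos {a b : Fin (m + 1) → Fin (N + 1) → ℝ}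
    (h : ∀ x, tupleEval a x ⬝ᵥ tupleEval b x ≠ 0) (x : ℝ) :
    0 < tupleEval a x ⬝ᵥ tupleEval b x := by
  have hscaled : ∀ a : Fin (m + 1) → Fin (N + 1) → ℝ,
      Tendsto (fun x : ℝ => (x ^ (N + 1))⁻¹ • tupleEval a x) atTop (𝓝 fun _ => 1) := fun a =>
    (tendsto_tupleEval a).comp (tendsto_const_nhds.prodMk atTop_le_cocompact)
  have hdot : Continuous fun z : (Fin (m + 1) → ℝ) × (Fin (m + 1) → ℝ) => z.1 ⬝ᵥ z.2 :=
    Continuous.dotProduct continuous_fst continuous_snd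
  have hlim := (hdot.tendsto (fun _ => 1, fun _ => 1)).comp
    ((hscaled a).prodMk_nhds (hscaled b))
  have hpos : (0 : ℝ) < (fun _ : Fin (m + 1) => (1 : ℝ)) ⬝ᵥ fun _ => 1 := by
    simp [dotProduct]
    positivity
  obtain ⟨x₀, hx₀⟩ := (hlim.eventually (lt_mem_nhds hpos)).exists
  have hx₀ : 0 ≤ tupleEval a x₀ ⬝ᵥ tupleEval b x₀ := by
    simp only [Function.comp, smul_dotProduct, dotProduct_smul, smul_eq_mul, ← mul_assoc] at hx₀
    by_contra! hneg
    exact hx₀.not_ge (mul_nonpos_of_nonneg_of_nonpos (mul_self_nonneg _) hneg.le)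
  by_contra! hx
  have hc : Continuous fun x => tupleEval a x ⬝ᵥ tupleEval b x :=
    Continuous.dotProduct
      (continuous_tupleEval.comp (f := fun x : ℝ => (a, x)) (by fun_prop))
      (continuous_tupleEval.comp (f := fun x : ℝ => (b, x)) (by fun_prop))
  obtain ⟨y, hy⟩ := mem_range_of_exists_le_of_exists_ge hc ⟨x, hx⟩ ⟨x₀, hx₀⟩
  exact h y hy

theorem dotProduct_ne_zero_of_dist_lt_one {v w : Fin (m + 1) → ℝ} (hv : v ≠ 0) (hw : w ≠ 0)
    (h : dist (lineMatrix v) (lineMatrix w) < 1) : v ⬝ᵥ w ≠ 0 := by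
  intro h0
  have h1 := norm_lineMatrix_sub_sq hv hw
  rw [h0, ← dist_eq_norm] at h1
  norm_num at h1
  nlinarith [dist_nonneg (x := lineMatrix v) (y := lineMatrix w)]

theorem dist_lineMatrix_lt_iff {v : Fin (m + 1) → ℝ} (hv : v ≠ 0)
    (u : Metric.sphere (0 : EuclideanSpace ℝ (Fin (m + 1))) 1) {ε : ℝ} (hε : 0 < ε) :
    dist (lineMatrix v) (toMatrix (sphereToRP u)) < ε ↔
      (1 - ε ^ 2 / 2) * ‖WithLp.toLp 2 v‖ ^ 2 < inner ℝ u.1 (WithLp.toLp 2 v) ^ 2 := by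
  have hu : ∑ k, (WithLp.ofLp u.1) k ^ 2 = 1 := by
    have h1 : ‖u.1‖ ^ 2 = 1 := by rw [mem_sphere_zero_iff_norm.1 u.2]; norm_num
    rw [EuclideanSpace.norm_sq_eq] at h1
    simpa using h1
  have hin : inner ℝ u.1 (WithLp.toLp 2 v) = v ⬝ᵥ WithLp.ofLp u.1 := by
    simp [PiLp.inner_apply, dotProduct]
  have hpos := sum_sq_pos hv
  rw [← sq_lt_sq₀ dist_nonneg hε.le, dist_eq_norm, sphereToRP, toMatrix_mk,
    norm_lineMatrix_sub_sq hv (ofLp_ne_zero_of_mem_sphere u), hu, mul_one, hin,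
    EuclideanSpace.norm_sq_eq]
  simp only [Real.norm_eq_abs, sq_abs]
  rw [sub_lt_comm, lt_div_iff₀ hpos]
  constructor <;> intro h <;> linarith

/-- The family of projection matrices defined by a loop. -/
def loopMatrix (f : OmegaRP m) :
    C(OnePoint ℝ, EuclideanSpace ℝ (Fin (m + 1) × Fin (m + 1))) :=
  (ContinuousMap.mk toMatrix continuous_toMatrix).comp f.1

theorem isInducing_loopMatrix : IsInducing (loopMatrix (m := m)) :=
  (ContinuousMap.isInducing_postcomp _ isInducing_toMatrix).comp IsInducing.subtypeVal

/-- Coefficients of tuples without common real root whose loop is `ε`-close to `f`. -/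
def nearTuples (N : ℕ) (f : OmegaRP m) (ε : ℝ) : Set (Fin (m + 1) → Fin (N + 1) → ℝ) :=
  {a | ∃ h : a ∈ noRealRoot m N, dist (loopMatrix (tupleLoop ⟨a, h⟩)) (loopMatrix f) < ε}

theorem tupleEval_combo (a b : Fin (m + 1) → Fin (N + 1) → ℝ) {s t : ℝ} (hst : s + t = 1)
    (x : ℝ) : tupleEval (s • a + t • b) x = s • tupleEval a x + t • tupleEval b x := by
  ext i
  simp only [tupleEval, Pi.add_apply, Pi.smul_apply, smul_eq_mul, add_mul,
    Finset.sum_add_distrib, mul_add, Finset.mul_sum, mul_assoc]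
  linear_combination (-x ^ (N + 1)) * hst

theorem convex_nearTuples (f : OmegaRP m) {ε : ℝ} (hε : 0 < ε) (hε' : ε ≤ 1 / 2) :
    Convex ℝ (nearTuples N f ε) := by
  rintro a ⟨ha, hda⟩ b ⟨hb, hdb⟩ s t hs ht hst
  have hda' := fun x : ℝ => (ContinuousMap.dist_lt_iff hε).1 hda (x : OnePoint ℝ)
  have hdb' := fun x : ℝ => (ContinuousMap.dist_lt_iff hε).1 hdb (x : OnePoint ℝ)
  have hpos := dotProduct_tupleEval_pos (a := a) (b := b) fun x =>
    dotProduct_ne_zero_of_dist_lt_one (ha x) (hb x)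
      ((dist_triangle_right _ _ (loopMatrix f x)).trans_lt
        ((add_lt_add (hda' x) (hdb' x)).trans_le (by linarith)))
  have key : ∀ x : ℝ, ∃ h : tupleEval (s • a + t • b) x ≠ 0,
      dist (lineMatrix (tupleEval (s • a + t • b) x)) (loopMatrix f x) < ε := by
    intro x
    obtain ⟨u, hu⟩ := sphereToRP_surjective (f.1 (x : OnePoint ℝ))
    have hfu : loopMatrix f x = toMatrix (sphereToRP u) := by rw [hu]; rfl
    have h1 := (dist_lineMatrix_lt_iff (ha x) u hε).1 (by rw [← hfu]; exact hda' x)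
    have h2 := (dist_lineMatrix_lt_iff (hb x) u hε).1 (by rw [← hfu]; exact hdb' x)
    have hin : 0 < inner ℝ (WithLp.toLp 2 (tupleEval a x)) (WithLp.toLp 2 (tupleEval b x)) := by
      have := hpos x
      rw [dotProduct_comm] at this
      simpa [PiLp.inner_apply, dotProduct] using this
    have h3 := cone_combo (mem_sphere_zero_iff_norm.1 u.2) (by nlinarith) h1 h2 hin hs ht hst
    rw [← WithLp.toLp_smul, ← WithLp.toLp_smul, ← WithLp.toLp_add, ← tupleEval_combo a b hst] at h3
    have hne : tupleEval (s • a + t • b) x ≠ 0 := by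
      intro h0
      rw [h0] at h3
      simp at h3
    refine ⟨hne, ?_⟩
    rw [hfu]
    exact (dist_lineMatrix_lt_iff hne u hε).2 h3
  refine ⟨fun x => (key x).1, (ContinuousMap.dist_lt_iff hε).2 fun y => ?_⟩
  induction y using OnePoint.rec with
  | infty =>
    have : loopMatrix f ∞ = toMatrix (basept m) := congrArg toMatrix f.2
    rw [this]
    exact (dist_self _).trans_lt hε
  | coe x => exact (key x).2

/-- A positive function tending to zero at infinity, bounded by `1 / 2`. -/
def tolerance (s : ℝ) : ℝ := 1 / (2 * (1 + s ^ 2))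

theorem tolerance_pos (s : ℝ) : 0 < tolerance s := by
  unfold tolerance
  positivity

theorem tolerance_le (s : ℝ) : tolerance s ≤ 1 / 2 := by
  unfold tolerance
  gcongr
  nlinarith [sq_nonneg s]

theorem continuous_tolerance : Continuous tolerance := by
  unfold tolerance
  refine continuous_const.div (by fun_prop) fun s => ?_
  positivity

theorem tolerance_inv_le (u : ℝ) : tolerance u⁻¹ ≤ 1 / 2 * u ^ 2 ∨ u = 0 := by
  rcases eq_or_ne u 0 with h | h
  · exact Or.inr h
  · left
    unfold tolerance
    rw [div_le_iff₀ (by positivity)]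
    have : u ^ 2 * u⁻¹ ^ 2 = 1 := by field_simp
    nlinarith [sq_nonneg u]

open scoped Manifold ContDiff in
theorem exists_smooth_approximation {f : ℝ → OmegaRP m} (hf : Continuous f)
    (hfm : ∀ t, f t ∈ ratSet (N + 1) m) {S : Set ℝ} (hS : IsClosed S) (a₀ : noRealRoot m N)
    (ha₀ : ∀ t ∈ S, f t = tupleLoop a₀) :
    ∃ H : ℝ × ℝ → noRealRoot m N, ContDiff ℝ 1 (fun z => (H z).1) ∧
      (∀ z, z.1 ∈ S → H z = a₀) ∧
      ∀ z, dist (loopMatrix (tupleLoop (H z))) (loopMatrix (f z.1)) < tolerance z.2 := by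
  let T : ℝ × ℝ → Set (Fin (m + 1) → Fin (N + 1) → ℝ) := fun z =>
    nearTuples N (f z.1) (tolerance z.2) ∩ {a | z.1 ∈ S → a = a₀}
  have hT : ∀ z, Convex ℝ (T z) := fun z => by
    refine (convex_nearTuples _ (tolerance_pos _) (tolerance_le _)).inter ?_
    intro a ha b hb s t _ _ hst hz
    rw [ha hz, hb hz, ← add_smul, hst, one_smul]
  have hev : ∀ (a : noRealRoot m N) (z : ℝ × ℝ),
      dist (loopMatrix (tupleLoop a)) (loopMatrix (f z.1)) < tolerance z.2 →
      ∀ᶠ y in 𝓝 z, a.1 ∈ nearTuples N (f y.1) (tolerance y.2) := fun a z hz => by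
    have hc : Continuous fun y : ℝ × ℝ => dist (loopMatrix (tupleLoop a)) (loopMatrix (f y.1)) :=
      continuous_const.dist (isInducing_loopMatrix.continuous.comp (hf.comp continuous_fst))
    filter_upwards [hc.continuousAt.eventually_lt
      (continuous_tolerance.comp continuous_snd).continuousAt hz] with y hy
    exact ⟨a.2, hy⟩
  have hloc : ∀ z, ∃ c, ∀ᶠ y in 𝓝 z, c ∈ T y := fun z => by
    by_cases hz : z.1 ∈ S
    · refine ⟨a₀, ?_⟩
      filter_upwards [hev a₀ z (by rw [ha₀ _ hz, dist_self]; exact tolerance_pos _)] with y hy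
      exact ⟨hy, fun _ => rfl⟩
    · have h1 : loopMatrix (f z.1) ∈ closure (loopMatrix '' RRat (N + 1) m) :=
        image_closure_subset_closure_image isInducing_loopMatrix.continuous ⟨_, hfm z.1, rfl⟩
      obtain ⟨_, ⟨g, hg, rfl⟩, hd⟩ := Metric.mem_closure_iff.1 h1 _ (tolerance_pos z.2)
      obtain ⟨a, rfl⟩ := exists_tupleLoop_of_mem_RRat hg
      rw [dist_comm] at hd
      refine ⟨a, ?_⟩
      filter_upwards [hev a z hd, (hS.isOpen_compl.preimage continuous_fst).mem_nhds hz]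
        with y hy hyS
      exact ⟨hy, fun h => absurd h hyS⟩
  obtain ⟨g, hg⟩ := exists_contMDiffMap_forall_mem_convex_of_local_const
    (n := (1 : ℕ∞)) 𝓘(ℝ, ℝ × ℝ) hT hloc
  refine ⟨fun z => ⟨g z, (hg z).1.1⟩, g.contMDiff.contDiff, fun z hz => Subtype.ext ((hg z).2 hz),
    fun z => ?_⟩
  exact (hg z).1.2

end Selection

section Homotopy

variable {m N : ℕ}

/-- The loop of a tuple, as a point of `ratSet`. -/
def tupleRat (hm : 1 ≤ m) (a : noRealRoot m N) : ratSet (N + 1) m :=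
  ⟨tupleLoop a, tupleLoop_mem_ratSet hm a⟩

theorem continuous_tupleRat (hm : 1 ≤ m) : Continuous (tupleRat (N := N) hm) :=
  continuous_tupleLoop.subtype_mk _

/-- A family in `ratSet` can be deformed, relative to a closed set where it is a constant tuple,
to a `C¹` family of tuples. -/
theorem exists_deformation (hm : 1 ≤ m) {f : ℝ → ratSet (N + 1) m} (hf : Continuous f)
    {S : Set ℝ} (hS : IsClosed S) (a₀ : noRealRoot m N) (ha₀ : ∀ t ∈ S, f t = tupleRat hm a₀) :
    ∃ p : ℝ → noRealRoot m N, ContDiff ℝ 1 (fun t => (p t).1) ∧ (∀ t ∈ S, p t = a₀) ∧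
      ∃ G : ℝ × ℝ → ratSet (N + 1) m, Continuous G ∧ (∀ t, G (0, t) = f t) ∧
        (∀ t, G (1, t) = tupleRat hm (p t)) ∧ ∀ u, ∀ t ∈ S, G (u, t) = tupleRat hm a₀ := by
  obtain ⟨H, hH, hHS, hHd⟩ := exists_smooth_approximation (N := N)
    (continuous_subtype_val.comp hf) (fun t => (f t).2) hS a₀
    fun t ht => congrArg Subtype.val (ha₀ t ht)
  have hHc : Continuous H := Topology.IsInducing.subtypeVal.continuous_iff.2 hH.continuous
  let G : ℝ × ℝ → ratSet (N + 1) m := fun z =>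
    if z.1 = 0 then f z.2 else tupleRat hm (H (z.2, z.1⁻¹))
  refine ⟨fun t => H (t, 1), hH.comp (by fun_prop : ContDiff ℝ 1 fun t : ℝ => (t, (1 : ℝ))),
    fun t ht => hHS _ ht, G, ?_, fun t => by simp [G], fun t => by simp [G], ?_⟩
  · refine continuous_iff_continuousAt.2 fun z => ?_
    obtain ⟨u, t⟩ := z
    by_cases hu : u = 0
    · subst hu
      rw [(isInducing_loopMatrix.comp Topology.IsInducing.subtypeVal).continuousAt_iff,
        ContinuousAt, tendsto_iff_dist_tendsto_zero]
      have hb : ∀ z : ℝ × ℝ, dist (loopMatrix (G z).1) (loopMatrix (G (0, t)).1) ≤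
          1 / 2 * z.1 ^ 2 + dist (loopMatrix (f z.2).1) (loopMatrix (f t).1) := by
        intro z
        have h0 : G (0, t) = f t := by simp [G]
        rw [h0]
        by_cases hz : z.1 = 0
        · simp [G, hz]
        · refine (dist_triangle _ (loopMatrix (f z.2).1) _).trans ?_
          gcongr
          have h1 := (hHd (z.2, z.1⁻¹)).le.trans ((tolerance_inv_le z.1).resolve_right hz)
          simpa [G, hz, tupleRat] using h1
      refine squeeze_zero (fun _ => dist_nonneg) hb ?_
      have hc : Continuous fun z : ℝ × ℝ =>
          1 / 2 * z.1 ^ 2 + dist (loopMatrix (f z.2).1) (loopMatrix (f t).1) := by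
        refine Continuous.add (by fun_prop) (Continuous.dist ?_ continuous_const)
        exact isInducing_loopMatrix.continuous.comp
          (continuous_subtype_val.comp (hf.comp continuous_snd))
      have := hc.tendsto (0, t)
      simpa using this
    · have hev : ∀ᶠ z : ℝ × ℝ in 𝓝 (u, t), tupleRat hm (H (z.2, z.1⁻¹)) = G z := by
        filter_upwards [(isOpen_ne.preimage continuous_fst).mem_nhds
          (show (u, t) ∈ Prod.fst ⁻¹' {x : ℝ | x ≠ 0} from hu)] with z hz
        exact (if_neg hz).symm
      refine ContinuousAt.congr ?_ hev
      refine ((continuous_tupleRat hm).comp hHc).continuousAt.comp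
        (f := fun z : ℝ × ℝ => (z.2, z.1⁻¹)) ?_
      exact continuousAt_snd.prodMk (continuousAt_fst.inv₀ hu)
  · intro u t ht
    by_cases hu : u = 0
    · simp [G, hu, ha₀ t ht]
    · simp [G, hu, hHS (t, u⁻¹) ht]

end Homotopy

section GeneralPosition

variable {m N : ℕ}

/-- The tuples vanishing at `x`, parametrized by their coefficients of positive degree. -/
def vanishingTuple (z : ℝ × (Fin (m + 1) → Fin N → ℝ)) : Fin (m + 1) → Fin (N + 1) → ℝ :=
  fun i => Fin.cons (-(z.1 ^ (N + 1) + ∑ k, z.2 i k * z.1 ^ ((k : ℕ) + 1))) (z.2 i)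

theorem contDiff_vanishingTuple : ContDiff ℝ 1 (vanishingTuple (m := m) (N := N)) := by
  have hproj : ∀ (i : Fin (m + 1)) (k : Fin N),
      ContDiff ℝ 1 fun z : ℝ × (Fin (m + 1) → Fin N → ℝ) => z.2 i k := fun i k =>
    contDiff_pi.1 (contDiff_pi.1 contDiff_snd i) k
  refine contDiff_pi.2 fun i => contDiff_pi.2 fun k => ?_
  refine Fin.cases ?_ (fun k => ?_) k
  · simp only [vanishingTuple, Fin.cons_zero]
    refine ContDiff.neg (ContDiff.add (contDiff_fst.pow _) (ContDiff.sum fun k _ => ?_))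
    exact (hproj i k).mul (contDiff_fst.pow _)
  · simpa only [vanishingTuple, Fin.cons_succ] using hproj i k

theorem exists_vanishingTuple_eq {a : Fin (m + 1) → Fin (N + 1) → ℝ} (ha : a ∉ noRealRoot m N) :
    ∃ z, vanishingTuple z = a := by
  simp only [noRealRoot, Set.mem_ofPred_eq, not_forall, not_not] at ha
  obtain ⟨x, hx⟩ := ha
  refine ⟨(x, fun i k => a i k.succ), ?_⟩
  ext i k
  refine Fin.cases ?_ (fun k => ?_) k
  · have := congrFun hx i
    simp only [tupleEval, Fin.sum_univ_succ, Fin.val_zero, pow_zero, mul_one, Fin.val_succ,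
      Pi.zero_apply] at this
    simp only [vanishingTuple, Fin.cons_zero]
    linarith
  · simp [vanishingTuple]

/-- The apexes from which some segment to the family `p` meets the tuples with a real root. -/
def badApex {E : Type*} (p : E → noRealRoot m N) : Set (Fin (m + 1) → Fin (N + 1) → ℝ) :=
  {c | ∃ t, ∃ u ∈ Set.Icc (0 : ℝ) 1, (1 - u) • (p t).1 + u • c ∉ noRealRoot m N}

theorem dimH_badApex_le {E : Type*} [NormedAddCommGroup E] [NormedSpace ℝ E]
    [FiniteDimensional ℝ E] {p : E → noRealRoot m N} (hp : ContDiff ℝ 1 fun t => (p t).1) :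
    dimH (badApex p) ≤ (Module.finrank ℝ E + 2 + (m + 1) * N : ℕ) := by
  let F : ((ℝ × (Fin (m + 1) → Fin N → ℝ)) × ℝ) × E → Fin (m + 1) → Fin (N + 1) → ℝ := fun z =>
    z.1.2 • vanishingTuple z.1.1 - (z.1.2 - 1) • (p z.2).1
  have hF : ContDiff ℝ 1 F := by
    have h1 : ContDiff ℝ 1 fun z : ((ℝ × (Fin (m + 1) → Fin N → ℝ)) × ℝ) × E => z.1.2 :=
      contDiff_snd.comp contDiff_fst
    exact (h1.smul (contDiff_vanishingTuple.comp (contDiff_fst.comp contDiff_fst))).sub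
      ((h1.sub contDiff_const).smul (hp.comp contDiff_snd))
  have hsub : badApex p ⊆ Set.range F := by
    rintro c ⟨t, u, hu, h⟩
    obtain ⟨z, hz⟩ := exists_vanishingTuple_eq h
    have hu0 : u ≠ 0 := by
      rintro rfl
      simp only [sub_zero, one_smul, zero_smul, add_zero] at h
      exact h (p t).2
    refine ⟨((z, u⁻¹), t), ?_⟩
    simp only [F, hz]
    rw [smul_add, smul_smul, smul_smul, inv_mul_cancel₀ hu0, one_smul, mul_sub,
      inv_mul_cancel₀ hu0, mul_one]
    abel
  refine (dimH_mono hsub).trans (hF.dimH_range_le.trans (le_of_eq ?_))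
  simp only [Module.finrank_prod, Module.finrank_self, Module.finrank_pi_fintype, Finset.sum_const,
    Finset.card_univ, Fintype.card_fin, smul_eq_mul, mul_one]
  congr 1
  ring

theorem finrank_tuples :
    Module.finrank ℝ (Fin (m + 1) → Fin (N + 1) → ℝ) = (m + 1) * N + (m + 1) := by
  simp only [Module.finrank_pi_fintype, Module.finrank_self, Finset.sum_const,
    Finset.card_univ, Fintype.card_fin, smul_eq_mul, mul_one]
  ring

theorem joined_tuples (hm : 2 ≤ m) (a b : noRealRoot m N) : Joined a b := by
  let p : noRealRoot m N → (Fin 0 → ℝ) → noRealRoot m N := fun a _ => a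
  have hdim : ∀ a, dimH (badApex (p a)) <
      Module.finrank ℝ (Fin (m + 1) → Fin (N + 1) → ℝ) := fun a => by
    refine (dimH_badApex_le (p := p a) (contDiff_const (c := a.1))).trans_lt ?_
    rw [finrank_tuples, Module.finrank_fin_fun]
    exact_mod_cast (by omega)
  obtain ⟨c, hc⟩ := (dense_compl_of_dimH_lt_finrank
    (s := badApex (p a) ∪ badApex (p b)) (by
      rw [dimH_union]
      exact max_lt (hdim a) (hdim b))).nonempty
  simp only [badApex, Set.mem_compl_iff, Set.mem_union, Set.mem_ofPred_eq, not_or, not_exists,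
    not_and, not_not, p] at hc
  have hcg : c ∈ noRealRoot m N := by simpa using hc.1 0 1 (by simp)
  have hj : ∀ a : noRealRoot m N, (∀ u ∈ Set.Icc (0 : ℝ) 1,
      (1 - u) • a.1 + u • c ∈ noRealRoot m N) → Joined a ⟨c, hcg⟩ := fun a h =>
    ⟨⟨⟨fun u => ⟨(1 - (u : ℝ)) • a.1 + (u : ℝ) • c, h u u.2⟩,
      Continuous.subtype_mk (by fun_prop) _⟩, by simp, by simp⟩⟩
  exact (hj a (hc.1 0)).trans (hj b (hc.2 0)).symm

theorem exists_starConvex (hm : 3 ≤ m) {p : ℝ → noRealRoot m N}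
    (hp : ContDiff ℝ 1 fun t => (p t).1) :
    ∃ c, ∃ C ⊆ noRealRoot m N, StarConvex ℝ c C ∧ ∀ t, (p t).1 ∈ C := by
  obtain ⟨c, hc⟩ := (dense_compl_of_dimH_lt_finrank (s := badApex p) (by
    refine (dimH_badApex_le hp).trans_lt ?_
    rw [finrank_tuples, Module.finrank_self]
    exact_mod_cast (by omega))).nonempty
  simp only [badApex, Set.mem_compl_iff, Set.mem_ofPred_eq, not_exists, not_and, not_not] at hc
  refine ⟨c, {b | ∃ t, ∃ u ∈ Set.Icc (0 : ℝ) 1, (1 - u) • (p t).1 + u • c = b}, ?_, ?_, ?_⟩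
  · rintro _ ⟨t, u, hu, rfl⟩
    exact hc t u hu
  · rintro _ ⟨t, u, hu, rfl⟩ r s hr hs hrs
    refine ⟨t, r + s * u, ⟨by nlinarith [hu.1], by nlinarith [hu.2]⟩, ?_⟩
    obtain rfl : r = 1 - s := by linarith
    module
  · exact fun t => ⟨t, 0, by simp, by simp⟩

end GeneralPosition

section Connectivity

variable {m N : ℕ}

theorem nonempty_noRealRoot (hm : 1 ≤ m) : Nonempty (noRealRoot m N) := by
  refine ⟨⟨fun i k => if k = 0 then (i : ℕ) else 0, fun x hx => ?_⟩⟩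
  have hval : ∀ i : Fin (m + 1), x ^ (N + 1) + (i : ℕ) = 0 := fun i => by
    have := congrFun hx i
    simpa [tupleEval, Fin.sum_univ_succ] using this
  have h0 := hval 0
  have h1 := hval ⟨1, by omega⟩
  simp at h0 h1
  simp [h0] at h1

theorem joined_tupleRat (hm : 1 ≤ m) (f : ratSet (N + 1) m) :
    ∃ a, Joined f (tupleRat (N := N) hm a) := by
  obtain ⟨a₀⟩ := nonempty_noRealRoot (m := m) (N := N) hm
  obtain ⟨p, -, -, G, hG, hG0, hG1, -⟩ := exists_deformation hm (f := fun _ => f)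
    continuous_const isClosed_empty a₀ (by simp)
  exact ⟨p 0, ⟨⟨⟨fun u => G (u, 0), by fun_prop⟩, by simp [hG0], by simp [hG1]⟩⟩⟩

theorem pathConnectedSpace_ratSet (hm : 2 ≤ m) : PathConnectedSpace (ratSet (N + 1) m) where
  nonempty := (nonempty_noRealRoot (N := N) (by omega)).map (tupleRat (by omega))
  joined f g := by
    obtain ⟨a, ha⟩ := joined_tupleRat (by omega) f
    obtain ⟨b, hb⟩ := joined_tupleRat (by omega) g
    exact ha.trans (((joined_tuples hm a b).map (continuous_tupleRat (by omega))).trans hb.symm)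

theorem loop_homotopic_refl (hm : 3 ≤ m) (a₀ : noRealRoot m N)
    (γ : Path (tupleRat (m := m) (by omega) a₀) (tupleRat (by omega) a₀)) :
    γ.Homotopic (Path.refl _) := by
  have hm' : 1 ≤ m := by omega
  obtain ⟨p, hp, hpS, G, hG, hG0, hG1, hGS⟩ := exists_deformation hm' (f := γ.extend)
    γ.continuous_extend (S := {0, 1}) (Set.toFinite _).isClosed a₀ (by simp)
  obtain ⟨c, C, hC, hstar, hpC⟩ := exists_starConvex hm hp
  have := hstar.contractibleSpace ⟨_, hpC 0⟩
  let δ : Path (⟨p 0, hpC 0⟩ : C) ⟨p 0, hpC 0⟩ :=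
    ⟨⟨fun t => ⟨p t, hpC t⟩, Continuous.subtype_mk
      (hp.continuous.comp continuous_subtype_val) _⟩, by simp, by
        have : p 1 = p 0 := by rw [hpS 1 (by simp), hpS 0 (by simp)]
        simp [this]⟩
  let ι : C → ratSet (N + 1) m := fun b => tupleRat hm' ⟨b.1, hC b.2⟩
  have hι : Continuous ι :=
    (continuous_tupleRat hm').comp (Continuous.subtype_mk continuous_subtype_val _)
  have hbase : tupleRat hm' a₀ = ι ⟨p 0, hpC 0⟩ := by
    simp only [ι]
    rw [← hpS 0 (by simp)]
  have hδ : (δ.map hι).Homotopic ((Path.refl _).map hι) :=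
    (SimplyConnectedSpace.paths_homotopic δ (Path.refl _)).map ⟨ι, hι⟩
  have h1 : γ.Homotopic ((δ.map hι).cast hbase hbase) := by
    refine ⟨⟨⟨⟨fun z => G (z.1, z.2), by fun_prop⟩, fun t => ?_, fun t => ?_⟩, ?_⟩⟩
    · simp [hG0]
    · simp [hG1, δ, ι]
    · rintro u t (rfl | rfl)
      · simp [hGS]
      · simp [hGS]
  refine h1.trans ?_
  obtain ⟨K⟩ := hδ
  exact ⟨⟨⟨K.toContinuousMap, fun t => by simp, fun t => by simp [hbase]⟩, by
    rintro u t (rfl | rfl) <;> simp [hbase]⟩⟩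

theorem simplyConnectedSpace_ratSet (hm : 3 ≤ m) :
    SimplyConnectedSpace (ratSet (N + 1) m) := by
  have hpc := pathConnectedSpace_ratSet (N := N) (show 2 ≤ m by omega)
  obtain ⟨a₀⟩ := nonempty_noRealRoot (m := m) (N := N) (by omega)
  refine simply_connected_iff_loops_nullhomotopic.2 ⟨hpc, fun x γ => ?_⟩
  have hsub : Subsingleton (FundamentalGroup (ratSet (N + 1) m) (tupleRat (by omega) a₀)) := by
    have : ∀ q : Path.Homotopic.Quotient (tupleRat (m := m) (by omega) a₀)
        (tupleRat (by omega) a₀), q = ⟦Path.refl _⟧ := fun q =>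
      Quotient.inductionOn q fun γ => Quotient.sound (loop_homotopic_refl hm a₀ γ)
    exact ⟨fun q r => (this q).trans (this r).symm⟩
  have hsub' : Subsingleton (FundamentalGroup (ratSet (N + 1) m) x) :=
    (FundamentalGroup.fundamentalGroupMulEquivOfPathConnected _ _).symm.injective.subsingleton
      (β := FundamentalGroup (ratSet (N + 1) m) (tupleRat _ a₀))
  exact Quotient.exact (hsub'.elim (⟦γ⟧ : Path.Homotopic.Quotient x x) ⟦Path.refl x⟧)

end Connectivity

end RatLoop

/-- For every `n ≥ 1`: if `m ≥ 2` then `rat(n,m)` is path-connected, and if `m ≥ 3`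
then `rat(n,m)` is simply connected. -/
theorem ratSet_connectivity (n m : ℕ) (hn : 1 ≤ n) :
    (2 ≤ m → PathConnectedSpace ↥(ratSet n m)) ∧
    (3 ≤ m → SimplyConnectedSpace ↥(ratSet n m)) := by
  obtain ⟨N, rfl⟩ : ∃ N, n = N + 1 := ⟨n - 1, by omega⟩
  exact ⟨fun hm => RatLoop.pathConnectedSpace_ratSet hm,
    fun hm => RatLoop.simplyConnectedSpace_ratSet hm⟩

end
end

section
/- For every m ≥ 1, the union over all n ≥ 0 of the sets RRat(n,m) is dense in the based loop space Ω ℝP^m. -/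
open OnePoint Projectivization

noncomputable section

open Topology Filter Polynomial

/-- The projection from nonzero vectors to projective space. -/
def toRP (m : ℕ) (v : {v : Fin (m + 1) → ℝ // v ≠ 0}) : RP m :=
  Projectivization.mk ℝ v.1 v.2

lemma isQuotientMap_toRP (m : ℕ) : IsQuotientMap (toRP m) :=
  isQuotientMap_quotient_mk'

lemma toRP_eq_of_smul {m : ℕ} {v w : {v : Fin (m + 1) → ℝ // v ≠ 0}} (c : ℝ)
    (h : v.1 = c • w.1) : toRP m v = toRP m w :=
  (Projectivization.mk_eq_mk_iff' ℝ v.1 w.1 v.2 w.2).2 ⟨c, h.symm⟩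

/-- The unit sphere of `ℝ^{m+1}` for the sup norm. -/
abbrev UnitSphere (m : ℕ) := Metric.sphere (0 : Fin (m + 1) → ℝ) 1

lemma unitSphere_ne_zero {m : ℕ} (v : UnitSphere m) : v.1 ≠ 0 :=
  ne_zero_of_mem_unit_sphere v

/-- The projection from the unit sphere to projective space. -/
def sphereToRP (m : ℕ) (v : UnitSphere m) : RP m :=
  toRP m ⟨v.1, (unitSphere_ne_zero v)⟩

lemma continuous_sphereToRP (m : ℕ) : Continuous (sphereToRP m) :=
  (isQuotientMap_toRP m).continuous.comp (continuous_subtype_val.subtype_mk _)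

lemma isQuotientMap_sphereToRP (m : ℕ) : IsQuotientMap (sphereToRP m) := by
  let r : {v : Fin (m + 1) → ℝ // v ≠ 0} → UnitSphere m := fun v =>
    ⟨‖v.1‖⁻¹ • v.1, by simp [norm_smul, v.2]⟩
  have hr : Continuous r := by
    refine Continuous.subtype_mk ((continuous_subtype_val.norm.inv₀ ?_).smul continuous_subtype_val) _
    intro v
    simpa using v.2
  have h : sphereToRP m ∘ r = toRP m := by
    funext v
    exact toRP_eq_of_smul _ rfl
  refine IsQuotientMap.of_comp hr (continuous_sphereToRP m) ?_
  rw [h]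
  exact isQuotientMap_toRP m

lemma isQuotientCoveringMap_sphereToRP (m : ℕ) :
    IsQuotientCoveringMap (sphereToRP m) (Metric.sphere (0 : ℝ) 1) where
  __ := isQuotientMap_sphereToRP m
  continuous_const_smul g := continuous_const_smul g
  apply_eq_iff_mem_orbit {v w} := by
    refine (Projectivization.mk_eq_mk_iff' ℝ v.1 w.1 (unitSphere_ne_zero v)
      (unitSphere_ne_zero w)).trans ⟨?_, ?_⟩
    · rintro ⟨a, ha⟩
      have hn : ‖a‖ = 1 := by simpa [norm_smul] using congrArg norm ha
      exact ⟨⟨a, by simpa using hn⟩, Subtype.ext ha⟩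
    · rintro ⟨a, ha⟩
      exact ⟨a.1, congrArg Subtype.val ha⟩
  disjoint e := by
    refine ⟨Metric.ball e 1, Metric.ball_mem_nhds _ one_pos, ?_⟩
    rintro g ⟨_, ⟨x, hx, rfl⟩, hgx⟩
    have hg : |(g : ℝ)| = 1 := mem_sphere_zero_iff_norm.1 g.2
    rcases (abs_eq zero_le_one).1 hg with h | h
    · exact Subtype.ext h
    · exfalso
      have h2 : dist x (g • x) < 2 := by
        have := dist_triangle_right x (g • x) e
        rw [Metric.mem_ball] at hx hgx
        linarith
      have h3 : dist x (g • x) = 2 := by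
        rw [Subtype.dist_eq, dist_eq_norm]
        have : (x : Fin (m + 1) → ℝ) - ((g • x : UnitSphere m) : Fin (m + 1) → ℝ)
            = (2 : ℝ) • (x : Fin (m + 1) → ℝ) := by
          change (x : Fin (m + 1) → ℝ) - (g : ℝ) • (x : Fin (m + 1) → ℝ) = _
          rw [h]; module
        rw [this, norm_smul]
        simp
      linarith

/-- The coordinate `re / im` on the circle, as a double cover of the projective line. -/
def circleCot (z : Circle) : OnePoint ℝ :=
  if (z : ℂ).im = 0 then ∞ else (((z : ℂ).re / (z : ℂ).im : ℝ) : OnePoint ℝ)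

lemma circleCot_of_im_eq_zero {z : Circle} (h : (z : ℂ).im = 0) : circleCot z = ∞ := if_pos h

lemma circleCot_of_im_ne_zero {z : Circle} (h : (z : ℂ).im ≠ 0) :
    circleCot z = (((z : ℂ).re / (z : ℂ).im : ℝ) : OnePoint ℝ) := if_neg h

lemma circleCot_neg (z : Circle) : circleCot (-z) = circleCot z := by
  simp [circleCot]

lemma Circle.re_sq_add_im_sq (z : Circle) : (z : ℂ).re ^ 2 + (z : ℂ).im ^ 2 = 1 := by
  have := Circle.normSq_coe z
  rw [Complex.normSq_apply] at this
  linarith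

lemma Circle.eq_one_or_eq_neg_one_of_im_eq_zero {z : Circle} (h : (z : ℂ).im = 0) :
    z = 1 ∨ z = -1 := by
  have hre := Circle.re_sq_add_im_sq z
  rw [h, zero_pow two_ne_zero, add_zero] at hre
  refine (sq_eq_sq_iff_eq_or_eq_neg.1 (hre.trans (one_pow 2).symm)).imp ?_ ?_
  all_goals
    intro h1
    refine Circle.ext (Complex.ext ?_ ?_) <;> simp [h, h1]

lemma continuous_circle_re : Continuous fun z : Circle => (z : ℂ).re :=
  Complex.continuous_re.comp continuous_subtype_val

lemma continuous_circle_im : Continuous fun z : Circle => (z : ℂ).im :=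
  Complex.continuous_im.comp continuous_subtype_val

lemma continuous_circleCot : Continuous circleCot := by
  rw [continuous_iff_continuousAt]
  intro z
  by_cases hz : (z : ℂ).im = 0
  · rw [ContinuousAt, circleCot_of_im_eq_zero hz, OnePoint.hasBasis_nhds_infty.tendsto_right_iff]
    rintro s ⟨-, hs⟩
    obtain ⟨M, hM⟩ := hs.isBounded.exists_norm_le
    have hre : (z : ℂ).re ≠ 0 := by
      intro h
      simpa [hz, h] using Circle.re_sq_add_im_sq z
    have hev : ∀ᶠ w : Circle in 𝓝 z, M * |(w : ℂ).im| < |(w : ℂ).re| := by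
      refine ContinuousAt.eventually_lt ?_ ?_ (by simpa [hz] using hre)
      · exact (continuous_const.mul continuous_circle_im.abs).continuousAt
      · exact continuous_circle_re.abs.continuousAt
    filter_upwards [hev] with w hw
    by_cases hw0 : (w : ℂ).im = 0
    · rw [circleCot_of_im_eq_zero hw0]
      exact Or.inr rfl
    · rw [circleCot_of_im_ne_zero hw0]
      refine Or.inl ⟨_, fun hmem => ?_, rfl⟩
      have := hM _ hmem
      rw [Real.norm_eq_abs, abs_div, div_le_iff₀ (abs_pos.2 hw0)] at this
      linarith
  · have h1 : ContinuousAt (fun w : Circle => (((w : ℂ).re / (w : ℂ).im : ℝ) : OnePoint ℝ)) z :=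
      OnePoint.continuous_coe.continuousAt.comp
        (continuous_circle_re.continuousAt.div continuous_circle_im.continuousAt hz)
    refine h1.congr ?_
    filter_upwards [continuous_circle_im.continuousAt.eventually_ne hz] with w hw
    exact (circleCot_of_im_ne_zero hw).symm

lemma exists_circle_im_ne_zero (x : ℝ) :
    ∃ z : Circle, (z : ℂ).im ≠ 0 ∧ (z : ℂ).re / (z : ℂ).im = x := by
  have h0 : (⟨x, 1⟩ : ℂ) ≠ 0 := fun h => one_ne_zero (congrArg Complex.im h)
  have hn : ‖(⟨x, 1⟩ : ℂ)‖ ≠ 0 := norm_ne_zero_iff.2 h0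
  refine ⟨⟨((‖(⟨x, 1⟩ : ℂ)‖⁻¹ : ℝ) : ℂ) * ⟨x, 1⟩, ?_⟩, ?_, ?_⟩
  · refine mem_sphere_zero_iff_norm.2 ?_
    rw [norm_mul, Complex.norm_real, norm_inv, norm_norm,
      inv_mul_cancel₀ hn]
  · rw [Complex.im_ofReal_mul]
    simpa using h0
  · rw [Complex.im_ofReal_mul, Complex.re_ofReal_mul]
    field_simp

lemma surjective_circleCot : Function.Surjective circleCot := by
  intro y
  induction y using OnePoint.rec with
  | infty => exact ⟨1, circleCot_of_im_eq_zero (by simp)⟩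
  | coe x =>
    obtain ⟨z, hz, hx⟩ := exists_circle_im_ne_zero x
    exact ⟨z, by rw [circleCot_of_im_ne_zero hz, hx]⟩

lemma isQuotientMap_circleCot : IsQuotientMap circleCot :=
  continuous_circleCot.isClosedMap.isQuotientMap continuous_circleCot surjective_circleCot

/-- Precomposition with a continuous surjection from a compact space to a Hausdorff space
is inducing for the compact-open topology. -/
lemma isInducing_precomp_of_surjective {X Y Z : Type*} [TopologicalSpace X] [TopologicalSpace Y]
    [TopologicalSpace Z] [CompactSpace X] [T2Space Y] (f : C(X, Y))
    (hf : Function.Surjective f) : IsInducing fun g : C(Y, Z) => g.comp f := by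
  refine ⟨le_antisymm (ContinuousMap.continuous_precomp f).le_induced ?_⟩
  refine le_generateFrom ?_
  rintro _ ⟨K, hK, U, hU, rfl⟩
  refine isOpen_induced_iff.2 ⟨{g | Set.MapsTo g (f ⁻¹' K) U}, ?_, ?_⟩
  · exact ContinuousMap.isOpen_setOfPred_mapsTo ((hK.isClosed.preimage f.continuous).isCompact) hU
  · ext g
    refine ⟨fun h y hy => ?_, fun h x hx => h hx⟩
    obtain ⟨x, rfl⟩ := hf y
    exact h hy

/-- The real part as a continuous function on the circle. -/
def circleRe : C(Circle, ℝ) := ⟨fun z => (z : ℂ).re, continuous_circle_re⟩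

/-- The imaginary part as a continuous function on the circle. -/
def circleIm : C(Circle, ℝ) := ⟨fun z => (z : ℂ).im, continuous_circle_im⟩

lemma circleRe_apply (z : Circle) : circleRe z = (z : ℂ).re := rfl

lemma circleIm_apply (z : Circle) : circleIm z = (z : ℂ).im := rfl

lemma circleRe_sq_add_circleIm_sq : circleRe ^ 2 + circleIm ^ 2 = 1 := by
  ext z
  exact Circle.re_sq_add_im_sq z

/-- The restrictions to the circle of homogeneous polynomials of degree `n` in two variables. -/
def homogeneousOnCircle (n : ℕ) : Submodule ℝ C(Circle, ℝ) :=
  Submodule.span ℝ {h | ∃ i j : ℕ, i + j = n ∧ h = circleRe ^ i * circleIm ^ j}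

lemma monomial_mem_homogeneousOnCircle (i j : ℕ) :
    circleRe ^ i * circleIm ^ j ∈ homogeneousOnCircle (i + j) :=
  Submodule.subset_span ⟨i, j, rfl, rfl⟩

lemma homogeneousOnCircle_le_add_two (n : ℕ) :
    homogeneousOnCircle n ≤ homogeneousOnCircle (n + 2) := by
  refine Submodule.span_le.2 ?_
  rintro _ ⟨i, j, rfl, rfl⟩
  have h : circleRe ^ i * circleIm ^ j
      = circleRe ^ (i + 2) * circleIm ^ j + circleRe ^ i * circleIm ^ (j + 2) := by
    linear_combination (-(circleRe ^ i * circleIm ^ j)) * circleRe_sq_add_circleIm_sq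
  rw [SetLike.mem_coe, h]
  refine add_mem ?_ ?_
  · have := monomial_mem_homogeneousOnCircle (i + 2) j
    rwa [show i + 2 + j = i + j + 2 by ring] at this
  · exact monomial_mem_homogeneousOnCircle i (j + 2)

lemma homogeneousOnCircle_le_add_two_mul (n k : ℕ) :
    homogeneousOnCircle n ≤ homogeneousOnCircle (n + 2 * k) := by
  induction k with
  | zero => exact le_rfl
  | succ k ih => exact ih.trans (homogeneousOnCircle_le_add_two _)

/-- An element of `homogeneousOnCircle n` is the homogenization of a polynomial in `re / im`. -/
lemma exists_polynomial_of_mem_homogeneousOnCircle {n : ℕ} {h : C(Circle, ℝ)}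
    (hh : h ∈ homogeneousOnCircle n) :
    ∃ p : ℝ[X], p.natDegree ≤ n ∧ p.coeff n = h 1 ∧
      ∀ z : Circle, (z : ℂ).im ≠ 0 →
        h z = (z : ℂ).im ^ n * p.eval ((z : ℂ).re / (z : ℂ).im) := by
  induction hh using Submodule.span_induction with
  | mem h hh =>
    obtain ⟨i, j, rfl, rfl⟩ := hh
    refine ⟨X ^ i, by simp, ?_, fun z hz => ?_⟩
    · rcases Nat.eq_zero_or_pos j with rfl | hj
      · simp [circleRe_apply]
      · have : ¬ (j = 0) := hj.ne'
        simp [coeff_X_pow, circleIm_apply, this]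
    · simp only [ContinuousMap.mul_apply, ContinuousMap.pow_apply, circleRe_apply, circleIm_apply,
        eval_pow, eval_X]
      rw [div_pow, pow_add]
      field_simp
  | zero => exact ⟨0, by simp, by simp, fun z _ => by simp⟩
  | add f g _ _ hf hg =>
    obtain ⟨p, hp, hp1, hpz⟩ := hf
    obtain ⟨q, hq, hq1, hqz⟩ := hg
    refine ⟨p + q, natDegree_add_le_of_degree_le hp hq, by simp [hp1, hq1], fun z hz => ?_⟩
    rw [ContinuousMap.add_apply, hpz z hz, hqz z hz, eval_add, mul_add]
  | smul c f _ hf =>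
    obtain ⟨p, hp, hp1, hpz⟩ := hf
    refine ⟨c • p, (natDegree_smul_le c p).trans hp, by simp [hp1], fun z hz => ?_⟩
    rw [ContinuousMap.smul_apply, hpz z hz, eval_smul, smul_eq_mul, smul_eq_mul]
    ring

/-- The antipodal map of the circle. -/
def circleNeg : C(Circle, Circle) := ⟨fun z => -z, continuous_neg⟩

lemma monomial_comp_circleNeg (i j : ℕ) : (circleRe ^ i * circleIm ^ j).comp circleNeg
    = (-1 : ℝ) ^ (i + j) • (circleRe ^ i * circleIm ^ j) := by
  ext z
  simp only [ContinuousMap.comp_apply, ContinuousMap.mul_apply, ContinuousMap.pow_apply,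
    ContinuousMap.smul_apply, circleRe_apply, circleIm_apply, smul_eq_mul]
  simp only [circleNeg, ContinuousMap.coe_mk, Circle.coe_neg, Complex.neg_re, Complex.neg_im]
  rw [neg_pow, neg_pow (z : ℂ).im, pow_add]
  ring

lemma apply_neg_of_mem_homogeneousOnCircle {n : ℕ} {h : C(Circle, ℝ)}
    (hh : h ∈ homogeneousOnCircle n) (z : Circle) : h (-z) = (-1 : ℝ) ^ n * h z := by
  induction hh using Submodule.span_induction with
  | mem h hh =>
    obtain ⟨i, j, rfl, rfl⟩ := hh
    exact DFunLike.congr_fun (monomial_comp_circleNeg i j) z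
  | zero => simp
  | add f g _ _ hf hg => rw [ContinuousMap.add_apply, hf, hg, ContinuousMap.add_apply, mul_add]
  | smul c f _ hf =>
    rw [ContinuousMap.smul_apply, hf, ContinuousMap.smul_apply, smul_eq_mul, smul_eq_mul,
      mul_left_comm]

/-- The part of parity `n` of a polynomial in the coordinates is homogeneous of degree `n` on the
circle, for large `n`. -/
lemma eventually_parityPart_mem_homogeneousOnCircle {h : C(Circle, ℝ)}
    (hh : h ∈ Algebra.adjoin ℝ {circleRe, circleIm}) :
    ∀ᶠ n : ℕ in atTop, (2⁻¹ : ℝ) • (h + (-1 : ℝ) ^ n • h.comp circleNeg)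
      ∈ homogeneousOnCircle n := by
  rw [← Subalgebra.mem_toSubmodule, Algebra.adjoin_eq_span] at hh
  induction hh using Submodule.span_induction with
  | mem h hh =>
    obtain ⟨i, j, rfl⟩ := (Submonoid.mem_closure_pair _ _ _).1 hh
    filter_upwards [eventually_ge_atTop (i + j)] with n hn
    rw [monomial_comp_circleNeg]
    obtain ⟨k, rfl⟩ := Nat.exists_eq_add_of_le hn
    rcases Nat.even_or_odd' k with ⟨l, rfl | rfl⟩
    · refine Submodule.smul_mem _ _ (add_mem ?_ (Submodule.smul_mem _ _ (Submodule.smul_mem _ _ ?_)))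
        <;> exact homogeneousOnCircle_le_add_two_mul _ l (monomial_mem_homogeneousOnCircle i j)
    · have h1 : (-1 : ℝ) ^ (i + j + (2 * l + 1)) * (-1 : ℝ) ^ (i + j) = -1 := by
        rw [← pow_add]
        exact Odd.neg_one_pow ⟨i + j + l, by ring⟩
      rw [smul_smul, h1, neg_one_smul, add_neg_cancel, smul_zero]
      exact zero_mem _
  | zero =>
    refine Eventually.of_forall fun n => ?_
    convert zero_mem (homogeneousOnCircle n)
    ext z
    simp
  | add f g _ _ hf hg =>
    filter_upwards [hf, hg] with n h1 h2
    convert add_mem h1 h2 using 1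
    ext z
    simp
    ring
  | smul c f _ hf =>
    filter_upwards [hf] with n h1
    convert Submodule.smul_mem _ c h1 using 1
    ext z
    simp
    ring

lemma separatesPoints_adjoin_circleRe_circleIm :
    (Algebra.adjoin ℝ {circleRe, circleIm}).SeparatesPoints := by
  intro z w hzw
  by_cases hre : circleRe z = circleRe w
  · refine ⟨circleIm, ⟨circleIm, Algebra.subset_adjoin (by simp), rfl⟩, fun him => hzw ?_⟩
    exact Circle.ext (Complex.ext hre him)
  · exact ⟨circleRe, ⟨circleRe, Algebra.subset_adjoin (by simp), rfl⟩, hre⟩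

/-- Continuous functions on the circle of given parity are approximated by homogeneous
polynomials of any sufficiently large degree of that parity. -/
lemma eventually_exists_homogeneousOnCircle_near {G : C(Circle, ℝ)} {ε : ℝ}
    (hε : ∀ z, G (-z) = ε * G z) (hε' : ε * ε = 1) {δ : ℝ} (hδ : 0 < δ) :
    ∀ᶠ n : ℕ in atTop, (-1 : ℝ) ^ n = ε →
      ∃ H ∈ homogeneousOnCircle n, H 1 = G 1 ∧ ∀ z, |H z - G z| < δ := by
  obtain ⟨⟨h, hh⟩, hhG⟩ := ContinuousMap.exists_mem_subalgebra_near_continuousMap_of_separatesPoints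
    _ separatesPoints_adjoin_circleRe_circleIm G (δ / 2) (half_pos hδ)
  have hz : ∀ z, |h z - G z| < δ / 2 := (ContinuousMap.norm_lt_iff _ (half_pos hδ)).1 hhG
  filter_upwards [eventually_parityPart_mem_homogeneousOnCircle hh] with n hn hnε
  set H : C(Circle, ℝ) := (2⁻¹ : ℝ) • (h + (-1 : ℝ) ^ n • h.comp circleNeg) with hH
  have hHz : ∀ z, |H z - G z| < δ / 2 := by
    intro z
    have h1 : H z - G z = 2⁻¹ * ((h z - G z) + ε * (h (-z) - G (-z))) := by
      have h2 : H z = 2⁻¹ * (h z + ε * h (-z)) := by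
        simp [hH, hnε, circleNeg]
        ring
      rw [h2, hε]
      linear_combination (2⁻¹ * G z) * hε'
    have habs : |ε| = 1 := by
      rcases mul_self_eq_one_iff.1 hε' with h | h <;> simp [h]
    have h3 := abs_add_le (h z - G z) (ε * (h (-z) - G (-z)))
    rw [abs_mul ε, habs, one_mul] at h3
    rw [h1, abs_mul, abs_of_pos (by norm_num : (0 : ℝ) < 2⁻¹)]
    linarith [hz z, hz (-z)]
  refine ⟨H + (G 1 - H 1) • circleRe ^ n, add_mem hn (Submodule.smul_mem _ _ ?_), ?_, fun z => ?_⟩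
  · simpa using monomial_mem_homogeneousOnCircle n 0
  · simp [circleRe_apply]
  · have hre : |circleRe z ^ n| ≤ 1 := by
      rw [abs_pow]
      refine pow_le_one₀ (abs_nonneg _) ?_
      exact (Complex.abs_re_le_norm _).trans (Circle.norm_coe z).le
    have h1 : (H + (G 1 - H 1) • circleRe ^ n) z - G z
        = (H z - G z) - (H 1 - G 1) * circleRe z ^ n := by
      simp
      ring
    rw [h1]
    have h2 := abs_sub (H z - G z) ((H 1 - G 1) * circleRe z ^ n)
    rw [abs_mul] at h2
    have h3 := mul_le_mul_of_nonneg_left hre (abs_nonneg (H 1 - G 1))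
    linarith [hHz z, hHz 1]

/-- Dividing out common complex roots does not change the associated loop. -/
lemma exists_no_common_root {m : ℕ} (n : ℕ) (p : Fin (m + 1) → ℝ[X])
    (hmonic : ∀ i, (p i).Monic) (hdeg : ∀ i, (p i).natDegree = n)
    (hreal : ∀ x : ℝ, (fun i => (p i).eval x) ≠ 0) :
    ∃ (k : ℕ) (q : Fin (m + 1) → ℝ[X]), (∀ i, (q i).Monic) ∧ (∀ i, (q i).natDegree = k) ∧
      (∀ z : ℂ, ∃ i, aeval z (q i) ≠ 0) ∧
      ∃ d : ℝ[X], ∀ i, p i = d * q i := by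
  induction n using Nat.strong_induction_on generalizing p with
  | _ n ih =>
    by_cases hz : ∀ z : ℂ, ∃ i, aeval z (p i) ≠ 0
    · exact ⟨n, p, hmonic, hdeg, hz, 1, fun i => (one_mul _).symm⟩
    · push Not at hz
      obtain ⟨z, hz⟩ := hz
      have hint : IsIntegral ℝ z := Algebra.IsIntegral.isIntegral z
      choose q hq using fun i => minpoly.dvd ℝ z (hz i)
      have hM := minpoly.monic hint
      have hqm : ∀ i, (q i).Monic := fun i => hM.of_mul_monic_left (hq i ▸ hmonic i)
      have hqd : ∀ i, (q i).natDegree = n - (minpoly ℝ z).natDegree := fun i => by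
        have := hdeg i
        rw [hq i, hM.natDegree_mul (hqm i)] at this
        omega
      have hpos := minpoly.natDegree_pos hint
      have hle : (minpoly ℝ z).natDegree ≤ n := by
        have := hdeg 0
        rw [hq 0, hM.natDegree_mul (hqm 0)] at this
        omega
      obtain ⟨k, r, hr1, hr2, hr3, d, hd⟩ := ih _ (by omega) q hqm hqd (fun x hx => hreal x (by
        funext i
        have := congrFun hx i
        simp only [Pi.zero_apply] at this ⊢
        rw [hq i, eval_mul, this, mul_zero]))
      exact ⟨k, r, hr1, hr2, hr3, minpoly ℝ z * d, fun i => by rw [hq i, hd i, mul_assoc]⟩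

/-- A based loop in `ℝP^m` lifts along `circleCot` to a map from the circle to nonzero vectors
which is either even or odd. -/
lemma exists_lift_circle {m : ℕ} (f : OmegaRP m) :
    ∃ (G : C(Circle, Fin (m + 1) → ℝ)) (ε : ℝ), ε * ε = 1 ∧ (∀ z, G (-z) = ε • G z) ∧
      (∀ i, G 1 i = 1) ∧ ∀ z, ∃ hz : G z ≠ 0, f.1 (circleCot z) = toRP m ⟨G z, hz⟩ := by
  have hq := isQuotientCoveringMap_sphereToRP m
  let φ : C(ℝ, RP m) :=
    f.1.comp ((⟨circleCot, continuous_circleCot⟩ : C(Circle, _)).comp Circle.exp)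
  have hφ : ∀ θ, φ θ = f.1 (circleCot (Circle.exp θ)) := fun _ => rfl
  obtain ⟨e₀, he₀⟩ := hq.surjective (φ 0)
  obtain ⟨Γ, ⟨-, hΓ⟩, -⟩ := hq.isCoveringMap.existsUnique_continuousMap_lifts φ 0 e₀ he₀
  have hexp : ∀ θ, Circle.exp (θ + Real.pi) = -Circle.exp θ := by
    intro θ
    refine Circle.ext ?_
    rw [Circle.exp_add, Circle.coe_mul, Circle.coe_neg, Circle.coe_exp Real.pi,
      Complex.exp_pi_mul_I, mul_neg_one]
  have hΓφ : ∀ θ, sphereToRP m (Γ θ) = φ θ := congrFun hΓ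
  have hφπ : ∀ θ, φ (θ + Real.pi) = φ θ := fun θ => by
    rw [hφ, hφ, hexp, circleCot_neg]
  obtain ⟨g, hg⟩ : ∃ g : Metric.sphere (0 : ℝ) 1, g • Γ 0 = Γ (0 + Real.pi) :=
    hq.apply_eq_iff_mem_orbit.1 (by rw [hΓφ, hΓφ, hφπ])
  have hΓπ : (fun θ => Γ (θ + Real.pi)) = fun θ => g • Γ θ := by
    refine hq.isCoveringMap.eq_of_comp_eq (by fun_prop) (Γ.continuous.const_smul g) ?_
      0 hg.symm
    funext θ
    change sphereToRP m (Γ (θ + Real.pi)) = sphereToRP m (g • Γ θ)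
    rw [hq.map_smul, hΓφ, hΓφ, hφπ]
  have hgg : (g : ℝ) * g = 1 := by
    have hg1 : |(g : ℝ)| = 1 := mem_sphere_zero_iff_norm.1 g.2
    rw [← abs_mul_abs_self, hg1, one_mul]
  have hΓval : ∀ θ, (Γ (θ + Real.pi) : Fin (m + 1) → ℝ) = (g : ℝ) • (Γ θ : Fin (m + 1) → ℝ) :=
    fun θ => congrArg Subtype.val (congrFun hΓπ θ)
  have hbase : basept m = sphereToRP m (Γ 0) := by
    rw [hΓφ, hφ, Circle.exp_zero, circleCot_of_im_eq_zero (by simp), f.2]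
  obtain ⟨a, ha⟩ := (Projectivization.mk_eq_mk_iff' ℝ _ _ _ _).1 hbase
  have ha0 : a ≠ 0 := by
    rintro rfl
    simpa using congrFun ha 0
  let γ : C(ℝ, Fin (m + 1) → ℝ) :=
    ⟨fun θ => a • (Γ θ : Fin (m + 1) → ℝ), (continuous_subtype_val.comp Γ.continuous).const_smul a⟩
  have hγ : ∀ θ, γ θ = a • (Γ θ : Fin (m + 1) → ℝ) := fun _ => rfl
  have hγπ : ∀ θ, γ (θ + Real.pi) = (g : ℝ) • γ θ := fun θ => by
    rw [hγ, hγ, hΓval, smul_comm]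
  have hγper : Function.Periodic γ (2 * Real.pi) := fun θ => by
    rw [two_mul, ← add_assoc, hγπ, hγπ, smul_smul, hgg, one_smul]
  have hexpq : IsQuotientMap Circle.exp :=
    isLocalHomeomorph_circleExp.isOpenMap.isQuotientMap Circle.exp.continuous Circle.exp_surjective
  have hfac : Function.FactorsThrough γ Circle.exp := by
    intro s t hst
    obtain ⟨k, rfl⟩ := Circle.exp_eq_exp.1 hst
    exact hγper.int_mul k t
  let G : C(Circle, Fin (m + 1) → ℝ) := IsQuotientMap.lift (f := Circle.exp) hexpq γ hfac
  have hG : ∀ θ, G (Circle.exp θ) = γ θ :=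
    DFunLike.congr_fun (IsQuotientMap.lift_comp (f := Circle.exp) hexpq γ hfac)
  refine ⟨G, g, hgg, fun z => ?_, fun i => ?_, fun z => ?_⟩
  · obtain ⟨θ, rfl⟩ := Circle.exp_surjective z
    rw [← hexp, hG, hG, hγπ]
  · rw [← Circle.exp_zero, hG, hγ, ha]
  · obtain ⟨θ, rfl⟩ := Circle.exp_surjective z
    have hz : G (Circle.exp θ) ≠ 0 := by
      rw [hG, hγ]
      exact smul_ne_zero ha0 (unitSphere_ne_zero _)
    refine ⟨hz, ?_⟩
    rw [← hφ, ← hΓφ]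
    exact (toRP_eq_of_smul a ((hG θ).trans (hγ θ))).symm

/-- Nowhere vanishing tuples of homogeneous polynomials on the circle, with value `(1, …, 1)` at
the point `1`, induce elements of `RRat`. -/
lemma exists_mem_RRat_of_homogeneousOnCircle {m n : ℕ}
    (H : C(Circle, {v : Fin (m + 1) → ℝ // v ≠ 0}))
    (h : Fin (m + 1) → C(Circle, ℝ)) (hH : ∀ z i, (H z).1 i = h i z)
    (hmem : ∀ i, h i ∈ homogeneousOnCircle n) (hone : ∀ i, h i 1 = 1) :
    ∃ F : OmegaRP m, F ∈ ⋃ k, RRat k m ∧ ∀ z, F.1 (circleCot z) = toRP m (H z) := by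
  choose p hdeg hcoeff hp using fun i => exists_polynomial_of_mem_homogeneousOnCircle (hmem i)
  have hcoeff' : ∀ i, (p i).coeff n = 1 := fun i => (hcoeff i).trans (hone i)
  have hmonic : ∀ i, (p i).Monic := fun i =>
    monic_of_natDegree_le_of_coeff_eq_one n (hdeg i) (hcoeff' i)
  have hdeg' : ∀ i, (p i).natDegree = n := fun i =>
    natDegree_eq_of_le_of_coeff_ne_zero (hdeg i) (by rw [hcoeff']; exact one_ne_zero)
  have hHp : ∀ z : Circle, (z : ℂ).im ≠ 0 →
      (H z).1 = (z : ℂ).im ^ n • fun i => (p i).eval ((z : ℂ).re / (z : ℂ).im) := by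
    intro z hz
    funext i
    rw [hH, hp i z hz, Pi.smul_apply, smul_eq_mul]
  have hreal : ∀ x : ℝ, (fun i => (p i).eval x) ≠ 0 := by
    intro x hx
    obtain ⟨z, hz, rfl⟩ := exists_circle_im_ne_zero x
    refine (H z).2 ?_
    rw [hHp z hz, hx, smul_zero]
  have hH_im_eq_zero : ∀ z : Circle, (z : ℂ).im = 0 → toRP m (H z) = basept m := by
    intro z hz
    refine (Projectivization.mk_eq_mk_iff' ℝ _ _ _ _).2 ?_
    rcases Circle.eq_one_or_eq_neg_one_of_im_eq_zero hz with rfl | rfl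
    · exact ⟨1, funext fun i => by simp [hH, hone]⟩
    · exact ⟨(-1) ^ n, funext fun i => by
        simp [hH, apply_neg_of_mem_homogeneousOnCircle (hmem i), hone]⟩
  have hfac : Function.FactorsThrough (fun z => toRP m (H z)) circleCot := by
    intro z w hzw
    by_cases hz : (z : ℂ).im = 0 <;> by_cases hw : (w : ℂ).im = 0
    · exact (hH_im_eq_zero z hz).trans (hH_im_eq_zero w hw).symm
    · rw [circleCot_of_im_eq_zero hz, circleCot_of_im_ne_zero hw] at hzw
      exact absurd hzw (OnePoint.infty_ne_coe _)
    · rw [circleCot_of_im_ne_zero hz, circleCot_of_im_eq_zero hw] at hzw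
      exact absurd hzw (OnePoint.coe_ne_infty _)
    · rw [circleCot_of_im_ne_zero hz, circleCot_of_im_ne_zero hw, OnePoint.coe_eq_coe] at hzw
      refine toRP_eq_of_smul ((z : ℂ).im ^ n / (w : ℂ).im ^ n) ?_
      rw [hHp z hz, hHp w hw, hzw, smul_smul, div_mul_cancel₀ _ (pow_ne_zero n hw)]
  let c : C(Circle, OnePoint ℝ) := ⟨circleCot, continuous_circleCot⟩
  have hc : IsQuotientMap c := isQuotientMap_circleCot
  let ψ : C(Circle, RP m) :=
    ⟨fun z => toRP m (H z), (isQuotientMap_toRP m).continuous.comp H.continuous⟩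
  let F : C(OnePoint ℝ, RP m) := IsQuotientMap.lift (f := c) hc ψ hfac
  have hF : ∀ z, F (circleCot z) = toRP m (H z) :=
    DFunLike.congr_fun (IsQuotientMap.lift_comp (f := c) hc ψ hfac)
  have hFinf : F ∞ = basept m := by
    rw [← circleCot_of_im_eq_zero (z := 1) (by simp), hF, hH_im_eq_zero 1 (by simp)]
  refine ⟨⟨F, hFinf⟩, ?_, hF⟩
  obtain ⟨k, q, hq1, hq2, hq3, d, hd⟩ := exists_no_common_root n p hmonic hdeg' hreal
  refine Set.mem_iUnion.2 ⟨k, q, hq1, hq2, hq3, fun x => ?_⟩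
  have hpq : (fun i => (p i).eval x) = d.eval x • fun i => (q i).eval x := by
    funext i
    rw [hd i, eval_mul, Pi.smul_apply, smul_eq_mul]
  have hqx : (fun i => (q i).eval x) ≠ 0 := by
    intro h0
    exact hreal x (by rw [hpq, h0, smul_zero])
  refine ⟨hqx, ?_⟩
  obtain ⟨z, hz, rfl⟩ := exists_circle_im_ne_zero x
  change F _ = _
  rw [← circleCot_of_im_ne_zero hz, hF]
  refine toRP_eq_of_smul (w := ⟨_, hqx⟩) ((z : ℂ).im ^ n * d.eval ((z : ℂ).re / (z : ℂ).im)) ?_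
  rw [hHp z hz, hpq, smul_smul]

/-- For every `m ≥ 1`, the union of the sets `RRat(n,m)` over all `n ≥ 0`
is dense in the based loop space `Ω ℝP^m`. -/
theorem rrat_union_dense (m : ℕ) (hm : 1 ≤ m) :
    Dense (⋃ n : ℕ, RRat n m) := by
  intro f
  rw [mem_closure_iff]
  intro W hW hfW
  obtain ⟨G, ε, hε, hGneg, hG1, hG⟩ := exists_lift_circle f
  choose hG0 hGf using hG
  let c : C(Circle, OnePoint ℝ) := ⟨circleCot, continuous_circleCot⟩
  have hind : IsInducing fun F : OmegaRP m => F.1.comp c :=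
    (isInducing_precomp_of_surjective c surjective_circleCot).comp IsInducing.subtypeVal
  obtain ⟨W', hW', rfl⟩ := hind.isOpen_iff.1 hW
  let π : C({v : Fin (m + 1) → ℝ // v ≠ 0}, RP m) := ⟨toRP m, (isQuotientMap_toRP m).continuous⟩
  let ι : C({v : Fin (m + 1) → ℝ // v ≠ 0}, Fin (m + 1) → ℝ) :=
    ⟨Subtype.val, continuous_subtype_val⟩
  have hι : IsInducing (ContinuousMap.comp ι :
      C(Circle, {v : Fin (m + 1) → ℝ // v ≠ 0}) → C(Circle, Fin (m + 1) → ℝ)) :=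
    ContinuousMap.isInducing_postcomp ι IsInducing.subtypeVal
  obtain ⟨U, hU, hUW⟩ := hι.isOpen_iff.1 (hW'.preimage (ContinuousMap.continuous_postcomp π))
  let G' : C(Circle, {v : Fin (m + 1) → ℝ // v ≠ 0}) :=
    ⟨fun z => ⟨G z, hG0 z⟩, G.continuous.subtype_mk _⟩
  have hGU : G ∈ U := by
    have : G' ∈ ContinuousMap.comp ι ⁻¹' U := by
      rw [hUW]
      have : π.comp G' = f.1.comp c := ContinuousMap.ext fun z => (hGf z).symm
      rwa [Set.mem_preimage, this]
    exact this
  obtain ⟨δ, hδ, hball⟩ := Metric.isOpen_iff.1 hU G hGU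
  obtain ⟨μ, hμ, hμG⟩ : ∃ μ : ℝ, 0 < μ ∧ ∀ z, μ ≤ ‖G z‖ := by
    obtain ⟨z, -, hz⟩ := isCompact_univ.exists_isMinOn (Set.univ_nonempty (α := Circle))
      G.continuous.norm.continuousOn
    exact ⟨‖G z‖, norm_pos_iff.2 (hG0 z), fun w => hz (Set.mem_univ w)⟩
  have hev : ∀ᶠ n : ℕ in atTop, ∀ i, (-1 : ℝ) ^ n = ε → ∃ H ∈ homogeneousOnCircle n,
      H 1 = G 1 i ∧ ∀ z, |H z - G z i| < min δ μ := by
    refine eventually_all.2 fun i => ?_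
    exact eventually_exists_homogeneousOnCircle_near (G := ⟨fun z => G z i, by fun_prop⟩)
      (fun z => congrFun (hGneg z) i) hε (lt_min hδ hμ)
  obtain ⟨N, hN⟩ := eventually_atTop.1 hev
  obtain ⟨n, hn, hnε⟩ : ∃ n ≥ N, (-1 : ℝ) ^ n = ε := by
    rcases mul_self_eq_one_iff.1 hε with rfl | rfl
    · exact ⟨2 * N, by omega, Even.neg_one_pow ⟨N, by ring⟩⟩
    · exact ⟨2 * N + 1, by omega, Odd.neg_one_pow ⟨N, rfl⟩⟩
  choose h hmem hone hnear using fun i => hN n hn i hnε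
  let H : C(Circle, Fin (m + 1) → ℝ) := ⟨fun z i => h i z, by fun_prop⟩
  have hdist : ∀ z, dist (H z) (G z) < min δ μ := fun z =>
    (dist_pi_lt_iff (lt_min hδ hμ)).2 fun i => hnear i z
  have hH0 : ∀ z, H z ≠ 0 := by
    intro z hz
    have := (hdist z).trans_le (min_le_right _ _)
    rw [hz, dist_zero_left] at this
    exact this.not_ge (hμG z)
  let H' : C(Circle, {v : Fin (m + 1) → ℝ // v ≠ 0}) :=
    ⟨fun z => ⟨H z, hH0 z⟩, H.continuous.subtype_mk _⟩
  obtain ⟨F, hFmem, hF⟩ := exists_mem_RRat_of_homogeneousOnCircle H' h (fun _ _ => rfl) hmem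
    fun i => (hone i).trans (hG1 i)
  refine ⟨F, ?_, hFmem⟩
  have hHU : H ∈ U := hball ((ContinuousMap.dist_lt_iff hδ).2 fun z =>
    (hdist z).trans_le (min_le_left _ _))
  have hHW : π.comp H' ∈ W' := by
    have : H' ∈ ContinuousMap.comp ι ⁻¹' U := hHU
    rwa [hUW] at this
  have hFH : F.1.comp c = π.comp H' := ContinuousMap.ext hF
  rwa [Set.mem_preimage, hFH]

end
end
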